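/- A finite projective plane P is Desarguesian — i.e., isomorphic to the projective plane of a 3-dimensional vector space over a finite field F (points the 1-dimensional subspaces of F³, lines the 2-dimensional subspaces, incidence given by inclusion) — if and only if the automorphism group of P acts transitively on the anti-flags of P. -/

import Mathlib

/-- A point-line incidence relation `I` is a projective plane if any two distinct
points lie on a unique common line, any two distinct lines meet in a unique point,
and there exist four points no three of which are incident with a common line. -/
structure IsProjectivePlane {P L : Type*} (I : P → L → Prop) : Prop where
  line_unique : ∀ p q : P, p ≠ q → ∃! M : L, I p M ∧ I q M
  point_unique : ∀ M N : L, M ≠ N → ∃! p : P, I p M ∧ I p N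
  nondeg : ∃ a b c d : P, a ≠ b ∧ a ≠ c ∧ a ≠ d ∧ b ≠ c ∧ b ≠ d ∧ c ≠ d ∧
    ∀ M : L, ¬(I a M ∧ I b M ∧ I c M) ∧ ¬(I a M ∧ I b M ∧ I d M) ∧
      ¬(I a M ∧ I c M ∧ I d M) ∧ ¬(I b M ∧ I c M ∧ I d M)

/-- The incidence structure `(P, L, I)` is isomorphic to the projective plane of the
3-dimensional vector space `F³` over the field `F`: points are the 1-dimensional
subspaces of `F³`, lines are the 2-dimensional subspaces, and incidence is inclusion. -/
def IsDesarguesianOver (F : Type) [Field F] {P L : Type*} (I : P → L → Prop) : Prop :=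
  ∃ (σ : P ≃ {V : Submodule F (Fin 3 → F) // Module.finrank F V = 1})
    (τ : L ≃ {W : Submodule F (Fin 3 → F) // Module.finrank F W = 2}),
    ∀ (p : P) (M : L), I p M ↔ (σ p : Submodule F (Fin 3 → F)) ≤ (τ M : Submodule F (Fin 3 → F))


set_option linter.unusedSectionVars false
set_option linter.unusedVariables false
namespace AF

/-- Working form of the projective plane axioms. -/
structure PP {P L : Type*} (I : P → L → Prop) : Prop where
  ln : ∀ p q : P, ∃ l : L, I p l ∧ I q l
  pt : ∀ l m : L, ∃ p : P, I p l ∧ I p m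
  uq : ∀ {p q : P} {l m : L}, I p l → I q l → I p m → I q m → p = q ∨ l = m
  nd : ∃ (p1 p2 p3 : P) (l1 l2 l3 : L), ¬ I p1 l2 ∧ ¬ I p1 l3 ∧ ¬ I p2 l1 ∧ I p2 l2 ∧ I p2 l3 ∧
    ¬ I p3 l1 ∧ I p3 l2 ∧ ¬ I p3 l3

theorem PP.dual {P L : Type*} {I : P → L → Prop} (h : PP I) : PP (fun l p => I p l) where
  ln := h.pt
  pt := h.ln
  uq := fun h1 h2 h3 h4 => (h.uq h1 h3 h2 h4).symm
  nd := by
    obtain ⟨p1, p2, p3, l1, l2, l3, a1, a2, a3, a4, a5, a6, a7, a8⟩ := h.nd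
    exact ⟨l1, l2, l3, p1, p2, p3, a3, a6, a1, a4, a7, a2, a5, a8⟩

/-- A projective plane together with its order and the basic counts. -/
structure Plane {P L : Type*} (I : P → L → Prop) (n : ℕ) : Prop extends PP I where
  two_le : 2 ≤ n
  line_card : ∀ l, {p | I p l}.ncard = n + 1
  point_card : ∀ p, {l | I p l}.ncard = n + 1
  cardP : Nat.card P = n ^ 2 + n + 1
  cardL : Nat.card L = n ^ 2 + n + 1

theorem Plane.dual {P L : Type*} {I : P → L → Prop} {n : ℕ} (h : Plane I n) :
    Plane (fun l p => I p l) n where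
  toPP := h.toPP.dual
  two_le := h.two_le
  line_card := h.point_card
  point_card := h.line_card
  cardP := h.cardL
  cardL := h.cardP

theorem PP.exists_plane {P L : Type*} [Finite P] [Finite L] {I : P → L → Prop} (h : PP I) :
    ∃ n, Plane I n := by
  classical
  have := Fintype.ofFinite P
  have := Fintype.ofFinite L
  choose ln hln using h.ln
  choose pt hpt using h.pt
  let : Membership P L := ⟨fun l p => I p l⟩
  obtain ⟨q1, q2, q3, k1, k2, k3, a1, a2, a3, a4, a5, a6, a7, a8⟩ := h.nd
  let : Configuration.ProjectivePlane P L :=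
    { exists_point := by
        intro l
        by_contra hc
        push Not at hc
        rcases h.uq a4 a7 (hc q2) (hc q3) with e | e
        · subst e; exact a8 a5
        · subst e; exact a1 (hc q1)
      exists_line := by
        intro p
        by_contra hc
        push Not at hc
        rcases h.uq a4 (hc k2) a5 (hc k3) with e | e
        · subst e; exact a3 (hc k1)
        · subst e; exact a8 a7
      eq_or_eq := fun h1 h2 h3 h4 => h.uq h1 h2 h3 h4
      mkPoint := fun {l m} _ => pt l m
      mkPoint_ax := fun {l m} _ => hpt l m
      mkLine := fun {l m} _ => ln l m
      mkLine_ax := fun {l m} _ => hln l m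
      exists_config := h.nd }
  refine ⟨Configuration.ProjectivePlane.order P L, ⟨h, ?_, ?_, ?_, ?_, ?_⟩⟩
  · exact Configuration.ProjectivePlane.one_lt_order P L
  · intro l
    exact Configuration.ProjectivePlane.pointCount_eq P l
  · intro l
    exact Configuration.ProjectivePlane.lineCount_eq L l
  · rw [Nat.card_eq_fintype_card]; exact Configuration.ProjectivePlane.card_points P L
  · rw [Nat.card_eq_fintype_card]; exact Configuration.ProjectivePlane.card_lines P L


theorem PP.of_isPP {P L : Type*} {I : P → L → Prop} (h : IsProjectivePlane I) : PP I := by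
  have uq : ∀ {p q : P} {l m : L}, I p l → I q l → I p m → I q m → p = q ∨ l = m := by
    intro p q l m h1 h2 h3 h4
    by_contra hc
    push Not at hc
    exact hc.2 ((h.line_unique p q hc.1).unique ⟨h1, h2⟩ ⟨h3, h4⟩)
  obtain ⟨a, b, c, d, hab, hac, had, hbc, hbd, hcd, hM⟩ := h.nondeg
  obtain ⟨bc, h1, -⟩ := h.line_unique b c hbc
  obtain ⟨bd, h2, -⟩ := h.line_unique b d hbd
  obtain ⟨ad, h3, -⟩ := h.line_unique a d had
  have e1 := hM bc
  have e2 := hM bd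
  have e3 := hM ad
  refine ⟨?_, ?_, uq, a, b, c, ad, bc, bd, ?_⟩
  · intro p q
    by_cases hp : p = q
    · subst hp
      by_cases hpa : p = a
      · subst hpa
        exact ⟨ad, h3.1, h3.1⟩
      · obtain ⟨l, hl, -⟩ := h.line_unique p a hpa
        exact ⟨l, hl.1, hl.1⟩
    · obtain ⟨l, hl, -⟩ := h.line_unique p q hp
      exact ⟨l, hl⟩
  · intro l m
    by_cases hp : l = m
    · subst hp
      by_cases hpa : l = ad
      · subst hpa
        exact ⟨a, h3.1, h3.1⟩
      · obtain ⟨p, hl, -⟩ := h.point_unique l ad hpa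
        exact ⟨p, hl.1, hl.1⟩
    · obtain ⟨p, hl, -⟩ := h.point_unique l m hp
      exact ⟨p, hl⟩
  · exact ⟨fun h => e1.1 ⟨h, h1⟩, fun h => e2.2.1 ⟨h, h2⟩, fun h => e3.2.1 ⟨h3.1, h, h3.2⟩, h1.1, h2.1,
      fun h => e3.2.2.1 ⟨h3.1, h, h3.2⟩, h1.2, fun h => e2.2.2.2 ⟨h2.1, h, h2.2⟩⟩

section basics
variable {P L : Type*} {I : P → L → Prop} {n : ℕ}

theorem PP.eqL (h : PP I) {p q : P} {l m : L} (hpq : p ≠ q) (h1 : I p l) (h2 : I q l) (h3 : I p m)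
    (h4 : I q m) : l = m := (h.uq h1 h2 h3 h4).resolve_left hpq

theorem PP.eqP (h : PP I) {p q : P} {l m : L} (hlm : l ≠ m) (h1 : I p l) (h2 : I p m) (h3 : I q l)
    (h4 : I q m) : p = q := (h.uq h1 h3 h2 h4).resolve_right hlm

variable [Finite P] [Finite L]

/-- a point on `l` outside a given pair -/
theorem Plane.pt_on (h : Plane I n) (l : L) (x y : P) : ∃ p, I p l ∧ p ≠ x ∧ p ≠ y := by
  have h1 := h.line_card l
  have h2 := h.two_le
  by_contra hc
  push Not at hc
  have : {p | I p l} ⊆ {x, y} := by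
    intro p hp
    by_cases e : p = x
    · simp [e]
    · simp [hc p hp e]
  have h3 := Set.ncard_le_ncard this
  have h4 := Set.ncard_insert_le x {y}
  rw [Set.ncard_singleton] at h4
  omega

theorem Plane.ln_on (h : Plane I n) (p : P) (x y : L) : ∃ l, I p l ∧ l ≠ x ∧ l ≠ y :=
  h.dual.pt_on p x y

theorem Plane.pt_off (h : Plane I n) (l m : L) : ∃ p, ¬ I p l ∧ ¬ I p m := by
  by_cases e : l = m
  · subst e
    obtain ⟨p1, p2, p3, l1, l2, l3, a1, a2, a3, a4, a5, a6, a7, a8⟩ := h.nd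
    by_cases c1 : I p1 l
    · by_cases c2 : I p2 l
      · refine ⟨p3, fun c3 => ?_, fun c3 => ?_⟩ <;>
        · rcases h.uq c2 c3 a4 a7 with e | e
          · subst e; exact a8 a5
          · subst e; exact a1 c1
      · exact ⟨p2, c2, c2⟩
    · exact ⟨p1, c1, c1⟩
  · obtain ⟨x, hx1, hx2⟩ := h.pt l m
    obtain ⟨p, hp, hpx, -⟩ := h.pt_on l x x
    obtain ⟨q, hq, hqx, -⟩ := h.pt_on m x x
    have hpm : ¬ I p m := fun hc => hpx (h.eqP e hp hc hx1 hx2)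
    have hql : ¬ I q l := fun hc => hqx (h.eqP e hc hq hx1 hx2)
    obtain ⟨k, hpk, hqk⟩ := h.ln p q
    obtain ⟨r, hr, hrp, hrq⟩ := h.pt_on k p q
    refine ⟨r, fun hc => ?_, fun hc => ?_⟩
    · have := h.eqL hrp hr hpk hc hp
      subst this; exact hql hqk
    · have := h.eqL hrq hr hqk hc hq
      subst this; exact hpm hpk

theorem Plane.ln_off (h : Plane I n) (p q : P) : ∃ l, ¬ I p l ∧ ¬ I q l :=
  h.dual.pt_off p q

theorem Plane.line_pt (h : Plane I n) (l : L) : ∃ p, I p l := by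
  obtain ⟨p, hp, -⟩ := h.pt l l
  exact ⟨p, hp⟩

/-- a fourth point: given a line `l`, a point `o` off `l` and `a` on `l`. -/
theorem Plane.pt_ne_ln (h : Plane I n) {l m : L} (hlm : l ≠ m) : ∃ p, I p l ∧ ¬ I p m := by
  obtain ⟨x, hx1, hx2⟩ := h.pt l m
  obtain ⟨p, hp, hpx, -⟩ := h.pt_on l x x
  exact ⟨p, hp, fun hc => hpx (h.eqP hlm hp hc hx1 hx2)⟩

theorem Plane.ln_ne_pt (h : Plane I n) {p q : P} (hlm : p ≠ q) : ∃ l, I p l ∧ ¬ I q l :=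
  h.dual.pt_ne_ln hlm

theorem Plane.card_off (h : Plane I n) (l : L) : {p | ¬ I p l}.ncard = n ^ 2 := by
  have h1 := Set.ncard_add_ncard_compl {p | I p l}
  rw [h.line_card, h.cardP] at h1
  have : {p | I p l}ᶜ = {p | ¬ I p l} := rfl
  rw [this] at h1
  omega

theorem Plane.card_diff (h : Plane I n) {l : L} {z : P} (hz : I z l) :
    {p | I p l ∧ p ≠ z}.ncard = n := by
  have h1 := Set.ncard_sdiff_singleton_add_one (s := {p | I p l}) (a := z) hz
  rw [h.line_card] at h1
  have : {p | I p l ∧ p ≠ z} = {p | I p l} \ {z} := by ext; simp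
  rw [this]; omega

theorem Plane.card_diff2 (h : Plane I n) {l : L} {z : P} (hz : I z l) :
    {m | I z m ∧ m ≠ l}.ncard = n := h.dual.card_diff hz

end basics

end AF
namespace AF

/-- `G` acts by collineations. -/
def Pres (G : Type*) [Group G] {P L : Type*} [MulAction G P] [MulAction G L] (I : P → L → Prop) :
    Prop := ∀ (g : G) (p : P) (l : L), I p l → I (g • p) (g • l)

/-- antiflag transitive -/
def AFT (G : Type*) [Group G] {P L : Type*} [MulAction G P] [MulAction G L] (I : P → L → Prop) :
    Prop := ∀ (p : P) (l : L) (p' : P) (l' : L), ¬ I p l → ¬ I p' l' →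
      ∃ g : G, g • p = p' ∧ g • l = l'

/-- two-transitive -/
def TT (G P : Type*) [Group G] [MulAction G P] : Prop :=
  ∀ a b a' b' : P, a ≠ b → a' ≠ b' → ∃ g : G, g • a = a' ∧ g • b = b'

section act
variable {G P L : Type*} [Group G] [MulAction G P] [MulAction G L] {I : P → L → Prop} {n : ℕ}

theorem Pres.dual (h : Pres G I) : Pres G (fun l p => I p l) := fun g l p => h g p l

theorem AFT.dual (h : AFT G I) : AFT G (fun l p => I p l) := fun l p l' p' h1 h2 => by
  obtain ⟨g, h1, h2⟩ := h p l p' l' h1 h2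
  exact ⟨g, h2, h1⟩

theorem Pres.iff (h : Pres G I) {g : G} {p : P} {l : L} : I (g • p) (g • l) ↔ I p l :=
  ⟨fun h1 => by simpa using h g⁻¹ _ _ h1, h g p l⟩

theorem Pres.sub (h : Pres G I) (H : Subgroup G) : Pres H I := fun g p l => h (g : G) p l

theorem Pres.fixP (h : Pres G I) {g : G} {p : P} {l : L} (hl : g • l = l) (hp : I p l) :
    I (g • p) l := by
  have := h g p l hp
  rwa [hl] at this

theorem Pres.fixP' (h : Pres G I) {g : G} {p : P} {l : L} (hl : g • l = l) :
    I (g • p) l ↔ I p l := by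
  have := h.iff (g := g) (p := p) (l := l)
  rwa [hl] at this

theorem Pres.fixL (h : Pres G I) {g : G} {p : P} {l : L} (hl : g • p = p) (hp : I p l) :
    I p (g • l) := by
  have := h g p l hp
  rwa [hl] at this

theorem Pres.fixL' (h : Pres G I) {g : G} {p : P} {l : L} (hl : g • p = p) :
    I p (g • l) ↔ I p l := by
  have := h.iff (g := g) (p := p) (l := l)
  rwa [hl] at this

/-- the line through two fixed points is fixed -/
theorem PP.fix_line (hp : PP I) (h : Pres G I) {g : G} {p q : P} {l : L} (hpq : p ≠ q)
    (h1 : I p l) (h2 : I q l) (e1 : g • p = p) (e2 : g • q = q) : g • l = l :=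
  hp.eqL hpq (h.fixL e1 h1) (h.fixL e2 h2) h1 h2

theorem PP.fix_pt (hp : PP I) (h : Pres G I) {g : G} {p : P} {l m : L} (hlm : l ≠ m)
    (h1 : I p l) (h2 : I p m) (e1 : g • l = l) (e2 : g • m = m) : g • p = p :=
  hp.eqP hlm (h.fixP e1 h1) (h.fixP e2 h2) h1 h2

variable [Finite P] [Finite L]

theorem Plane.count_aux (hP : Plane I n) (h : Pres G I) (g : G) [Fintype P] [Fintype L]
    [DecidableEq P] [DecidableEq L]
    [DecidableRel (fun (l : L) (p : P) => I p l ∧ I p (g • l))] (l : L) :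
    (Finset.univ.bipartiteAbove (fun (l : L) (p : P) => I p l ∧ I p (g • l)) l).card
      = 1 + n * (if g • l = l then 1 else 0) := by
  have : ((Finset.univ.bipartiteAbove (fun (l : L) (p : P) => I p l ∧ I p (g • l)) l) : Set P)
      = {p | I p l ∧ I p (g • l)} := by
    ext p; simp [Finset.bipartiteAbove]
  rw [← Set.ncard_coe_finset, this]
  split_ifs with e
  · rw [e]; simp only [and_self]; rw [hP.line_card]; ring
  · obtain ⟨x, hx1, hx2⟩ := hP.pt l (g • l)
    have : {p | I p l ∧ I p (g • l)} = {x} := by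
      ext p
      constructor
      · rintro ⟨h1, h2⟩
        exact hP.eqP (fun hc => e hc.symm) h1 h2 hx1 hx2
      · rintro rfl
        exact ⟨hx1, hx2⟩
    rw [this]; simp

theorem Plane.card_fixed (hP : Plane I n) (h : Pres G I) (g : G) :
    {p : P | g • p = p}.ncard = {l : L | g • l = l}.ncard := by
  classical
  have := Fintype.ofFinite P
  have := Fintype.ofFinite L
  have h1 := Finset.sum_card_bipartiteAbove_eq_sum_card_bipartiteBelow
    (s := (Finset.univ : Finset L)) (t := (Finset.univ : Finset P))
    (fun (l : L) (p : P) => I p l ∧ I p (g • l))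
  have h2 : ∀ p : P, (Finset.univ.bipartiteBelow (fun (l : L) (p : P) => I p l ∧ I p (g • l)) p).card
      = 1 + n * (if g⁻¹ • p = p then 1 else 0) := by
    intro p
    rw [← hP.dual.count_aux h.dual g⁻¹ p]
    congr 1
    ext l
    simp only [Finset.mem_bipartiteBelow, Finset.mem_bipartiteAbove, Finset.mem_univ, true_and]
    have := h.iff (g := g⁻¹) (p := p) (l := g • l)
    rw [inv_smul_smul] at this
    rw [this]
  simp only [hP.count_aux h g, h2, Finset.sum_add_distrib, ← Finset.mul_sum] at h1
  simp only [Finset.sum_const, Finset.card_univ, smul_eq_mul, mul_one, ← Nat.card_eq_fintype_card,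
    hP.cardP, hP.cardL, Finset.sum_boole] at h1
  have hn := hP.two_le
  have h3 := Nat.eq_of_mul_eq_mul_left (by omega) (Nat.add_left_cancel h1)
  have e1 : {p : P | g • p = p} = ((Finset.univ.filter (fun p : P => g⁻¹ • p = p) : Finset P) : Set P) := by
    ext p
    simp only [Set.mem_ofPred_eq, Finset.coe_filter, Finset.mem_univ, true_and]
    rw [inv_smul_eq_iff]; exact eq_comm
  have e2 : {p : L | g • p = p} = ((Finset.univ.filter (fun p : L => g • p = p) : Finset L) : Set L) := by
    ext p; simp
  rw [e1, e2, Set.ncard_coe_finset, Set.ncard_coe_finset]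
  simpa using h3.symm

theorem Plane.card_orbits [Finite G] (hP : Plane I n) (h : Pres G I) :
    Nat.card (MulAction.orbitRel.Quotient G P) = Nat.card (MulAction.orbitRel.Quotient G L) := by
  classical
  have := Fintype.ofFinite P
  have := Fintype.ofFinite L
  have := Fintype.ofFinite G
  have := Fintype.ofFinite (MulAction.orbitRel.Quotient G P)
  have := Fintype.ofFinite (MulAction.orbitRel.Quotient G L)
  have h1 := MulAction.sum_card_fixedBy_eq_card_orbits_mul_card_group G P
  have h2 := MulAction.sum_card_fixedBy_eq_card_orbits_mul_card_group G L
  have h3 : ∀ g : G, Fintype.card (MulAction.fixedBy P g) = Fintype.card (MulAction.fixedBy L g) := by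
    intro g
    rw [← Nat.card_eq_fintype_card, ← Nat.card_eq_fintype_card]
    exact hP.card_fixed h g
  simp only [h3] at h1
  rw [h1] at h2
  rw [Nat.card_eq_fintype_card, Nat.card_eq_fintype_card]
  exact Nat.eq_of_mul_eq_mul_right Fintype.card_pos h2

/-- the stabilizer of a flag is transitive on the other lines through the point -/
theorem Plane.star [Finite G] (hP : Plane I n) (h : Pres G I) (ht : AFT G I) {l m m' : L} {z : P}
    (hz : I z l) (hm : I z m) (hm' : I z m') (e : m ≠ l) (e' : m' ≠ l) :
    ∃ g : G, g • l = l ∧ g • z = z ∧ g • m = m' := by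
  classical
  let H := MulAction.stabilizer G l
  have hH : ∀ g : H, g • l = l := fun g => g.2
  have hc := hP.card_orbits (h.sub H)
  obtain ⟨o, ho, -⟩ := hP.pt_off l l
  choose pt hpt using hP.pt
  let f : MulAction.orbitRel.Quotient H L → MulAction.orbitRel.Quotient H P := fun a =>
    if a.out = l then Quotient.mk'' o else Quotient.mk'' (pt a.out l)
  have key : ∀ (m : L) (z : P), I z m → I z l → m ≠ l → f (Quotient.mk'' m) = Quotient.mk'' z := by
    intro m z h1 h2 h3
    have h4 : (Quotient.mk'' m : MulAction.orbitRel.Quotient H L).out ∈ MulAction.orbit H m := by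
      rw [← MulAction.orbitRel_apply]
      exact Quotient.mk_out m
    obtain ⟨g, hg⟩ := h4
    simp only at hg
    have h5 : g • m ≠ l := fun hc => h3 (smul_left_cancel g (hc.trans (hH g).symm))
    simp only [f]
    rw [← hg, if_neg h5]
    apply Quotient.sound
    show (MulAction.orbitRel H P) _ _
    rw [MulAction.orbitRel_apply]
    refine ⟨g, ?_⟩
    exact hP.eqP h5 (h g z m h1) (h.fixP (hH g) h2) (hpt _ _).1 (hpt _ _).2
  have surj : Function.Surjective f := by
    intro a
    induction a using Quotient.inductionOn' with
    | h x =>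
      by_cases hx : I x l
      · obtain ⟨m, hm, hml, -⟩ := hP.ln_on x l l
        exact ⟨_, key m x hm hx hml⟩
      · refine ⟨Quotient.mk'' l, ?_⟩
        have h4 : (Quotient.mk'' l : MulAction.orbitRel.Quotient H L).out ∈ MulAction.orbit H l := by
          rw [← MulAction.orbitRel_apply]
          exact Quotient.mk_out l
        obtain ⟨g, hg⟩ := h4
        simp only [hH] at hg
        simp only [f]
        rw [← hg, if_pos rfl]
        apply Quotient.sound
        show (MulAction.orbitRel H P) _ _
        rw [MulAction.orbitRel_apply]
        obtain ⟨g, h1, h2⟩ := ht x l o l hx ho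
        exact ⟨⟨g, h2⟩, h1⟩
  have inj := (Function.Surjective.bijective_of_nat_card_le surj hc.ge).1
  have := inj ((key m z hm hz e).trans (key m' z hm' hz e').symm)
  have h6 := Quotient.exact this
  change (MulAction.orbitRel H L) _ _ at h6
  rw [MulAction.orbitRel_apply] at h6
  obtain ⟨g, hg⟩ := h6
  have hg : g • m' = m := hg
  refine ⟨(g : G)⁻¹, ?_, ?_, ?_⟩
  · rw [inv_smul_eq_iff]; exact (hH g).symm
  · rw [inv_smul_eq_iff]; refine (hP.eqP e ?_ ?_ hm hz).symm
    · rw [← hg]; exact h g _ _ hm'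
    · exact h.fixP (hH g) hz
  · rw [inv_smul_eq_iff]; exact hg.symm

theorem Plane.star' [Finite G] (hP : Plane I n) (h : Pres G I) (ht : AFT G I) {l : L} {x x' z : P}
    (hz : I z l) (hm : I x l) (hm' : I x' l) (e : x ≠ z) (e' : x' ≠ z) :
    ∃ g : G, g • l = l ∧ g • z = z ∧ g • x = x' := by
  obtain ⟨g, h1, h2, h3⟩ := hP.dual.star h.dual ht.dual hz hm hm' e e'
  exact ⟨g, h2, h1, h3⟩

theorem Plane.flag_trans [Finite G] (hP : Plane I n) (h : Pres G I) (ht : AFT G I) {l l' : L}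
    {z z' : P} (hz : I z l) (hz' : I z' l') : ∃ g : G, g • z = z' ∧ g • l = l' := by
  obtain ⟨o, ho, -⟩ := hP.pt_off l l
  obtain ⟨o', ho', -⟩ := hP.pt_off l' l'
  obtain ⟨g, h1, h2⟩ := ht o l o' l' ho ho'
  have h3 : I (g • z) l' := by rw [← h2]; exact h _ _ _ hz
  obtain ⟨w, hw, w1, w2⟩ := hP.pt_on l' (g • z) z'
  obtain ⟨k, k1, k2, k3⟩ := hP.star' h ht hw h3 hz' w1.symm w2.symm
  exact ⟨k * g, by rw [mul_smul, k3], by rw [mul_smul, h2, k1]⟩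

theorem Plane.two_trans [Finite G] (hP : Plane I n) (h : Pres G I) (ht : AFT G I) : TT G P := by
  intro a b a' b' hab hab'
  obtain ⟨l, h1, h2⟩ := hP.ln a b
  obtain ⟨l', h1', h2'⟩ := hP.ln a' b'
  obtain ⟨g, g1, g2⟩ := hP.flag_trans h ht h1 h1'
  have h3 : I (g • b) l' := by rw [← g2]; exact h _ _ _ h2
  have h4 : g • b ≠ a' := by rw [← g1]; exact fun hc => hab (smul_left_cancel g hc).symm
  obtain ⟨k, k1, k2, k3⟩ := hP.star' h ht h1' h3 h2' h4 hab'.symm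
  exact ⟨k * g, by rw [mul_smul, g1, k2], by rw [mul_smul, k3]⟩

theorem Plane.aft_of_tt [Finite G] (hP : Plane I n) (h : Pres G I) (ht : TT G P) : AFT G I := by
  classical
  -- transitivity on lines off a point
  have key : ∀ (a : P) (m m' : L), ¬ I a m → ¬ I a m' → ∃ g : G, g • a = a ∧ g • m = m' := by
    intro a m m' hm hm'
    let H := MulAction.stabilizer G a
    have hH : ∀ g : H, g • a = a := fun g => g.2
    have hc := hP.card_orbits (h.sub H)
    obtain ⟨k, hk, -⟩ := hP.ln_on a m m
    obtain ⟨b, hb, hba, -⟩ := hP.pt_on k a a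
    have h2 : Nat.card (MulAction.orbitRel.Quotient H P) ≤ 2 := by
      have : (Set.univ : Set (MulAction.orbitRel.Quotient H P)) ⊆ {Quotient.mk'' a, Quotient.mk'' b} := by
        intro q _
        induction q using Quotient.inductionOn' with
        | h x =>
          by_cases hx : x = a
          · left; rw [hx]
          · right
            apply Quotient.sound
            show (MulAction.orbitRel H P) _ _
            rw [MulAction.orbitRel_apply]
            obtain ⟨g, g1, g2⟩ := ht a b a x hba.symm (fun hc => hx hc.symm)
            exact ⟨⟨g, g1⟩, g2⟩
      have h3 := Set.ncard_le_ncard this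
      have h4 := Set.ncard_insert_le (Quotient.mk'' a : MulAction.orbitRel.Quotient H P) {Quotient.mk'' b}
      rw [Set.ncard_singleton] at h4
      rw [Set.ncard_univ] at h3
      omega
    rw [hc] at h2
    have nk : ∀ m0, ¬ I a m0 → (Quotient.mk'' k : MulAction.orbitRel.Quotient H L) ≠ Quotient.mk'' m0 := by
      intro m0 h0 h1
      have h6 := Quotient.exact h1
      change (MulAction.orbitRel H L) _ _ at h6
      rw [MulAction.orbitRel_apply] at h6
      obtain ⟨g, hg⟩ := h6
      have hg : g • m0 = k := hg
      rw [← hg] at hk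
      exact h0 ((h.fixL' (g := (g : G)) (hH g)).1 hk)
    have e : (Quotient.mk'' m' : MulAction.orbitRel.Quotient H L) = Quotient.mk'' m := by
      by_contra hne
      have h3 := Set.ncard_eq_three.2 ⟨_, _, _, nk m' hm', nk m hm, hne, rfl⟩
      have h4 := Set.ncard_le_card ({Quotient.mk'' k, Quotient.mk'' m', Quotient.mk'' m} : Set (MulAction.orbitRel.Quotient H L))
      omega
    have h6 := Quotient.exact e
    change (MulAction.orbitRel H L) _ _ at h6
    rw [MulAction.orbitRel_apply] at h6
    obtain ⟨g, hg⟩ := h6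
    exact ⟨g, hH g, hg⟩
  intro p l p' l' hpl hpl'
  obtain ⟨q, -, hq, -⟩ := hP.pt_on l p p
  obtain ⟨q', -, hq', -⟩ := hP.pt_on l' p' p'
  obtain ⟨g, g1, -⟩ := ht p q p' q' hq.symm hq'.symm
  have : ¬ I p' (g • l) := by rw [← g1]; exact fun hc => hpl (h.iff.1 hc)
  obtain ⟨k, k1, k2⟩ := key p' (g • l) l' this hpl'
  exact ⟨k * g, by rw [mul_smul, g1, k1], by rw [mul_smul, k2]⟩

end act
end AF
namespace AF

section persp
variable {G P L : Type*} [Group G] [MulAction G P] [MulAction G L] {n : ℕ}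

def Axis (I : P → L → Prop) (g : G) (l : L) : Prop := ∀ p, I p l → g • p = p
def Center (I : P → L → Prop) (g : G) (c : P) : Prop := ∀ l, I c l → g • l = l

variable {I : P → L → Prop}

theorem Center.axis {g : G} {c : P} (h : Center I g c) : Axis (fun l p => I p l) g c := h
theorem Axis.center {g : G} {l : L} (h : Axis I g l) : Center (fun l p => I p l) g l := h

variable [Finite P] [Finite L]

theorem Plane.axis_fix (hP : Plane I n) (h : Pres G I) {g : G} {l : L} (ha : Axis I g l) :
    g • l = l := by
  obtain ⟨a, h1, -⟩ := hP.pt_on l (hP.line_pt l).choose (hP.line_pt l).choose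
  obtain ⟨b, h2, h3, -⟩ := hP.pt_on l a a
  exact hP.fix_line h h3 h2 h1 (ha b h2) (ha a h1)

theorem Plane.center_fix (hP : Plane I n) (h : Pres G I) {g : G} {c : P} (ha : Center I g c) :
    g • c = c := hP.dual.axis_fix h.dual ha.axis

theorem Plane.trivL (hP : Plane I n) (h : Pres G I) {g : G} (ht : ∀ p : P, g • p = p) (l : L) :
    g • l = l := hP.axis_fix h (fun p _ => ht p)

theorem Plane.trivP (hP : Plane I n) (h : Pres G I) {g : G} (ht : ∀ p : L, g • p = p) (l : P) :
    g • l = l := hP.dual.trivL h.dual ht l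

/-- fixing all points off a line -/
theorem Plane.triv_of_off (hP : Plane I n) (h : Pres G I) {g : G} {l : L}
    (ht : ∀ p, ¬ I p l → g • p = p) (p : P) : g • p = p := by
  have key : ∀ m, m ≠ l → g • m = m := by
    intro m hm
    obtain ⟨x, hx1, hx2⟩ := hP.pt m l
    obtain ⟨a, a1, a2, -⟩ := hP.pt_on m x x
    obtain ⟨b, b1, b2, b3⟩ := hP.pt_on m x a
    have : ∀ c, I c m → c ≠ x → ¬ I c l := fun c c1 c2 c3 => c2 (hP.eqP hm c1 c3 hx1 hx2)
    exact hP.fix_line h b3.symm a1 b1 (ht a (this a a1 a2)) (ht b (this b b1 b2))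
  by_cases hp : I p l
  · obtain ⟨m, m1, m2, -⟩ := hP.ln_on p l l
    obtain ⟨k, k1, k2, k3⟩ := hP.ln_on p l m
    exact hP.fix_pt h k3 k1 m1 (key k k2) (key m m2)
  · exact ht p hp

theorem Plane.two_centers (hP : Plane I n) (h : Pres G I) {g : G} {c d : P} (hcd : c ≠ d)
    (hc : Center I g c) (hd : Center I g d) (p : P) : g • p = p := by
  obtain ⟨l, h1, h2⟩ := hP.ln c d
  refine hP.triv_of_off h (l := l) (fun x hx => ?_) p
  obtain ⟨k, k1, k2⟩ := hP.ln x c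
  obtain ⟨m, m1, m2⟩ := hP.ln x d
  refine hP.fix_pt h (l := k) (m := m) ?_ k1 m1 (hc k k2) (hd m m2)
  rintro rfl
  exact hx (hP.eqL hcd k2 m2 h1 h2 ▸ k1)

theorem Plane.two_axes (hP : Plane I n) (h : Pres G I) {g : G} {c d : L} (hcd : c ≠ d)
    (hc : Axis I g c) (hd : Axis I g d) (p : P) : g • p = p :=
  hP.trivP h (hP.dual.two_centers h.dual hcd hc.center hd.center) p

theorem Plane.center_of_off (hP : Plane I n) (h : Pres G I) {g : G} {l : L} {c : P}
    (ha : Axis I g l) (hc : ¬ I c l) (hf : g • c = c) : Center I g c := by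
  intro m hm
  obtain ⟨x, x1, x2⟩ := hP.pt m l
  refine hP.fix_line h (p := c) (q := x) ?_ hm x1 hf (ha x x2)
  rintro rfl; exact hc x2

theorem Plane.axis_of_off (hP : Plane I n) (h : Pres G I) {g : G} {l : L} {c : P}
    (ha : Center I g c) (hc : ¬ I c l) (hf : g • l = l) : Axis I g l :=
  hP.dual.center_of_off h.dual ha.axis hc hf

theorem Plane.exists_center (hP : Plane I n) (h : Pres G I) {g : G} {l : L} (ha : Axis I g l) :
    ∃ c, Center I g c := by
  by_cases hc : ∃ c, ¬ I c l ∧ g • c = c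
  · obtain ⟨c, h1, h2⟩ := hc
    exact ⟨c, hP.center_of_off h ha h1 h2⟩
  push Not at hc
  have hl := hP.axis_fix h ha
  have key : ∀ q x k, ¬ I q l → I q k → I (g • q) k → I x k → I x l → g • k = k := by
    intro q x k q1 q2 q3 x1 x2
    have e : g • q ≠ x := by
      rintro rfl; exact q1 ((h.fixP' hl).1 x2)
    have := h g _ _ q2
    have h2 := h.fixL (ha x x2) x1
    exact hP.eqL e this h2 q3 x1
  obtain ⟨p, hp, -⟩ := hP.pt_off l l
  obtain ⟨m, m1, m2⟩ := hP.ln p (g • p)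
  obtain ⟨x, x1, x2⟩ := hP.pt m l
  have hm := key p x m hp m1 m2 x1 x2
  refine ⟨x, fun k hk => ?_⟩
  by_cases e1 : k = l
  · rw [e1]; exact hl
  by_cases e2 : k = m
  · rw [e2]; exact hm
  obtain ⟨q, q1, q2, -⟩ := hP.pt_on k x x
  have q3 : ¬ I q l := fun hc => q2 (hP.eqP e1 q1 hc hk x2)
  obtain ⟨m', m1', m2'⟩ := hP.ln q (g • q)
  obtain ⟨x', x1', x2'⟩ := hP.pt m' l
  have hm' := key q x' m' q3 m1' m2' x1' x2'
  obtain ⟨y, y1, y2⟩ := hP.pt m m'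
  have e3 : m ≠ m' := by
    rintro rfl; exact q2 (hP.eqP e2 q1 m1' hk x1)
  have hy := hP.fix_pt h e3 y1 y2 hm hm'
  have hy2 : I y l := by
    by_contra hc'; exact hc y hc' hy
  have e4 : y = x := by
    refine hP.eqP (l := m) (m := l) ?_ y1 hy2 x1 x2
    rintro rfl; exact hp m1
  subst e4
  rw [hP.eqL q2 q1 hk m1' y2, hm']

theorem Plane.exists_axis (hP : Plane I n) (h : Pres G I) {g : G} {c : P} (ha : Center I g c) :
    ∃ l, Axis I g l := hP.dual.exists_center h.dual ha.axis

/-- fixed points of a perspectivity -/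
theorem Plane.persp_fixed (hP : Plane I n) (h : Pres G I) {g : G} {l : L} {c : P} (ha : Axis I g l)
    (hc : Center I g c) (hnt : ∃ p : P, g • p ≠ p) {p : P} (hp : g • p = p) : I p l ∨ p = c := by
  by_contra hcon
  push Not at hcon
  obtain ⟨q, hq⟩ := hnt
  exact hq (hP.two_centers h hcon.2 (hP.center_of_off h ha hcon.1 hp) hc q)

theorem Plane.center_unique (hP : Plane I n) (h : Pres G I) {g : G} {c d : P}
    (hc : Center I g c) (hd : Center I g d) (hnt : ∃ p : P, g • p ≠ p) : c = d := by
  by_contra hcon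
  obtain ⟨q, hq⟩ := hnt
  exact hq (hP.two_centers h hcon hc hd q)

theorem Plane.axis_unique (hP : Plane I n) (h : Pres G I) {g : G} {c d : L}
    (hc : Axis I g c) (hd : Axis I g d) (hnt : ∃ p : P, g • p ≠ p) : c = d := by
  by_contra hcon
  obtain ⟨q, hq⟩ := hnt
  exact hq (hP.two_axes h hcon hc hd q)

/-- configurations witnessing non-degeneracy -/
def Cfg (I : P → L → Prop) (p1 p2 p3 : P) (l1 l2 l3 : L) : Prop :=
  ¬ I p1 l2 ∧ ¬ I p1 l3 ∧ ¬ I p2 l1 ∧ I p2 l2 ∧ I p2 l3 ∧ ¬ I p3 l1 ∧ I p3 l2 ∧ ¬ I p3 l3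

theorem Cfg.dual {p1 p2 p3 : P} {l1 l2 l3 : L} (h : Cfg I p1 p2 p3 l1 l2 l3) :
    Cfg (fun l p => I p l) l1 l2 l3 p1 p2 p3 := by
  obtain ⟨a1, a2, a3, a4, a5, a6, a7, a8⟩ := h
  exact ⟨a3, a6, a1, a4, a7, a2, a5, a8⟩

theorem Plane.inv_line (hP : Plane I n) (h : Pres G I) {g : G} (hg : ∀ p : P, g • g • p = p)
    (hnt : ∃ p : P, g • p ≠ p) (l : L) : ∃ p, I p l ∧ g • p = p := by
  have hgL : ∀ l : L, g • g • l = l := by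
    intro l
    rw [← mul_smul]; exact hP.trivL h (fun p => by rw [mul_smul, hg]) l
  by_cases e : g • l = l
  · by_contra hcon
    push Not at hcon
    have key : ∃ q, ¬ I q l ∧ g • q ≠ q := by
      by_contra hc'
      push Not at hc'
      obtain ⟨p, hp⟩ := hnt
      exact hp (hP.triv_of_off h hc' p)
    obtain ⟨q, q1, q2⟩ := key
    obtain ⟨m, m1, m2⟩ := hP.ln q (g • q)
    obtain ⟨x, x1, x2⟩ := hP.pt m l
    have hm : g • m = m := by
      refine hP.eqL q2 (h _ _ _ m1) ?_ m2 m1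
      have := h g _ _ m2
      rwa [hg] at this
    exact hcon x x2 (hP.fix_pt h (by rintro rfl; exact q1 m1) x1 x2 hm e)
  · obtain ⟨x, x1, x2⟩ := hP.pt l (g • l)
    refine ⟨x, x1, ?_⟩
    refine hP.eqP (Ne.symm e) ?_ (h _ _ _ x1) x1 x2
    have := h g _ _ x2
    rwa [hgL] at this

theorem Plane.inv_pt (hP : Plane I n) (h : Pres G I) {g : G} (hg : ∀ p : P, g • g • p = p)
    (hnt : ∃ p : P, g • p ≠ p) (p : P) : ∃ l, I p l ∧ g • l = l := by
  refine hP.dual.inv_line h.dual ?_ ?_ p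
  · intro l
    rw [← mul_smul]; exact hP.trivL h (fun p => by rw [mul_smul, hg]) l
  · by_contra hc
    push Not at hc
    obtain ⟨p, hp⟩ := hnt
    exact hp (hP.trivP h hc p)

theorem Plane.inv_off (hP : Plane I n) (h : Pres G I) {g : G} (hg : ∀ p : P, g • g • p = p)
    (hnt : ∃ p : P, g • p ≠ p) (hax : ∀ l, ¬ Axis I g l) (k k' : L) :
    ∃ p, ¬ I p k ∧ ¬ I p k' ∧ g • p = p := by
  by_contra hcon
  push Not at hcon
  have main : ∀ k k' : L, k ≠ k' → (∀ p, ¬ I p k → ¬ I p k' → g • p ≠ p) → False := by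
    intro k k' hkk hcon
    obtain ⟨c, c1, c2⟩ := hP.pt k k'
    have hc : g • c = c := by
      by_contra hc
      obtain ⟨j, j1, j2, j3⟩ := hP.ln_on c k k'
      obtain ⟨x, x1, x2⟩ := hP.inv_line h hg hnt j
      have hxc : x ≠ c := by rintro rfl; exact hc x2
      exact hcon x (fun hh => hxc (hP.eqP j2 x1 hh j1 c1)) (fun hh => hxc (hP.eqP j3 x1 hh j1 c2)) x2
    have h1 := hax k'
    unfold Axis at h1
    push Not at h1
    obtain ⟨x', x1, x2⟩ := h1
    have hxc : x' ≠ c := by rintro rfl; exact x2 hc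
    apply hax k
    intro y hy
    by_cases hyc : y = c
    · rw [hyc, hc]
    obtain ⟨j, j1, j2⟩ := hP.ln x' y
    obtain ⟨w, w1, w2⟩ := hP.inv_line h hg hnt j
    have hy' : ¬ I y k' := fun hh => hyc (hP.eqP hkk hy hh c1 c2)
    have hx' : ¬ I x' k := fun hh => hxc (hP.eqP hkk hh x1 c1 c2)
    have hw' : ¬ I w k' := by
      intro hh
      have : w = x' := hP.eqP (l := j) (m := k') (by rintro rfl; exact hy' j2) w1 hh j1 x1
      rw [this] at w2; exact x2 w2
    have hw : I w k := by
      by_contra hh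
      exact hcon w hh hw' w2
    have : w = y := hP.eqP (l := j) (m := k) (by rintro rfl; exact hx' j1) w1 hw j2 hy
    rw [this] at w2; exact w2
  by_cases e : k = k'
  · subst e
    obtain ⟨p, hp⟩ := hP.line_pt k
    obtain ⟨m, m1, m2, -⟩ := hP.ln_on p k k
    exact main m k m2 (fun p _ h2 => hcon p h2 h2)
  · exact main k k' e hcon

/-- an involution is a perspectivity or planar -/
theorem Plane.inv_dich (hP : Plane I n) (h : Pres G I) {g : G} (hg : ∀ p : P, g • g • p = p)
    (hnt : ∃ p : P, g • p ≠ p) (hax : ∀ l, ¬ Axis I g l) :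
    ∃ p1 p2 p3 l1 l2 l3, Cfg I p1 p2 p3 l1 l2 l3 ∧ g • p1 = p1 ∧ g • p2 = p2 ∧ g • p3 = p3 ∧
      g • l1 = l1 ∧ g • l2 = l2 ∧ g • l3 = l3 := by
  have hgL : ∀ l : L, g • g • l = l := by
    intro l
    rw [← mul_smul]; exact hP.trivL h (fun p => by rw [mul_smul, hg]) l
  have hntL : ∃ p : L, g • p ≠ p := by
    by_contra hc
    push Not at hc
    obtain ⟨p, hp⟩ := hnt
    exact hp (hP.trivP h hc p)
  have hcen : ∀ c, ¬ Center I g c := fun c hc => by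
    obtain ⟨l, hl⟩ := hP.exists_axis h hc
    exact hax l hl
  have o1 := hP.inv_off h hg hnt hax
  have o2 := hP.dual.inv_off h.dual hgL hntL hcen
  obtain ⟨k, hk⟩ := hP.dual.line_pt (hnt.choose)
  obtain ⟨a, -, -, ha⟩ := o1 k k
  obtain ⟨k, hk⟩ := hP.dual.line_pt a
  obtain ⟨b, hb, -, hb'⟩ := o1 k k
  have hab : a ≠ b := by rintro rfl; exact hb hk
  obtain ⟨ab, ab1, ab2⟩ := hP.ln a b
  obtain ⟨c, hc, -, hc'⟩ := o1 ab ab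
  have hbc : b ≠ c := by rintro rfl; exact hc ab2
  obtain ⟨bc, bc1, bc2⟩ := hP.ln b c
  have habc : ¬ I a bc := fun hh => hc (hP.eqL hab hh bc1 ab1 ab2 ▸ bc2)
  obtain ⟨d, d1, d2, d'⟩ := o1 ab bc
  have hbd : b ≠ d := by rintro rfl; exact d1 ab2
  obtain ⟨bd, bd1, bd2⟩ := hP.ln b d
  obtain ⟨l1, l11, l12, l1'⟩ := o2 b c
  refine ⟨a, b, c, l1, bc, bd, ⟨habc, ?_, l11, bc1, bd1, l12, bc2, ?_⟩, ha, hb', hc', l1', ?_, ?_⟩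
  · intro hh
    have := hP.eqL hab hh bd1 ab1 ab2
    subst this; exact d1 bd2
  · intro hh
    have := hP.eqL hbc bd1 hh bc1 bc2
    subst this; exact d2 bd2
  · exact hP.fix_line h hbc bc1 bc2 hb' hc'
  · exact hP.fix_line h hbd bd1 bd2 hb' d'

end persp

theorem inv_parity {X : Type*} [Finite X] (f : X → X) (s : Set X) (hs : ∀ x ∈ s, f x ∈ s)
    (hf : ∀ x ∈ s, f (f x) = x) : s.ncard ≡ {x | x ∈ s ∧ f x = x}.ncard [MOD 2] := by
  classical
  have := Fintype.ofFinite X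
  let F : Function.End s := fun x => ⟨f x, hs x x.2⟩
  have hF : F ^ (2 ^ 1) = 1 := by
    funext x
    apply Subtype.ext
    exact hf x x.2
  have := Equiv.Perm.card_fixedPoints_modEq hF
  rw [← Nat.card_eq_fintype_card, ← Nat.card_eq_fintype_card] at this
  convert this using 1
  rw [← Nat.card_coe_set_eq]
  refine Nat.card_congr ⟨fun x => ⟨⟨x.1, x.2.1⟩, Subtype.ext x.2.2⟩,
    fun x => ⟨x.1.1, x.1.2, congrArg Subtype.val x.2⟩, fun _ => rfl, fun _ => rfl⟩

section persp2
variable {G P L : Type*} [Group G] [MulAction G P] [MulAction G L] {n : ℕ} {I : P → L → Prop}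
  [Finite P] [Finite L]

theorem Plane.inv_odd (hP : Plane I n) (h : Pres G I) {g : G} (hg : ∀ p : P, g • g • p = p)
    (hnt : ∃ p : P, g • p ≠ p) (hn : Odd n) {l : L} {c : P} (ha : Axis I g l) (hc : Center I g c) :
    ¬ I c l := by
  intro hcl
  have h1 := inv_parity (fun p : P => g • p) {p | ¬ I p l}
    (fun p hp hh => hp ((h.fixP' (hP.axis_fix h ha)).1 hh)) (fun p _ => hg p)
  have h2 : {x | x ∈ {p | ¬ I p l} ∧ g • x = x} = ∅ := by
    ext p
    simp only [Set.mem_ofPred_eq, Set.mem_empty_iff_false, iff_false]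
    rintro ⟨p1, p2⟩
    rcases hP.persp_fixed h ha hc hnt p2 with e | e
    · exact p1 e
    · rw [e] at p1; exact p1 hcl
  rw [h2, hP.card_off] at h1
  simp only [Set.ncard_empty] at h1
  have : Odd (n ^ 2) := hn.pow
  rw [Nat.odd_iff] at this
  unfold Nat.ModEq at h1
  omega

theorem Plane.inv_even (hP : Plane I n) (h : Pres G I) {g : G} (hg : ∀ p : P, g • g • p = p)
    (hnt : ∃ p : P, g • p ≠ p) (hn : Even n) {l : L} {c : P} (ha : Axis I g l) (hc : Center I g c) :
    I c l := by
  by_contra hcl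
  have h1 := inv_parity (fun p : P => g • p) {p | ¬ I p l}
    (fun p hp hh => hp ((h.fixP' (hP.axis_fix h ha)).1 hh)) (fun p _ => hg p)
  have h2 : {x | x ∈ {p | ¬ I p l} ∧ g • x = x} = {c} := by
    ext p
    simp only [Set.mem_ofPred_eq, Set.mem_singleton_iff]
    constructor
    · rintro ⟨p1, p2⟩
      exact (hP.persp_fixed h ha hc hnt p2).resolve_left p1
    · rintro rfl
      exact ⟨hcl, hP.center_fix h hc⟩
  rw [h2, hP.card_off] at h1
  simp only [Set.ncard_singleton] at h1
  have : Even (n ^ 2) := hn.pow_of_ne_zero (by norm_num)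
  rw [Nat.even_iff] at this
  unfold Nat.ModEq at h1
  omega

end persp2
end AF
namespace AF

section grp
variable {G : Type*} [Group G] {p : ℕ}

/-- `S` is a Sylow `p`-subgroup of the subgroup `K`. -/
def IsSyl (p : ℕ) (K S : Subgroup G) : Prop :=
  S ≤ K ∧ Nat.card S = p ^ (Nat.card K).factorization p

theorem IsSyl.pg {K S : Subgroup G} (h : IsSyl p K S) : IsPGroup p S := IsPGroup.of_card h.2

variable [Finite G] [hp : Fact p.Prime]

theorem card_subgroupOf {S K : Subgroup G} (h : S ≤ K) : Nat.card (S.subgroupOf K) = Nat.card S :=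
  Nat.card_congr (Subgroup.subgroupOfEquivOfLe h).toEquiv

theorem exists_syl {K Q : Subgroup G} (hQ : Q ≤ K) (hQp : IsPGroup p Q) :
    ∃ S, IsSyl p K S ∧ Q ≤ S := by
  have h1 : IsPGroup p (Q.subgroupOf K) := hQp.comap_subtype
  obtain ⟨T, hT⟩ := h1.exists_le_sylow
  refine ⟨T.map K.subtype, ⟨Subgroup.map_subtype_le _, ?_⟩, ?_⟩
  · have := T.card_eq_multiplicity
    rw [← this]
    exact Nat.card_congr ((T : Subgroup K).equivMapOfInjective _ K.subtype_injective).symm.toEquiv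
  · have := Subgroup.map_mono (f := K.subtype) hT
    rwa [Subgroup.map_subgroupOf_eq_of_le hQ] at this

theorem exists_syl' (p : ℕ) [Fact p.Prime] (K : Subgroup G) : ∃ S, IsSyl p K S := by
  obtain ⟨S, hS, -⟩ := exists_syl (p := p) (K := K) (Q := ⊥) bot_le IsPGroup.of_bot
  exact ⟨S, hS⟩

theorem IsSyl.card_le {K S T : Subgroup G} (h : IsSyl p K S) (hT : T ≤ K) (hTp : IsPGroup p T) :
    Nat.card T ≤ Nat.card S := by
  obtain ⟨U, hU, h2⟩ := exists_syl hT hTp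
  rw [h.2, ← hU.2]
  exact Subgroup.card_le_of_le h2

theorem IsSyl.max {K S T : Subgroup G} (h : IsSyl p K S) (hT : T ≤ K) (hTp : IsPGroup p T)
    (hST : S ≤ T) : T = S :=
  (Subgroup.eq_of_le_of_card_ge hST (h.card_le hT hTp)).symm

theorem IsSyl.conj {K S T : Subgroup G} (h : IsSyl p K S) (h' : IsSyl p K T) :
    ∃ u ∈ K, ∀ x, x ∈ S ↔ u * x * u⁻¹ ∈ T := by
  let S1 : Sylow p K := Sylow.ofCard (S.subgroupOf K) (by rw [card_subgroupOf h.1, h.2])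
  let T1 : Sylow p K := Sylow.ofCard (T.subgroupOf K) (by rw [card_subgroupOf h'.1, h'.2])
  obtain ⟨u, hu⟩ := MulAction.exists_smul_eq K S1 T1
  have hu2 : ∀ x : K, x ∈ S1 ↔ u * x * u⁻¹ ∈ T1 := by
    intro x
    rw [← hu, ← SetLike.mem_coe (p := u • S1), Sylow.coe_smul, Set.mem_smul_set]
    constructor
    · intro hx; exact ⟨x, hx, rfl⟩
    · rintro ⟨y, hy, hxy⟩
      have : y = x := by
        have h3 : u * y * u⁻¹ = u * x * u⁻¹ := hxy
        simpa using h3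
      rwa [← this]
  refine ⟨u, u.2, fun x => ?_⟩
  constructor
  · intro hx
    have := (hu2 ⟨x, h.1 hx⟩).1 (show (⟨x, h.1 hx⟩ : K) ∈ S.subgroupOf K from hx)
    exact this
  · intro hx
    have h1 : x ∈ K := by
      have := K.mul_mem (K.mul_mem (K.inv_mem u.2) (h'.1 hx)) u.2
      simpa [mul_assoc] using this
    exact (hu2 ⟨x, h1⟩).2 (show _ ∈ T.subgroupOf K from hx)

/-- conjugate of a `p`-subgroup into a Sylow subgroup -/
theorem IsSyl.conj_le {K S T : Subgroup G} (h : IsSyl p K S) (hT : T ≤ K) (hTp : IsPGroup p T) :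
    ∃ u ∈ K, ∀ x ∈ T, u * x * u⁻¹ ∈ S := by
  obtain ⟨U, hU, h2⟩ := exists_syl hT hTp
  obtain ⟨u, hu, h3⟩ := hU.conj h
  exact ⟨u, hu, fun x hx => (h3 x).1 (h2 hx)⟩

theorem IsSyl.mono {K K' S : Subgroup G} (h : IsSyl p K S) (hK : K ≤ K')
    (hc : (Nat.card K').factorization p = (Nat.card K).factorization p) : IsSyl p K' S :=
  ⟨h.1.trans hK, by rw [h.2, hc]⟩

theorem IsSyl.down {K K' S : Subgroup G} (h : IsSyl p K' S) (hK : K ≤ K') (hS : S ≤ K) :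
    IsSyl p K S := by
  refine ⟨hS, Nat.dvd_antisymm ?_ ?_⟩
  · rw [h.2]
    have h1 : p ^ (Nat.card K').factorization p ∣ Nat.card K := by
      rw [← h.2]; exact Subgroup.card_dvd_of_le hS
    exact pow_dvd_pow _ ((hp.out.pow_dvd_iff_le_factorization Nat.card_pos.ne').1 h1)
  · rw [h.2]
    apply pow_dvd_pow
    exact (Nat.factorization_le_iff_dvd Nat.card_pos.ne' Nat.card_pos.ne').2
      (Subgroup.card_dvd_of_le hK) p

/-- Witt's lemma -/
theorem witt {X : Type*} [MulAction G X] {x y : X} {S : Subgroup G}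
    (hS : IsSyl p (MulAction.stabilizer G x) S) (hy : ∀ g ∈ S, g • y = y)
    (ht : ∃ g : G, g • x = y) : ∃ k ∈ Subgroup.normalizer (S : Set G), k • x = y := by
  obtain ⟨g, hg⟩ := ht
  have hcard : Nat.card (MulAction.stabilizer G y) = Nat.card (MulAction.stabilizer G x) := by
    rw [← hg]
    exact Nat.card_congr (MulAction.stabilizerEquivStabilizer rfl).symm.toEquiv
  have h1 : IsSyl p (MulAction.stabilizer G y) S := by
    refine ⟨fun s hs => hy s hs, by rw [hS.2, hcard]⟩
  have h2 : IsSyl p (MulAction.stabilizer G y) (S.map (MulAut.conj g).toMonoidHom) := by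
    refine ⟨?_, ?_⟩
    · rintro _ ⟨s, hs, rfl⟩
      have := hS.1 hs
      rw [MulAction.mem_stabilizer_iff] at this ⊢
      simp [mul_smul, ← hg, this]
    · rw [hcard, ← hS.2]
      exact Nat.card_congr (S.equivMapOfInjective _ (MulAut.conj g).injective).symm.toEquiv
  obtain ⟨u, hu, h3⟩ := h2.conj h1
  refine ⟨u * g, ?_, ?_⟩
  · rw [Subgroup.mem_normalizer_iff]
    intro s
    have h4 : s ∈ S ↔ g * s * g⁻¹ ∈ S.map (MulAut.conj g).toMonoidHom := by
      constructor
      · intro hs; exact ⟨s, hs, rfl⟩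
      · rintro ⟨t, ht, h5⟩
        have : t = s := by
          have h6 : g * t * g⁻¹ = g * s * g⁻¹ := h5
          simpa using h6
        rwa [← this]
    rw [h4, h3]
    have : u * (g * s * g⁻¹) * u⁻¹ = u * g * s * (u * g)⁻¹ := by group
    rw [this]
  · rw [mul_smul, hg]; exact hu

theorem pg_fix {X : Type*} [Finite X] [MulAction G X] {S : Subgroup G} (hS : IsPGroup p S)
    (s : Set X) (hs : ∀ g ∈ S, ∀ x ∈ s, g • x ∈ s) :
    s.ncard ≡ {x | x ∈ s ∧ ∀ g ∈ S, g • x = x}.ncard [MOD p] := by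
  let A : SubMulAction S X := ⟨s, fun g {x} hx => hs g g.2 x hx⟩
  have h1 := hS.card_modEq_card_fixedPoints A
  have h2 : Nat.card A = s.ncard := rfl
  rw [h2] at h1
  convert h1 using 1
  rw [← Nat.card_coe_set_eq]
  refine Nat.card_congr ⟨fun x => ⟨⟨x.1, x.2.1⟩, fun g => Subtype.ext (x.2.2 g g.2)⟩,
    fun x => ⟨x.1.1, x.1.2, fun g hg => congrArg Subtype.val (x.2 ⟨g, hg⟩)⟩, fun _ => rfl, fun _ => rfl⟩

/-- a p-group has a normal subgroup of index p -/
theorem pg_index {R : Subgroup G} (hR : IsPGroup p R) (h1 : R ≠ ⊥) :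
    ∃ R' : Subgroup G, R' < R ∧ R ≤ Subgroup.normalizer (R' : Set G) ∧ (∀ x ∈ R, x ^ p ∈ R') ∧
      ∀ x ∈ R, x ∉ R' → ∀ K : Subgroup G, R' ≤ K → x ∈ K → R ≤ K := by
  obtain ⟨n, hn⟩ := IsPGroup.iff_card.1 hR
  have hn0 : n ≠ 0 := by
    rintro rfl
    exact h1 (Subgroup.card_eq_one.1 (by simpa using hn))
  obtain ⟨k, rfl⟩ := Nat.exists_eq_succ_of_ne_zero hn0
  obtain ⟨Q, hQ⟩ := Sylow.exists_subgroup_card_pow_prime (G := R) p (n := k)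
    (by rw [hn]; exact pow_dvd_pow _ (Nat.le_succ k))
  have hidx : Q.index = p := by
    have := Q.card_mul_index
    rw [hQ, hn, pow_succ] at this
    exact Nat.eq_of_mul_eq_mul_left (pow_pos hp.out.pos k) this
  have hnorm : Q.Normal := by
    apply Subgroup.normal_of_index_eq_minFac_card
    rw [hidx, hn, Nat.Prime.pow_minFac hp.out (Nat.succ_ne_zero k)]
  have hmem : ∀ x : R, (x : G) ∈ Q.map R.subtype ↔ x ∈ Q := by
    intro x
    constructor
    · rintro ⟨y, hy, h⟩
      rwa [← Subtype.ext h]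
    · intro h; exact ⟨x, h, rfl⟩
  have hcard : Nat.card (Q.map R.subtype) = p ^ k := by
    rw [← hQ]
    exact Nat.card_congr (Q.equivMapOfInjective _ R.subtype_injective).symm.toEquiv
  have hlt : Q.map R.subtype < R := by
    refine lt_of_le_of_ne (Subgroup.map_subtype_le _) ?_
    intro h
    have h2 := hn
    rw [← h, hcard] at h2
    exact absurd (Nat.pow_right_injective hp.out.two_le h2) (by omega)
  refine ⟨Q.map R.subtype, hlt, ?_, ?_, ?_⟩
  · rw [Subgroup.le_normalizer_iff]
    rintro g hg _ ⟨y, hy, rfl⟩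
    exact ⟨⟨g, hg⟩ * y * ⟨g, hg⟩⁻¹, hnorm.conj_mem y hy ⟨g, hg⟩, rfl⟩
  · intro x hx
    have := Q.pow_index_mem ⟨x, hx⟩
    rw [hidx] at this
    exact (hmem (⟨x, hx⟩ ^ p)).2 this
  · intro x hx hx' K hK hxK
    have hR2 : IsPGroup p (K ⊓ R : Subgroup G) := hR.to_le inf_le_right
    obtain ⟨j, hj⟩ := IsPGroup.iff_card.1 hR2
    have h3 : Q.map R.subtype < K ⊓ R := by
      refine lt_of_le_of_ne (le_inf hK hlt.le) ?_
      intro h; rw [h] at hx'; exact hx' ⟨hxK, hx⟩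
    have h4 : k < j := by
      by_contra hc
      have h5 : Nat.card (K ⊓ R : Subgroup G) ≤ Nat.card (Q.map R.subtype) := by
        rw [hj, hcard]; exact Nat.pow_le_pow_right hp.out.pos (by omega)
      exact h3.ne (Subgroup.eq_of_le_of_card_ge h3.le h5)
    have h6 : K ⊓ R = R := by
      apply Subgroup.eq_of_le_of_card_ge inf_le_right
      rw [hj, hn]; exact Nat.pow_le_pow_right hp.out.pos h4
    exact inf_eq_right.1 h6

end grp
end AF
namespace AF

/-- elements of `X` fixed by the subgroup `R` -/
def Fx {G : Type*} [Group G] (R : Subgroup G) (X : Type*) [MulAction G X] :=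
  {x : X // ∀ g ∈ R, g • x = x}

section fx
variable {G P L : Type*} [Group G] [MulAction G P] [MulAction G L] {n : ℕ}

instance fxAct {X : Type*} [MulAction G X] (R : Subgroup G) :
    MulAction (Subgroup.normalizer (R : Set G)) (Fx R X) where
  smul k x := ⟨(k : G) • x.1, by
    intro g hg
    have h1 := (Subgroup.mem_normalizer_iff''.1 k.2 g).1 hg
    have h2 := x.2 _ h1
    rw [mul_smul, mul_smul, inv_smul_eq_iff] at h2
    exact h2⟩
  one_smul x := Subtype.ext (one_smul G x.1)
  mul_smul a b x := Subtype.ext (mul_smul (a : G) b x.1)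

theorem fx_smul {X : Type*} [MulAction G X] {R : Subgroup G}
    (k : Subgroup.normalizer (R : Set G)) (x : Fx R X) : (k • x).1 = (k : G) • x.1 := rfl

instance {X : Type*} [MulAction G X] [Finite X] (R : Subgroup G) : Finite (Fx R X) :=
  inferInstanceAs (Finite {x : X // ∀ g ∈ R, g • x = x})

/-- induced incidence -/
def FI (I : P → L → Prop) (R : Subgroup G) : Fx R P → Fx R L → Prop := fun p l => I p.1 l.1

/-- `R` fixes a nondegenerate configuration -/
def Planar (I : P → L → Prop) (R : Subgroup G) : Prop :=
  ∃ p1 p2 p3 l1 l2 l3, Cfg I p1 p2 p3 l1 l2 l3 ∧ ∀ g ∈ R, g • p1 = p1 ∧ g • p2 = p2 ∧ g • p3 = p3 ∧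
      g • l1 = l1 ∧ g • l2 = l2 ∧ g • l3 = l3

variable {I : P → L → Prop}

theorem Planar.mono {R R' : Subgroup G} (h : Planar I R) (hR : R' ≤ R) : Planar I R' := by
  obtain ⟨p1, p2, p3, l1, l2, l3, h1, h2⟩ := h
  exact ⟨p1, p2, p3, l1, l2, l3, h1, fun g hg => h2 g (hR hg)⟩

theorem Pres.fi (h : Pres G I) (R : Subgroup G) :
    Pres (Subgroup.normalizer (R : Set G)) (FI I R) := fun g p l hpl => h (g : G) p.1 l.1 hpl

theorem Planar.pp {R : Subgroup G} (hP : PP I) (h : Pres G I) (hR : Planar I R) : PP (FI I R) := by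
  obtain ⟨p1, p2, p3, l1, l2, l3, h1, h2⟩ := hR
  obtain ⟨a1, a2, a3, a4, a5, a6, a7, a8⟩ := h1
  have lnaux : ∀ p q : Fx R P, p.1 ≠ q.1 → ∃ l : Fx R L, FI I R p l ∧ FI I R q l := by
    intro p q hpq
    obtain ⟨l, b1, b2⟩ := hP.ln p.1 q.1
    exact ⟨⟨l, fun g hg => hP.fix_line h hpq b1 b2 (p.2 g hg) (q.2 g hg)⟩, b1, b2⟩
  have ptaux : ∀ p q : Fx R L, p.1 ≠ q.1 → ∃ l : Fx R P, FI I R l p ∧ FI I R l q := by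
    intro p q hpq
    obtain ⟨l, b1, b2⟩ := hP.pt p.1 q.1
    exact ⟨⟨l, fun g hg => hP.fix_pt h hpq b1 b2 (p.2 g hg) (q.2 g hg)⟩, b1, b2⟩
  refine ⟨?_, ?_, ?_, ?_⟩
  · intro p q
    by_cases e : p.1 = q.1
    · have : p = q := Subtype.ext e
      subst this
      by_cases e2 : p.1 = p2
      · exact ⟨⟨l2, fun g hg => (h2 g hg).2.2.2.2.1⟩, by unfold FI; rw [e2]; exact ⟨a4, a4⟩⟩
      · obtain ⟨l, b1, b2⟩ := lnaux p ⟨p2, fun g hg => (h2 g hg).2.1⟩ e2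
        exact ⟨l, b1, b1⟩
    · exact lnaux p q e
  · intro p q
    by_cases e : p.1 = q.1
    · have : p = q := Subtype.ext e
      subst this
      by_cases e2 : p.1 = l2
      · exact ⟨⟨p2, fun g hg => (h2 g hg).2.1⟩, by unfold FI; rw [e2]; exact ⟨a4, a4⟩⟩
      · obtain ⟨l, b1, b2⟩ := ptaux p ⟨l2, fun g hg => (h2 g hg).2.2.2.2.1⟩ e2
        exact ⟨l, b1, b1⟩
    · exact ptaux p q e
  · intro p q l m b1 b2 b3 b4
    rcases hP.uq b1 b2 b3 b4 with e | e
    · exact Or.inl (Subtype.ext e)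
    · exact Or.inr (Subtype.ext e)
  · exact ⟨⟨p1, fun g hg => (h2 g hg).1⟩, ⟨p2, fun g hg => (h2 g hg).2.1⟩,
      ⟨p3, fun g hg => (h2 g hg).2.2.1⟩, ⟨l1, fun g hg => (h2 g hg).2.2.2.1⟩,
      ⟨l2, fun g hg => (h2 g hg).2.2.2.2.1⟩, ⟨l3, fun g hg => (h2 g hg).2.2.2.2.2⟩,
      a1, a2, a3, a4, a5, a6, a7, a8⟩

variable [Finite P] [Finite L]

theorem Planar.dual {R : Subgroup G} (h : Planar I R) : Planar (fun l p => I p l) R := by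
  obtain ⟨p1, p2, p3, l1, l2, l3, h1, h2⟩ := h
  refine ⟨l1, l2, l3, p1, p2, p3, h1.dual, fun g hg => ?_⟩
  obtain ⟨a, b, c, d, e, f⟩ := h2 g hg
  exact ⟨d, e, f, a, b, c⟩

theorem Planar.plane {R : Subgroup G} (hP : PP I) (h : Pres G I) (hR : Planar I R) :
    ∃ r, Plane (FI I R) r := (hR.pp hP h).exists_plane

theorem fx_line_card {R : Subgroup G} {r : ℕ} (hR : Plane (FI I R) r) {l : L}
    (hl : ∀ g ∈ R, g • l = l) : {p : P | I p l ∧ ∀ g ∈ R, g • p = p}.ncard = r + 1 := by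
  rw [← hR.line_card ⟨l, hl⟩, ← Nat.card_coe_set_eq, ← Nat.card_coe_set_eq]
  exact Nat.card_congr ⟨fun x => ⟨⟨x.1, x.2.2⟩, x.2.1⟩, fun x => ⟨x.1.1, x.2, x.1.2⟩,
    fun _ => rfl, fun _ => rfl⟩

theorem fx_card {R : Subgroup G} {r : ℕ} (hR : Plane (FI I R) r) :
    {p : P | ∀ g ∈ R, g • p = p}.ncard = r ^ 2 + r + 1 := by
  rw [← hR.cardP, ← Nat.card_coe_set_eq]
  rfl

/-- a planar subgroup acting nontrivially has smaller order -/
theorem Plane.order_lt {R : Subgroup G} {r : ℕ} (hP : Plane I n) (hR : Plane (FI I R) r)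
    (hnt : ∃ g ∈ R, ∃ p : P, g • p ≠ p) : r < n := by
  obtain ⟨g, hg, p, hp⟩ := hnt
  have h1 := fx_card hR
  have h2 : {p : P | ∀ g ∈ R, g • p = p}.ncard < Nat.card P := by
    rw [← Set.ncard_univ]
    refine Set.ncard_lt_ncard ?_ (Set.toFinite _)
    rw [Set.ssubset_univ_iff]
    intro hh
    have : p ∈ {p : P | ∀ g ∈ R, g • p = p} := by rw [hh]; trivial
    exact hp (this g hg)
  rw [h1, hP.cardP] at h2
  by_contra hc
  push Not at hc
  nlinarith

theorem zp_fix {X : Type*} [MulAction G X] {g : G} {x : X} :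
    (∀ k ∈ Subgroup.zpowers g, k • x = x) ↔ g • x = x := by
  constructor
  · intro h; exact h g (Subgroup.mem_zpowers g)
  · intro h k hk
    have : Subgroup.zpowers g ≤ MulAction.stabilizer G x := by
      rw [Subgroup.zpowers_le]; exact h
    exact this hk

theorem planar_zp {g : G} : Planar I (Subgroup.zpowers g) ↔
    ∃ p1 p2 p3 l1 l2 l3, Cfg I p1 p2 p3 l1 l2 l3 ∧ g • p1 = p1 ∧ g • p2 = p2 ∧ g • p3 = p3 ∧
      g • l1 = l1 ∧ g • l2 = l2 ∧ g • l3 = l3 := by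
  constructor
  · rintro ⟨p1, p2, p3, l1, l2, l3, h1, h2⟩
    exact ⟨p1, p2, p3, l1, l2, l3, h1, h2 g (Subgroup.mem_zpowers g)⟩
  · rintro ⟨p1, p2, p3, l1, l2, l3, h1, a, b, c, d, e, f⟩
    exact ⟨p1, p2, p3, l1, l2, l3, h1, fun k hk => ⟨zp_fix.2 a k hk, zp_fix.2 b k hk,
      zp_fix.2 c k hk, zp_fix.2 d k hk, zp_fix.2 e k hk, zp_fix.2 f k hk⟩⟩

theorem Plane.baer (hP : Plane I n) (h : Pres G I) {g : G} (hg : ∀ p : P, g • g • p = p)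
    (hnt : ∃ p : P, g • p ≠ p) {r : ℕ} (hr : Plane (FI I (Subgroup.zpowers g)) r) :
    n = r ^ 2 := by
  classical
  set Z := Subgroup.zpowers g
  choose ln hln using hP.inv_pt h hg hnt
  have hlt : r < n := hP.order_lt hr ⟨g, Subgroup.mem_zpowers g, hnt⟩
  have e1 : Nat.card {p : P // g • p ≠ p} =
      Nat.card (Σ l : Fx Z L, {p : P // I p l.1 ∧ g • p ≠ p}) := by
    refine Nat.card_congr ⟨fun x => ⟨⟨ln x.1, zp_fix.2 (hln x.1).2⟩, ⟨x.1, (hln x.1).1, x.2⟩⟩,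
      fun x => ⟨x.2.1, x.2.2.2⟩, fun x => rfl, ?_⟩
    rintro ⟨⟨l, hl⟩, ⟨p, hp1, hp2⟩⟩
    have : ln p = l := by
      by_contra hc
      exact hp2 (hP.fix_pt h hc (hln p).1 hp1 (hln p).2 (zp_fix.1 hl))
    subst this
    rfl
  have e2 : ∀ l : Fx Z L, Nat.card {p : P // I p l.1 ∧ g • p ≠ p} = n - r := by
    intro l
    have h1 := fx_line_card hr l.2
    have h2 := hP.line_card l.1
    have h3 : {p | I p l.1} = {p : P | I p l.1 ∧ ∀ g ∈ Z, g • p = p} ∪ {p | I p l.1 ∧ g • p ≠ p} := by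
      ext p
      simp only [Set.mem_ofPred_eq, Set.mem_union, Z, zp_fix]
      tauto
    have h4 : Disjoint {p : P | I p l.1 ∧ ∀ g ∈ Z, g • p = p} {p | I p l.1 ∧ g • p ≠ p} := by
      rw [Set.disjoint_left]
      rintro p ⟨_, h5⟩ ⟨_, h6⟩
      exact h6 (zp_fix.1 h5)
    rw [h3, Set.ncard_union_eq h4, h1] at h2
    have : Nat.card {p : P // I p l.1 ∧ g • p ≠ p} = {p : P | I p l.1 ∧ g • p ≠ p}.ncard := rfl
    omega
  have e3 : Nat.card {p : P // g • p ≠ p} + (r ^ 2 + r + 1) = n ^ 2 + n + 1 := by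
    have h1 := fx_card hr
    have h5 := Set.ncard_add_ncard_compl {p : P | ∀ g ∈ Z, g • p = p}
    have h6 : {p : P | ∀ g ∈ Z, g • p = p}ᶜ = {p : P | g • p ≠ p} := by
      ext p
      simp only [Set.mem_compl_iff, Set.mem_ofPred_eq, Z, zp_fix]
    rw [h6, h1, hP.cardP] at h5
    have : Nat.card {p : P // g • p ≠ p} = {p : P | g • p ≠ p}.ncard := rfl
    omega
  have e4 : Nat.card {p : P // g • p ≠ p} = (r ^ 2 + r + 1) * (n - r) := by
    have := Fintype.ofFinite (Fx Z L)
    rw [e1, Nat.card_sigma]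
    simp only [e2, Finset.sum_const, smul_eq_mul]
    rw [Finset.card_univ, ← Nat.card_eq_fintype_card, hr.cardL]
  obtain ⟨d, rfl⟩ := Nat.exists_eq_add_of_lt hlt
  rw [e4] at e3
  have e5 : r + d + 1 - r = d + 1 := by omega
  rw [e5] at e3
  have : (d + 1) * (r + (r + d + 1) + 1) = (d + 1) * (r ^ 2 + r + 1) := by nlinarith
  have := Nat.eq_of_mul_eq_mul_left (Nat.succ_pos d) this
  omega

end fx
end AF
namespace AF

section elat
variable {G P L : Type*} [Group G] [MulAction G P] [MulAction G L] {n : ℕ} {I : P → L → Prop}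

/-- faithful on points -/
def Fth (G P : Type*) [Group G] [MulAction G P] : Prop := ∀ g : G, (∀ p : P, g • p = p) → g = 1

/-- nontrivial elation -/
def Elat (I : P → L → Prop) (g : G) : Prop :=
  ∃ l c, I c l ∧ Axis I g l ∧ Center I g c ∧ ∃ p : P, g • p ≠ p

theorem fth_nt (hF : Fth G P) {g : G} (hg : g ≠ 1) : ∃ p : P, g • p ≠ p := by
  by_contra hc
  push Not at hc
  exact hg (hF g hc)

theorem nt_ne {g : G} (hg : ∃ p : P, g • p ≠ p) : g ≠ 1 := by
  rintro rfl
  obtain ⟨p, hp⟩ := hg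
  exact hp (one_smul _ p)

theorem Axis.inv {g : G} {l : L} (h : Axis I g l) : Axis I g⁻¹ l := fun p hp => by
  rw [inv_smul_eq_iff, h p hp]

theorem Axis.mul {g k : G} {l : L} (h : Axis I g l) (h' : Axis I k l) : Axis I (g * k) l :=
  fun p hp => by rw [mul_smul, h' p hp, h p hp]

theorem Axis.one {l : L} : Axis I (1 : G) l := fun p hp => one_smul _ p
theorem Center.one {l : P} : Center I (1 : G) l := fun p hp => one_smul _ p

theorem Axis.pow {g : G} {l : L} (h : Axis I g l) (k : ℕ) : Axis I (g ^ k) l := by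
  induction k with
  | zero => rw [pow_zero]; exact Axis.one
  | succ k ih => rw [pow_succ]; exact ih.mul h

theorem Center.inv {g : G} {l : P} (h : Center I g l) : Center I g⁻¹ l := fun p hp => by
  rw [inv_smul_eq_iff, h p hp]

theorem Center.mul {g k : G} {l : P} (h : Center I g l) (h' : Center I k l) : Center I (g * k) l :=
  fun p hp => by rw [mul_smul, h' p hp, h p hp]

theorem Center.pow {g : G} {l : P} (h : Center I g l) (k : ℕ) : Center I (g ^ k) l := by
  induction k with
  | zero => rw [pow_zero]; exact Center.one
  | succ k ih => rw [pow_succ]; exact ih.mul h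

theorem Pres.inv_iff (h : Pres G I) {g : G} {p : P} {l : L} : I (g⁻¹ • p) l ↔ I p (g • l) := by
  rw [← h.iff (g := g), smul_inv_smul]

theorem Pres.inv_iff' (h : Pres G I) {g : G} {p : P} {l : L} : I p (g⁻¹ • l) ↔ I (g • p) l := by
  rw [← h.iff (g := g), smul_inv_smul]

theorem Axis.conj (hp : Pres G I) {g : G} {l : L} (h : Axis I g l) (k : G) :
    Axis I (k * g * k⁻¹) (k • l) := fun p hp1 => by
  rw [mul_smul, mul_smul, h _ (hp.inv_iff.2 hp1), smul_inv_smul]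

theorem Center.conj (hp : Pres G I) {g : G} {l : P} (h : Center I g l) (k : G) :
    Center I (k * g * k⁻¹) (k • l) := fun p hp1 => by
  rw [mul_smul, mul_smul, h _ (hp.inv_iff'.2 hp1), smul_inv_smul]

theorem nt_conj {g : G} (h : ∃ p : P, g • p ≠ p) (k : G) : ∃ p : P, (k * g * k⁻¹) • p ≠ p := by
  obtain ⟨p, hp⟩ := h
  refine ⟨k • p, fun hc => hp ?_⟩
  rw [mul_smul, mul_smul, inv_smul_smul] at hc
  exact smul_left_cancel k hc

variable [Finite P] [Finite L]

theorem Elat.dual (hP : Plane I n) (h : Pres G I) {g : G} (he : Elat I g) :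
    Elat (fun l p => I p l) g := by
  obtain ⟨l, c, h1, h2, h3, h4⟩ := he
  refine ⟨c, l, h1, h3, h2, ?_⟩
  by_contra hc
  push Not at hc
  obtain ⟨p, hp⟩ := h4
  exact hp (hP.trivP h hc p)

/-- part four -/
theorem Plane.homology_elat (hP : Plane I n) (h : Pres G I) (ht : AFT G I) {g : G}
    {l : L} {c : P} (ha : Axis I g l) (hc : Center I g c) (hcl : ¬ I c l)
    (hnt : ∃ p : P, g • p ≠ p) (hg : g * g = 1) : ∃ e : G, Elat I e := by
  obtain ⟨m, hm⟩ := hP.pt_on l c c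
  obtain ⟨k, k1, k2⟩ := hP.ln c m
  obtain ⟨c', h1, h2, h3⟩ := hP.pt_on k c m
  have hc' : ¬ I c' l := fun h5 => h3 (hP.eqP (l := l) (m := k) (by rintro rfl; exact hcl k1) h5 h1 hm.1 k2)
  obtain ⟨u, u1, u2⟩ := ht c l c' l hcl hc'
  set t := u * g * u⁻¹ with htd
  have ta : Axis I t l := u2 ▸ ha.conj h u
  have tc : Center I t c' := u1 ▸ hc.conj h u
  have tn := nt_conj hnt u
  have tt : t * t = 1 := by rw [htd]; simp [mul_assoc]; rw [← mul_assoc g g, hg]; simp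
  have en : ∃ p : P, (g * t) • p ≠ p := by
    by_contra hcon
    push Not at hcon
    refine h2 (hP.center_unique h ?_ hc hnt)
    intro q hq
    have := tc q hq
    have h6 := hP.trivL h hcon q
    rw [mul_smul, this] at h6
    exact h6
  have ea : Axis I (g * t) l := ha.mul ta
  obtain ⟨d, hd⟩ := hP.exists_center h ea
  refine ⟨g * t, l, d, ?_, ea, hd, en⟩
  by_contra hdl
  have gi : g⁻¹ = g := inv_eq_of_mul_eq_one_left hg
  have ti : t⁻¹ = t := inv_eq_of_mul_eq_one_left tt
  have en' : ∃ p : P, (g * t)⁻¹ • p ≠ p := by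
    obtain ⟨p, hp⟩ := en
    refine ⟨p, fun h7 => hp ?_⟩
    rw [inv_smul_eq_iff] at h7
    exact h7.symm
  have e1 : g • d = d := by
    refine hP.center_unique h (g := (g * t)⁻¹) ?_ hd.inv en'
    have := hd.conj h g
    have e : g * (g * t) * g⁻¹ = (g * t)⁻¹ := by
      rw [mul_inv_rev, gi, ti, ← mul_assoc, hg, one_mul]
    rwa [e] at this
  have e2 : t • d = d := by
    refine hP.center_unique h (g := (g * t)⁻¹) ?_ hd.inv en'
    have := hd.conj h t
    have e : t * (g * t) * t⁻¹ = (g * t)⁻¹ := by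
      clear_value t
      rw [mul_inv_rev, gi, ti, mul_assoc, mul_assoc, tt, mul_one]
    rwa [e] at this
  have e3 := (hP.persp_fixed h ha hc hnt e1).resolve_left hdl
  have e4 := (hP.persp_fixed h ta tc tn e2).resolve_left hdl
  exact h2 (e4.symm.trans e3)

end elat

section orb
variable {G : Type*} [Group G] [Finite G] {p : ℕ} [Fact p.Prime]
variable {X : Type*} [MulAction G X] [Finite X]

theorem orbit_card (K : Subgroup G) (x : X) :
    (MulAction.orbit K x).ncard * Nat.card (MulAction.stabilizer K x) = Nat.card K := by
  rw [← MulAction.index_stabilizer, Subgroup.index_mul_card]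

/-- Sylow orbits are divisible by the `p`-part of the orbit of the group -/
theorem IsSyl.orb {K S : Subgroup G} (h : IsSyl p K S) (x : X) :
    p ^ ((MulAction.orbit K x).ncard.factorization p) ∣ (MulAction.orbit S x).ncard := by
  have hp : p.Prime := Fact.out
  have h1 := orbit_card K x
  have h2 := orbit_card S x
  set Kx := MulAction.stabilizer K x
  set Sx := MulAction.stabilizer S x
  have h3 : Nat.card Sx ∣ Nat.card Kx := by
    refine Subgroup.card_dvd_of_injective
      (⟨⟨fun s => ⟨⟨s.1.1, h.1 s.1.2⟩, s.2⟩, rfl⟩, fun a b => rfl⟩ : Sx →* Kx) ?_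
    intro a b hab
    have : a.1.1 = b.1.1 := congrArg (fun z : Kx => z.1.1) hab
    exact Subtype.ext (Subtype.ext this)
  have ho : (MulAction.orbit K x).ncard ≠ 0 := by
    intro h0; rw [h0, zero_mul] at h1; exact Nat.card_pos.ne h1
  have hk : Nat.card Kx ≠ 0 := Nat.card_pos.ne'
  have h4 : Nat.card Sx ∣ p ^ (Nat.card Kx).factorization p := by
    have h5 : Nat.card Sx ∣ p ^ (Nat.card K).factorization p := by
      rw [← h.2, ← h2]; exact Dvd.intro_left _ rfl
    obtain ⟨j, -, hj⟩ := (Nat.dvd_prime_pow hp).1 h5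
    rw [hj] at h3 ⊢
    exact pow_dvd_pow _ ((hp.pow_dvd_iff_le_factorization hk).1 h3)
  obtain ⟨c, hc⟩ := h4
  have h6 : (MulAction.orbit S x).ncard * Nat.card Sx =
      p ^ ((MulAction.orbit K x).ncard.factorization p) * (Nat.card Sx * c) := by
    rw [h2, ← hc, ← pow_add, h.2, ← h1, Nat.factorization_mul ho hk]
    rfl
  refine ⟨c, Nat.eq_of_mul_eq_mul_right (Nat.card_pos (α := Sx)) ?_⟩
  rw [h6]; ring

/-- union of orbits -/
theorem dvd_of_orbits (S : Subgroup G) (s : Set X) (hs : ∀ g ∈ S, ∀ x ∈ s, g • x ∈ s) (d : ℕ)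
    (hd : ∀ x ∈ s, d ∣ (MulAction.orbit S x).ncard) : d ∣ s.ncard := by
  classical
  have := Fintype.ofFinite X
  rw [Set.ncard_eq_toFinset_card', Finset.card_eq_sum_card_image (fun x => MulAction.orbit S x)]
  refine Finset.dvd_sum ?_
  intro b hb
  rw [Finset.mem_image] at hb
  obtain ⟨x, hx, rfl⟩ := hb
  rw [Set.mem_toFinset] at hx
  have : (Finset.filter (fun a => MulAction.orbit S a = MulAction.orbit S x) s.toFinset)
      = (MulAction.orbit S x).toFinset := by
    ext y
    simp only [Finset.mem_filter, Set.mem_toFinset]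
    rw [MulAction.orbit_eq_iff]
    constructor
    · exact fun h => h.2
    · rintro ⟨g, rfl⟩
      exact ⟨hs g.1 g.2 x hx, g, rfl⟩
  rw [this, ← Set.ncard_eq_toFinset_card']
  exact hd x hx

/-- central element of prime order -/
theorem exists_central {S : Subgroup G} (hS : IsPGroup p S) (h1 : S ≠ ⊥) :
    ∃ z ∈ S, z ≠ 1 ∧ z ^ p = 1 ∧ ∀ s ∈ S, s * z = z * s := by
  have hnt : Nontrivial S := (Subgroup.nontrivial_iff_ne_bot S).2 h1
  have := hS.center_nontrivial
  have hc : IsPGroup p (Subgroup.center S) := hS.to_subgroup _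
  obtain ⟨k, hk⟩ := IsPGroup.iff_card.1 hc
  have hk0 : k ≠ 0 := by
    rintro rfl
    rw [pow_zero] at hk
    exact (Finite.one_lt_card (α := Subgroup.center S)).ne' hk
  obtain ⟨z, hz⟩ := exists_prime_orderOf_dvd_card' (G := Subgroup.center S) p (by rw [hk]; exact dvd_pow_self p hk0)
  refine ⟨z.1.1, z.1.2, ?_, ?_, ?_⟩
  · intro h
    have : z = 1 := Subtype.ext (Subtype.ext h)
    rw [this, orderOf_one] at hz
    exact (Fact.out : p.Prime).one_lt.ne hz
  · have := pow_orderOf_eq_one z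
    rw [hz] at this
    exact congrArg (fun t : Subgroup.center S => t.1.1) this
  · intro s hs
    have := Subgroup.mem_center_iff.1 z.2 ⟨s, hs⟩
    exact congrArg (fun t : S => t.1) this

theorem IsSyl.ne_bot {K S : Subgroup G} (h : IsSyl p K S) (hd : p ∣ Nat.card K) : S ≠ ⊥ := by
  rintro rfl
  have := h.2
  rw [Subgroup.card_bot] at this
  have h2 := (Fact.out : p.Prime).factorization_pos_of_dvd Nat.card_pos.ne' hd
  exact (Nat.one_lt_pow h2.ne' (Fact.out : p.Prime).one_lt).ne this

theorem orbit_dvd_card (K : Subgroup G) (x : X) : (MulAction.orbit K x).ncard ∣ Nat.card K := by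
  exact Dvd.intro _ (orbit_card K x)

end orb

section even
variable {G P L : Type*} [Group G] [MulAction G P] [MulAction G L] {n : ℕ} {I : P → L → Prop}
variable [Finite P] [Finite L] [Finite G]

theorem AFT.orbit_off (h : Pres G I) (ht : AFT G I) {l : L} {q : P} (hq : ¬ I q l) :
    MulAction.orbit (MulAction.stabilizer G l) q = {p : P | ¬ I p l} := by
  ext p
  constructor
  · rintro ⟨g, rfl⟩
    exact fun hc => hq ((h.fixP' g.2).1 hc)
  · intro hp
    obtain ⟨g, g1, g2⟩ := ht q l p l hq hp
    exact ⟨⟨g, g2⟩, g1⟩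

/-- part 3 -/
theorem Plane.even_elat (hP : Plane I n) (h : Pres G I) (ht : AFT G I) (hF : Fth G P)
    (hn : Even n) : ∃ e : G, Elat I e := by
  have : Fact (Nat.Prime 2) := ⟨Nat.prime_two⟩
  obtain ⟨S, hS⟩ := exists_syl' 2 (⊤ : Subgroup G)
  have h1 := pg_fix hS.pg (Set.univ : Set L) (fun _ _ _ _ => trivial)
  rw [Set.ncard_univ, hP.cardL] at h1
  have h2 : ∃ l : L, ∀ g ∈ S, g • l = l := by
    by_contra hc
    push Not at hc
    have : {x : L | x ∈ Set.univ ∧ ∀ g ∈ S, g • x = x} = ∅ := by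
      ext x
      simp only [Set.mem_ofPred_eq, Set.mem_univ, true_and, Set.mem_empty_iff_false, iff_false]
      intro h7
      obtain ⟨g, g1, g2⟩ := hc x
      exact g2 (h7 g g1)
    rw [this, Set.ncard_empty] at h1
    obtain ⟨k, rfl⟩ := hn
    have h9 : (k + k) ^ 2 + (k + k) + 1 = 2 * (2 * k ^ 2 + k) + 1 := by ring
    rw [h9, Nat.modEq_zero_iff_dvd] at h1
    omega
  obtain ⟨l, hl⟩ := h2
  have hSK : S ≤ MulAction.stabilizer G l := fun g hg => hl g hg
  have hS' : IsSyl 2 (MulAction.stabilizer G l) S := hS.down le_top hSK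
  have hn2 := hP.two_le
  have hv : 0 < n.factorization 2 :=
    Nat.prime_two.factorization_pos_of_dvd (by omega) hn.two_dvd
  have horb : ∀ q : P, ¬ I q l → 2 ^ (2 * n.factorization 2) ∣ (MulAction.orbit S q).ncard := by
    intro q hq
    have := hS'.orb q
    rw [ht.orbit_off h hq, hP.card_off] at this
    simpa using this
  obtain ⟨q, hq, -⟩ := hP.pt_off l l
  have hSb : S ≠ ⊥ := by
    refine hS'.ne_bot ?_
    refine dvd_trans ?_ (orbit_dvd_card _ q)
    rw [ht.orbit_off h hq, hP.card_off]
    exact dvd_pow hn.two_dvd (by norm_num)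
  obtain ⟨z, z1, z2, z3, z4⟩ := exists_central hS.pg hSb
  have znt : ∃ p : P, z • p ≠ p := fth_nt hF z2
  have zz : ∀ p : P, z • z • p = p := fun p => by rw [← mul_smul, ← sq, z3, one_smul]
  by_cases hax : ∃ k, Axis I z k
  · obtain ⟨k, hk⟩ := hax
    obtain ⟨c, hc⟩ := hP.exists_center h hk
    exact ⟨z, k, c, hP.inv_even h zz znt hn hk hc, hk, hc, znt⟩
  push Not at hax
  exfalso
  have hpl : Planar I (Subgroup.zpowers z) := planar_zp.2 (hP.inv_dich h zz znt hax)
  obtain ⟨r, hr⟩ := hpl.plane hP.toPP h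
  have hnr := hP.baer h zz znt hr
  have hzl := hl z z1
  set s := {p : P | ¬ I p l ∧ z • p = p} with hs
  have hsc : s.ncard = n := by
    have h3 := fx_card hr
    have h4 := fx_line_card hr (l := l) (fun g hg => zp_fix.2 hzl g hg)
    simp only [zp_fix] at h3 h4
    have h5 : {p : P | z • p = p} = {p : P | I p l ∧ z • p = p} ∪ s := by
      ext p
      simp only [hs, Set.mem_ofPred_eq, Set.mem_union]
      tauto
    have h6 : Disjoint {p : P | I p l ∧ z • p = p} s := by
      rw [Set.disjoint_left]
      rintro p h7 h8
      exact h8.1 h7.1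
    rw [h5, Set.ncard_union_eq h6, h4] at h3
    omega
  have := dvd_of_orbits S s ?_ (2 ^ (2 * n.factorization 2)) (fun x hx => horb x hx.1)
  · rw [hsc, Nat.prime_two.pow_dvd_iff_le_factorization (by omega)] at this
    omega
  · intro g hg x hx
    refine ⟨fun hc => hx.1 ((h.fixP' (hl g hg)).1 hc), ?_⟩
    rw [← mul_smul, ← z4 g hg, mul_smul, hx.2]

end even
end AF
namespace AF

section cc
variable {H P L : Type*} [Group H] [MulAction H P] [MulAction H L] {r : ℕ} {I : P → L → Prop}

/-- involutory perspectivity with center `C` and axis `k` -/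
def Inv (I : P → L → Prop) (h : H) (C : P) (k : L) : Prop :=
  h ≠ 1 ∧ h * h = 1 ∧ Axis I h k ∧ Center I h C

/-- `(C,k)` is the center-axis pair of an involution in `H` -/
def Cc (H : Type*) {P L : Type*} [Group H] [MulAction H P] [MulAction H L] (I : P → L → Prop)
    (C : P) (k : L) : Prop := ∃ h : H, Inv I h C k

/-- the hypotheses of the combinatorial part -/
structure Hyp (H : Type*) {P L : Type*} [Group H] [MulAction H P] [MulAction H L]
    (I : P → L → Prop) (r : ℕ) : Prop where
  pl : Plane I r
  pr : Pres H I
  ft : Fth H P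
  od : Odd r
  nb : ∀ h : H, h ≠ 1 → h * h = 1 → ∃ k, Axis I h k
  af : ∀ Q m, ¬ I Q m → Cc H I Q m ∨ ∃ C k, I C m ∧ I Q k ∧ Cc H I C k
  pp : ∀ A B, A ≠ B → (∃ k C, I A k ∧ I B k ∧ Cc H I C k) ∨ (∃ k, I B k ∧ Cc H I A k) ∨
    (∃ k, I A k ∧ Cc H I B k)
  ll : ∀ k k', k ≠ k' → (∃ C l, I C k ∧ I C k' ∧ Cc H I C l) ∨ (∃ C, I C k' ∧ Cc H I C k) ∨
    (∃ C, I C k ∧ Cc H I C k')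

variable [Finite P] [Finite L]

theorem Inv.dual {h : H} {C : P} {k : L} (hi : Inv I h C k) : Inv (fun l p => I p l) h k C :=
  ⟨hi.1, hi.2.1, hi.2.2.2, hi.2.2.1⟩

theorem cc_dual {C : P} {k : L} : Cc H (fun l p => I p l) k C ↔ Cc H I C k :=
  ⟨fun ⟨h, hi⟩ => ⟨h, hi.dual⟩, fun ⟨h, hi⟩ => ⟨h, hi.dual⟩⟩

theorem Plane.fth_dual (hP : Plane I r) (hpr : Pres H I) (hF : Fth H P) : Fth H L :=
  fun g hg => hF g (hP.trivP hpr hg)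

theorem Hyp.dual (h : Hyp H I r) : Hyp H (fun l p => I p l) r where
  pl := h.pl.dual
  pr := h.pr.dual
  ft := h.pl.fth_dual h.pr h.ft
  od := h.od
  nb := fun g h1 h2 => by
    obtain ⟨k, hk⟩ := h.nb g h1 h2
    obtain ⟨c, hc⟩ := h.pl.exists_center h.pr hk
    exact ⟨c, hc.axis⟩
  af := fun Q m hQ => by
    simp only [cc_dual]
    rcases h.af m Q hQ with h1 | ⟨C, k, h1, h2, h3⟩
    · exact Or.inl h1
    · exact Or.inr ⟨k, C, h2, h1, h3⟩
  pp := fun A B hAB => by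
    simp only [cc_dual]
    exact h.ll A B hAB
  ll := fun A B hAB => by
    simp only [cc_dual]
    exact h.pp A B hAB

theorem Inv.nt (h : Hyp H I r) {g : H} {C : P} {k : L} (hi : Inv I g C k) : ∃ p : P, g • p ≠ p :=
  fth_nt h.ft hi.1

theorem Inv.sq {g : H} {C : P} {k : L} (hi : Inv I g C k) {X : Type*} [MulAction H X] (p : X) :
    g • g • p = p := by rw [← mul_smul, hi.2.1, one_smul]

theorem Inv.inv {g : H} {C : P} {k : L} (hi : Inv I g C k) : g⁻¹ = g :=
  inv_eq_of_mul_eq_one_left hi.2.1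

theorem Inv.off (h : Hyp H I r) {g : H} {C : P} {k : L} (hi : Inv I g C k) : ¬ I C k :=
  h.pl.inv_odd h.pr hi.sq (hi.nt h) h.od hi.2.2.1 hi.2.2.2

theorem Cc.off (h : Hyp H I r) {C : P} {k : L} (hi : Cc H I C k) : ¬ I C k := by
  obtain ⟨g, hg⟩ := hi
  exact hg.off h

theorem Inv.smul (h : Hyp H I r) {g : H} {C : P} {k : L} (hi : Inv I g C k) (u : H) :
    Inv I (u * g * u⁻¹) (u • C) (u • k) := by
  refine ⟨?_, ?_, hi.2.2.1.conj h.pr u, hi.2.2.2.conj h.pr u⟩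
  · intro hc
    exact nt_ne (nt_conj (hi.nt h) u) hc
  · have := hi.2.1
    simp only [mul_assoc, inv_mul_cancel_left]
    rw [← mul_assoc g g, this]; simp

theorem Cc.smul (h : Hyp H I r) {C : P} {k : L} (hi : Cc H I C k) (u : H) :
    Cc H I (u • C) (u • k) := by
  obtain ⟨g, hg⟩ := hi
  exact ⟨_, hg.smul h u⟩

theorem Inv.fixed (h : Hyp H I r) {g : H} {C : P} {k : L} (hi : Inv I g C k) {p : P}
    (hp : g • p = p) : I p k ∨ p = C :=
  h.pl.persp_fixed h.pr hi.2.2.1 hi.2.2.2 (hi.nt h) hp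

/-- the product of two involutions with common axis -/
theorem Hyp.prod_off (h : Hyp H I r) {s t z : H} {A D E : P} {l : L} (hs : Inv I s A l)
    (ht : Inv I t D l) (hAD : A ≠ D) (hz : z ≠ 1) (hza : Axis I z l) (hzE : Center I z E)
    (e1 : s * z * s⁻¹ = z ∨ s * z * s⁻¹ = z⁻¹) (e2 : t * z * t⁻¹ = z ∨ t * z * t⁻¹ = z⁻¹) :
    I E l := by
  by_contra hE
  have key : ∀ w : H, (w * z * w⁻¹ = z ∨ w * z * w⁻¹ = z⁻¹) → w • E = E := by
    intro w hw
    have h1 := hzE.conj h.pr w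
    rcases hw with hw | hw
    · rw [hw] at h1
      exact h.pl.center_unique h.pr h1 hzE (fth_nt h.ft hz)
    · rw [hw] at h1
      exact h.pl.center_unique h.pr h1 hzE.inv (fth_nt h.ft (inv_ne_one.2 hz))
  have h1 := (hs.fixed h (key s e1)).resolve_left hE
  have h2 := (ht.fixed h (key t e2)).resolve_left hE
  exact hAD (h1.symm.trans h2)

/-- the product of two involutory homologies with common axis and different centers -/
theorem Hyp.prod_elat (h : Hyp H I r) {s t : H} {A D X : P} {l m : L} (hs : Inv I s A l)
    (ht : Inv I t D l) (hAD : A ≠ D) (hA : I A m) (hD : I D m) (hX : I X m) (hXl : I X l) :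
    s * t ≠ 1 ∧ Axis I (s * t) l ∧ Center I (s * t) X := by
  have h1 : s * t ≠ 1 := by
    intro hc
    have e : s = t := by rw [eq_inv_of_mul_eq_one_left hc, ht.inv]
    rw [e] at hs
    exact hAD (h.pl.center_unique h.pr hs.2.2.2 ht.2.2.2 (ht.nt h))
  have h2 : Axis I (s * t) l := hs.2.2.1.mul ht.2.2.1
  refine ⟨h1, h2, ?_⟩
  obtain ⟨E, hE⟩ := h.pl.exists_center h.pr h2
  have e1 : s * (s * t) * s⁻¹ = (s * t)⁻¹ := by
    rw [mul_inv_rev, hs.inv, ht.inv, ← mul_assoc, hs.2.1, one_mul]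
  have e2 : t * (s * t) * t⁻¹ = (s * t)⁻¹ := by
    rw [mul_inv_rev, hs.inv, ht.inv, mul_assoc, mul_assoc, ht.2.1, mul_one]
  have hEl := h.prod_off hs ht hAD h1 h2 hE (Or.inr e1) (Or.inr e2)
  have hm : (s * t) • m = m := by
    rw [mul_smul, ht.2.2.2 m hD, hs.2.2.2 m hA]
  have : E = X := by
    by_contra hne
    have hEm : ¬ I E m := fun hc => hs.off h (by
      have : m = l := h.pl.eqL hne hc hX hEl hXl
      rw [← this]; exact hA)
    have h3 := h.pl.axis_of_off h.pr hE hEm hm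
    have := h.pl.axis_unique h.pr h3 h2 (fth_nt h.ft h1)
    rw [this] at hA
    exact hs.off h hA
  exact this ▸ hE

variable [Finite H]

/-- F1 -/
theorem Hyp.f1 (h : Hyp H I r) {A D X : P} {l m : L} (hs : Cc H I A l)
    (ht : Cc H I D l) (hA : I A m) (hD : I D m) (hX : I X m) (hXl : I X l) :
    ∃ g : H, Axis I g l ∧ Center I g X ∧ g • A = D := by
  by_cases hAD : A = D
  · exact ⟨1, Axis.one, Center.one, by rw [one_smul, hAD]⟩
  obtain ⟨s, hs⟩ := hs
  obtain ⟨t, ht⟩ := ht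
  obtain ⟨h1, h2, h3⟩ := h.prod_elat hs ht hAD hA hD hX hXl
  set q := s * t with hq
  have e1 : s * q * s⁻¹ = q⁻¹ := by
    rw [hq, mul_inv_rev, hs.inv, ht.inv, ← mul_assoc, hs.2.1, one_mul]
  have e2 : t * q * t⁻¹ = q⁻¹ := by
    rw [hq, mul_inv_rev, hs.inv, ht.inv, mul_assoc, mul_assoc, ht.2.1, mul_one]
  rcases Nat.even_or_odd' (orderOf q) with ⟨k, hk | hk⟩
  · exfalso
    have hkp : 0 < k := by
      have := orderOf_pos q
      omega
    have z1 : q ^ k ≠ 1 := fun hc => by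
      have := orderOf_le_of_pow_eq_one hkp hc
      omega
    have z2 : q ^ k * q ^ k = 1 := by
      rw [← pow_add, ← two_mul, ← hk, pow_orderOf_eq_one]
    have zi : (q ^ k)⁻¹ = q ^ k := inv_eq_of_mul_eq_one_left z2
    have hX' := h.pl.inv_odd h.pr (g := q ^ k) (fun p => by rw [← mul_smul, z2, one_smul])
      (fth_nt h.ft z1) h.od (h2.pow k) (h3.pow k)
    exact hX' hXl
  · refine ⟨q ^ k, h2.pow k, h3.pow k, ?_⟩
    have e3 : q ^ k * s * (q ^ k)⁻¹ = t := by
      have e4 : (q ^ k)⁻¹ = s * q ^ k * s⁻¹ := by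
        rw [← conj_pow, e1, inv_pow]
      have e5 : q ^ k * q ^ k = q⁻¹ := by
        rw [eq_inv_iff_mul_eq_one, ← pow_add, ← pow_succ, ← two_mul, ← hk, pow_orderOf_eq_one]
      calc q ^ k * s * (q ^ k)⁻¹ = q ^ k * (s * s) * q ^ k * s⁻¹ := by rw [e4]; simp only [mul_assoc]
        _ = t := by
          rw [hs.2.1, mul_one, e5, hq, mul_inv_rev, hs.inv, ht.inv, mul_assoc, hs.2.1, mul_one]
    have h4 := hs.2.2.2.conj h.pr (q ^ k)
    rw [e3] at h4
    exact h.pl.center_unique h.pr h4 ht.2.2.2 (ht.nt h)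

theorem Hyp.f1' (h : Hyp H I r) {A D : P} {l : L} (hs : Cc H I A l)
    (ht : Cc H I D l) : ∃ g : H, Axis I g l ∧ g • A = D := by
  obtain ⟨m, h1, h2⟩ := h.pl.ln A D
  obtain ⟨X, h3, h4⟩ := h.pl.pt m l
  obtain ⟨g, h5, -, h6⟩ := h.f1 hs ht h1 h2 h3 h4
  exact ⟨g, h5, h6⟩

/-- F2 -/
theorem Hyp.f2 (h : Hyp H I r) {g : H} {D : P} {l : L} (hg : Inv I g D l) (s : Set P)
    (hs : ∀ x ∈ s, g • x ∈ s) (hsl : ∀ x ∈ s, ¬ I x l) (hD : D ∈ s) : Odd s.ncard := by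
  have h1 := inv_parity (fun p : P => g • p) s hs (fun x _ => hg.sq x)
  have : {x | x ∈ s ∧ (fun p : P => g • p) x = x} = {D} := by
    ext x
    constructor
    · rintro ⟨h2, h3⟩
      exact (hg.fixed h h3).resolve_left (hsl x h2)
    · rintro rfl
      exact ⟨hD, h.pl.center_fix h.pr hg.2.2.2⟩
  rw [this, Set.ncard_singleton] at h1
  exact Nat.odd_iff.2 h1

theorem odd_fix {g : H} (hg : g * g = 1) (s : Set P) (hs : ∀ x ∈ s, g • x ∈ s)
    (ho : Odd s.ncard) : ∃ x ∈ s, g • x = x := by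
  have h1 := inv_parity (fun p : P => g • p) s hs (fun x _ => by
    change g • g • x = x
    rw [← mul_smul, hg, one_smul])
  by_contra hc
  push Not at hc
  have : {x | x ∈ s ∧ (fun p : P => g • p) x = x} = ∅ := by
    ext x
    simp only [Set.mem_ofPred_eq, Set.mem_empty_iff_false, iff_false]
    rintro ⟨h2, h3⟩
    exact hc x h2 h3
  rw [this, Set.ncard_empty] at h1
  have h2 := Nat.odd_iff.1 ho
  unfold Nat.ModEq at h1
  omega

/-- F3 -/
theorem Hyp.f3 (h : Hyp H I r) {X D0 : P} {l g' : L} (hX : Cc H I X g') (hXl : I X l)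
    (hD0 : Cc H I D0 l) : ∃ X', I X' l ∧ X' ≠ X ∧ ∀ D, Cc H I D l → ∀ m, I D m →
      (I X m → Cc H I X' m) ∧ (I X' m → Cc H I X m) := by
  obtain ⟨s, hs⟩ := hX
  have hsl : s • l = l := hs.2.2.2 l hXl
  obtain ⟨D1, hD1, hD1s⟩ := odd_fix hs.2.1 {D | Cc H I D l}
    (fun x hx => by
      have := Cc.smul h hx s
      rwa [hsl] at this)
    (by
      obtain ⟨t, ht⟩ := hD0
      refine h.f2 ht _ (fun x hx => ?_) (fun x hx => Cc.off h hx) ⟨t, ht⟩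
      have := Cc.smul h hx t
      rwa [h.pl.axis_fix h.pr ht.2.2.1] at this)
  have hD1' : Cc H I D1 l := hD1
  have hD1l : ¬ I D1 l := hD1'.off h
  have hXg : ¬ I X g' := hs.off h
  have hD1X : D1 ≠ X := by rintro rfl; exact hD1l hXl
  have hD1g : I D1 g' := (hs.fixed h hD1s).resolve_right hD1X
  have hgl : g' ≠ l := by rintro rfl; exact hXg hXl
  obtain ⟨X', hX'g, hX'l⟩ := h.pl.pt g' l
  have hX'X : X' ≠ X := by rintro rfl; exact hXg hX'g
  have hX'D : X' ≠ D1 := by rintro rfl; exact hD1l hX'l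
  obtain ⟨t, ht⟩ := hD1'
  -- commuting
  have hcom : s * t * s⁻¹ * t⁻¹ = 1 := by
    by_contra hne
    have c1 : Center I (s * t * s⁻¹ * t⁻¹) D1 := by
      have := ht.2.2.2.conj h.pr s
      rw [hD1s] at this
      exact this.mul ht.2.2.2.inv
    have c2 : Center I (s * t * s⁻¹ * t⁻¹) X := by
      have := hs.2.2.2.inv.conj h.pr t
      rw [ht.2.2.1 X hXl] at this
      have h2 := hs.2.2.2.mul this
      have e : s * (t * s⁻¹ * t⁻¹) = s * t * s⁻¹ * t⁻¹ := by simp only [mul_assoc]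
      rwa [e] at h2
    exact hD1X (h.pl.center_unique h.pr c1 c2 (fth_nt h.ft hne))
  have hst : s * t = t * s := by
    have := mul_inv_eq_one.1 hcom
    have := mul_inv_eq_iff_eq_mul.1 this
    exact this
  set w := s * t with hw
  have w1 : w ≠ 1 := by
    intro hc
    have e : s = t := by rw [eq_inv_of_mul_eq_one_left hc, ht.inv]
    rw [e] at hs
    exact hD1X (h.pl.center_unique h.pr ht.2.2.2 hs.2.2.2 (ht.nt h))
  have w2 : w * w = 1 := by
    calc w * w = s * t * (t * s) := by rw [← hst]
      _ = s * (t * t) * s := by simp only [mul_assoc]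
      _ = 1 := by rw [ht.2.1, mul_one, hs.2.1]
  obtain ⟨k, hk⟩ := h.nb w w1 w2
  obtain ⟨E, hE⟩ := h.pl.exists_center h.pr hk
  have hwi : Inv I w E k := ⟨w1, w2, hk, hE⟩
  have fX : w • X = X := by rw [hw, mul_smul, ht.2.2.1 X hXl, h.pl.center_fix h.pr hs.2.2.2]
  have fX' : w • X' = X' := by rw [hw, mul_smul, ht.2.2.1 X' hX'l, hs.2.2.1 X' hX'g]
  have fD : w • D1 = D1 := by rw [hw, mul_smul, h.pl.center_fix h.pr ht.2.2.2, hD1s]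
  have kl : k ≠ l := by
    rintro rfl
    have : Axis I s k := by
      have := hk.mul ht.2.2.1.inv
      rwa [hw, mul_inv_cancel_right] at this
    exact hgl (h.pl.axis_unique h.pr hs.2.2.1 this (hs.nt h))
  have kg : k ≠ g' := by
    rintro rfl
    have : Axis I t k := by
      have := hs.2.2.1.inv.mul hk
      rwa [hw, inv_mul_cancel_left] at this
    exact hgl (h.pl.axis_unique h.pr this ht.2.2.1 (ht.nt h))
  have hEX' : X' = E := by
    rcases hwi.fixed h fX' with h1 | h1
    · exfalso
      have h2 : X = E := (hwi.fixed h fX).resolve_left fun h2 => kl (h.pl.eqL hX'X h1 h2 hX'l hXl)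
      have h3 : D1 = E := (hwi.fixed h fD).resolve_left fun h2 => kg (h.pl.eqL hX'D h1 h2 hX'g hD1g)
      exact hD1X (h3.trans h2.symm)
    · exact h1
  have hXk : I X k := (hwi.fixed h fX).resolve_right fun h2 => hX'X (hEX'.trans h2.symm)
  have hDk : I D1 k := (hwi.fixed h fD).resolve_right fun h2 => hX'D (hEX'.trans h2.symm)
  refine ⟨X', hX'l, hX'X, fun D hD m hDm => ?_⟩
  obtain ⟨u, u1, u2⟩ := h.f1' ⟨t, ht⟩ hD
  have hDl : ¬ I D l := hD.off h
  constructor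
  · intro hXm
    have h1 := Cc.smul h ⟨w, hwi⟩ u
    rw [← hEX', u1 X' hX'l] at h1
    have : u • k = m := by
      refine h.pl.eqL (p := D) (q := X) (by rintro rfl; exact hDl hXl) ?_ ?_ hDm hXm
      · rw [← u2, h.pr.iff]; exact hDk
      · rw [← u1 X hXl, h.pr.iff]; exact hXk
    rwa [this] at h1
  · intro hXm
    have h1 := Cc.smul h ⟨s, hs⟩ u
    rw [u1 X hXl] at h1
    have : u • g' = m := by
      refine h.pl.eqL (p := D) (q := X') (by rintro rfl; exact hDl hX'l) ?_ ?_ hDm hXm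
      · rw [← u2, h.pr.iff]; exact hD1g
      · rw [← u1 X' hX'l, h.pr.iff]; exact hX'g
    rwa [this] at h1

/-- closure (a) -/
theorem Hyp.cla (h : Hyp H I r) {A B : P} {a b m : L} (hAB : A ≠ B) (hA : Cc H I A a)
    (hB : Cc H I B b) (hAm : I A m) (hBm : I B m) : ∃ C, Cc H I C m := by
  rcases h.pp A B hAB with ⟨k, C, h1, h2, h3⟩ | ⟨k, h1, h2⟩ | ⟨k, h1, h2⟩
  · rw [h.pl.eqL hAB hAm hBm h1 h2]; exact ⟨C, h3⟩
  · obtain ⟨X', -, -, h4⟩ := h.f3 hB h1 h2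
    exact ⟨X', (h4 A h2 m hAm).1 hBm⟩
  · obtain ⟨X', -, -, h4⟩ := h.f3 hA h1 h2
    exact ⟨X', (h4 B h2 m hBm).1 hAm⟩

theorem Hyp.clb (h : Hyp H I r) {A B : L} {a b m : P} (hAB : A ≠ B) (hA : Cc H I a A)
    (hB : Cc H I b B) (hAm : I m A) (hBm : I m B) : ∃ C, Cc H I m C := by
  obtain ⟨C, hC⟩ := h.dual.cla hAB (cc_dual.2 hA) (cc_dual.2 hB) hAm hBm
  exact ⟨C, cc_dual.1 hC⟩

/-- the good situation -/
def G1 (H : Type*) {P L : Type*} [Group H] [MulAction H P] [MulAction H L] (I : P → L → Prop) : Prop :=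
  ∃ l X m D2, I X l ∧ I X m ∧ l ≠ m ∧ (∀ Y, I Y m → Y ≠ X → Cc H I Y l) ∧ ¬ I D2 m ∧ Cc H I D2 l

/-- part c -/
theorem Hyp.cc (h : Hyp H I r) {Q : P} (hQ : ∀ k, ¬ Cc H I Q k) : G1 H I := by
  have ax : ∀ Q : P, (∀ k, ¬ Cc H I Q k) → ∀ m, ¬ I Q m → ∃ C k, I C m ∧ I Q k ∧ Cc H I C k := by
    intro Q hQ m hm
    exact (h.af Q m hm).resolve_left (hQ m)
  obtain ⟨m0, hm0, -⟩ := h.pl.ln_off Q Q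
  obtain ⟨C0, k, -, hQk, hk⟩ := ax Q hQ m0 hm0
  have huniq : ∀ k' C, I Q k' → Cc H I C k' → k' = k := by
    intro k' C h1 h2
    by_contra hne
    obtain ⟨c, hc⟩ := h.clb hne h2 hk h1 hQk
    exact hQ c hc
  have ax2 : ∀ m, ¬ I Q m → ∃ C, I C m ∧ Cc H I C k := by
    intro m hm
    obtain ⟨C, k', h1, h2, h3⟩ := ax Q hQ m hm
    rw [huniq k' C h2 h3] at h3
    exact ⟨C, h1, h3⟩
  have noX : ∀ X, I X k → ∀ g, ¬ Cc H I X g := by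
    intro X hXk g hX
    have lines : ∀ X, I X k → (∃ g, Cc H I X g) → ∀ m, I X m → ∃ C, Cc H I C m := by
      rintro X hXk ⟨g, hX⟩ m hXm
      have hXQ : X ≠ Q := by rintro rfl; exact hQ g hX
      by_cases e : m = k
      · exact ⟨C0, e ▸ hk⟩
      have hQm : ¬ I Q m := fun hc => e (h.pl.eqL hXQ hXm hc hXk hQk)
      obtain ⟨C, h1, h2⟩ := ax2 m hQm
      exact h.cla (by rintro rfl; exact h2.off h hXk) h2 hX h1 hXm
    obtain ⟨X', h1, h2, h3⟩ := h.f3 hX hXk hk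
    obtain ⟨m1, m1a, m1b⟩ := h.pl.ln C0 X
    have hX' : Cc H I X' m1 := (h3 C0 hk m1 m1a).1 m1b
    have off : ∀ Y, ¬ I Y k → ∃ g, Cc H I Y g := by
      intro Y hY
      obtain ⟨a, a1, a2⟩ := h.pl.ln Y X
      obtain ⟨b, b1, b2⟩ := h.pl.ln Y X'
      obtain ⟨c1, hc1⟩ := lines X hXk ⟨g, hX⟩ a a2
      obtain ⟨c2, hc2⟩ := lines X' h1 ⟨m1, hX'⟩ b b2
      refine h.clb ?_ hc1 hc2 a1 b1
      rintro rfl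
      have := h.pl.eqL h2 b2 a2 h1 hXk
      rw [this] at a1
      exact hY a1
    obtain ⟨m, hm1, hm2, -⟩ := h.pl.ln_on Q k k
    obtain ⟨y1, a1, a2, -⟩ := h.pl.pt_on m Q Q
    obtain ⟨y2, b1, b2, b3⟩ := h.pl.pt_on m Q y1
    have n1 : ¬ I y1 k := fun hc => a2 (h.pl.eqP hm2 a1 hc hm1 hQk)
    have n2 : ¬ I y2 k := fun hc => b2 (h.pl.eqP hm2 b1 hc hm1 hQk)
    obtain ⟨g1, hg1⟩ := off y1 n1
    obtain ⟨g2, hg2⟩ := off y2 n2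
    obtain ⟨C, hC⟩ := h.cla b3 hg2 hg1 b1 a1
    exact hm2 (huniq m C hm1 hC)
  have onlyk : ∀ k' C, Cc H I C k' → k' = k := by
    intro k' C hC
    by_contra hne
    obtain ⟨X, x1, x2⟩ := h.pl.pt k' k
    obtain ⟨g, hg⟩ := h.clb hne hC hk x1 x2
    exact noX X x2 g hg
  have offk : ∀ Y, ¬ I Y k → Cc H I Y k := by
    intro Y hY
    by_contra hc
    have hY2 : ∀ g, ¬ Cc H I Y g := by
      intro g hg
      rw [onlyk g Y hg] at hg
      exact hc hg
    obtain ⟨m, hm, -⟩ := h.pl.ln_off Y Y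
    obtain ⟨C, k', h1, h2, h3⟩ := ax Y hY2 m hm
    rw [onlyk k' C h3] at h2
    exact hY h2
  obtain ⟨m, hm1, hm2, -⟩ := h.pl.ln_on Q k k
  obtain ⟨D2, d1, d2⟩ := h.pl.pt_off k m
  refine ⟨k, Q, m, D2, hQk, hm1, hm2.symm, fun Y hY hYQ => offk Y fun hc => hYQ ?_, d2, offk D2 d1⟩
  exact h.pl.eqP hm2 hY hc hm1 hQk

end cc
end AF
namespace AF

theorem fib_card {P Q : Type*} [Finite P] [Finite Q] (s : Set P) (t : Set Q) (f : P → Q)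
    (hf : ∀ x ∈ s, f x ∈ t) (a : ℕ) (ha : ∀ y ∈ t, {x | x ∈ s ∧ f x = y}.ncard = a) :
    s.ncard = t.ncard * a := by
  classical
  have := Fintype.ofFinite P
  have := Fintype.ofFinite Q
  rw [Set.ncard_eq_toFinset_card', Set.ncard_eq_toFinset_card',
    Finset.card_eq_sum_card_fiberwise (f := f) (t := t.toFinset)]
  · rw [Finset.sum_const_nat]
    intro y hy
    rw [← ha y (by simpa using hy), Set.ncard_eq_toFinset_card']
    congr 1
    ext x
    simp
  · intro x hx
    simpa using hf x (by simpa using hx)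

section cnt
variable {H P L : Type*} [Group H] [MulAction H P] [MulAction H L] {r : ℕ} {I : P → L → Prop}
variable [Finite P] [Finite L] [Finite H]

theorem Hyp.n_le (h : Hyp H I r) {l m m' : L} {X D D' : P} (hX : I X l) (hXm : I X m)
    (hXm' : I X m') (hDm : I D m) (hDm' : I D' m') (hD : Cc H I D l) (hD' : Cc H I D' l) :
    {E | Cc H I E l ∧ I E m}.ncard ≤ {E | Cc H I E l ∧ I E m'}.ncard := by
  obtain ⟨u, u1, u2⟩ := h.f1' hD hD'
  have hul := h.pl.axis_fix h.pr u1
  have hum : u • m = m' := by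
    refine h.pl.eqL (p := X) (q := D') ?_ ?_ ?_ hXm' hDm'
    · rintro rfl; exact hD'.off h hX
    · have := h.pr u _ _ hXm
      rwa [u1 X hX] at this
    · have := h.pr u _ _ hDm
      rwa [u2] at this
  refine Set.ncard_le_ncard_of_injOn (fun x => u • x) ?_ ?_ (Set.toFinite _)
  · rintro x ⟨h1, h2⟩
    refine ⟨?_, ?_⟩
    · have := h1.smul h u
      rwa [hul] at this
    · have := h.pr u _ _ h2
      rwa [hum] at this
  · intro a _ b _ hab
    exact smul_left_cancel u hab

theorem Hyp.n_eq (h : Hyp H I r) {l m m' : L} {X D D' : P} (hX : I X l) (hXm : I X m)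
    (hXm' : I X m') (hDm : I D m) (hDm' : I D' m') (hD : Cc H I D l) (hD' : Cc H I D' l) :
    {E | Cc H I E l ∧ I E m}.ncard = {E | Cc H I E l ∧ I E m'}.ncard :=
  le_antisymm (h.n_le hX hXm hXm' hDm hDm' hD hD') (h.n_le hX hXm' hXm hDm' hDm hD' hD)

theorem Hyp.cnt (h : Hyp H I r) {l m1 m2 : L} {D Y1 Y2 : P} (hD : Cc H I D l) (h1 : I Y1 l)
    (h2 : I Y2 l) (hne : Y1 ≠ Y2) (d1 : I D m1) (d2 : I D m2) (y1 : I Y1 m1) (y2 : I Y2 m2) :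
    {E | Cc H I E l ∧ I E m1}.ncard * {E | Cc H I E l ∧ I E m2}.ncard ≤ {E | Cc H I E l}.ncard ∧
    (Cc H I Y1 m2 → {E | Cc H I E l}.ncard =
      {E | Cc H I E l ∧ I E m1}.ncard * {E | Cc H I E l ∧ I E m2}.ncard) := by
  have hDl := hD.off h
  have hY1 : ¬ I Y1 m2 := by
    intro hc
    have := h.pl.eqL hne hc y2 h1 h2
    rw [this] at d2
    exact hDl d2
  have hex : ∀ F : P, ∃ E k, I E m2 ∧ I F k ∧ I Y1 k ∧ I E k := by
    intro F
    obtain ⟨k, k1, k2⟩ := h.pl.ln F Y1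
    obtain ⟨E, e1, e2⟩ := h.pl.pt k m2
    exact ⟨E, k, e2, k1, k2, e1⟩
  choose f kk hf1 hf2 hf3 hf4 using hex
  have fu : ∀ F E k, Cc H I F l → I F k → I Y1 k → I E k → I E m2 → f F = E := by
    intro F E k hF a1 a2 a3 a4
    have e : k = kk F := h.pl.eqL (by rintro rfl; exact hF.off h h1) a1 a2 (hf2 F) (hf3 F)
    subst e
    exact h.pl.eqP (by intro hc; rw [hc] at a2; exact hY1 a2) (hf4 F) (hf1 F) a3 a4
  set T := {F | Cc H I F l ∧ Cc H I (f F) l} with hT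
  have key : T.ncard = {E | Cc H I E l ∧ I E m2}.ncard * {E | Cc H I E l ∧ I E m1}.ncard := by
    refine fib_card T {E | Cc H I E l ∧ I E m2} f (fun x hx => ⟨hx.2, hf1 x⟩) _ ?_
    rintro E ⟨e1, e2⟩
    obtain ⟨k, k1, k2⟩ := h.pl.ln E Y1
    have : {x | x ∈ T ∧ f x = E} = {F | Cc H I F l ∧ I F k} := by
      ext F
      constructor
      · rintro ⟨⟨a1, a2⟩, rfl⟩
        refine ⟨a1, ?_⟩
        have : kk F = k := h.pl.eqL (by intro hc; rw [← hc] at h1; exact e1.off h h1)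
          (hf4 F) (hf3 F) k1 k2
        rw [← this]; exact hf2 F
      · rintro ⟨a1, a2⟩
        have := fu F E k a1 a2 k2 k1 e2
        exact ⟨⟨a1, by rw [this]; exact e1⟩, this⟩
    rw [this]
    exact h.n_eq h1 k2 y1 k1 d1 e1 hD
  constructor
  · rw [mul_comm, ← key]
    exact Set.ncard_le_ncard (fun x hx => hx.1) (Set.toFinite _)
  · intro hc
    rw [mul_comm, ← key]
    congr 1
    ext F
    constructor
    · intro hF
      refine ⟨hF, ?_⟩
      obtain ⟨s, hs⟩ := hc
      have hF' : Cc H I F l := hF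
      obtain ⟨t, ht⟩ := hF'
      have hF' : Cc H I F l := hF
      obtain ⟨E, ⟨hE1, hE2⟩, hE3⟩ := odd_fix hs.2.1 {E | Cc H I E l ∧ I E (kk F)} (by
          rintro x ⟨x1, x2⟩
          refine ⟨?_, ?_⟩
          · have := x1.smul h s
            rwa [hs.2.2.2 l h1] at this
          · have := h.pr s _ _ x2
            rwa [hs.2.2.2 _ (hf3 F)] at this) (by
          refine h.f2 ht _ ?_ (fun x hx => hx.1.off h) ⟨hF', hf2 F⟩
          rintro x ⟨x1, x2⟩
          refine ⟨?_, ?_⟩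
          · have := x1.smul h t
            rwa [h.pl.axis_fix h.pr ht.2.2.1] at this
          · have := h.pr t _ _ x2
            rwa [ht.2.2.2 _ (hf2 F)] at this)
      have : f F = E := fu F E (kk F) hF (hf2 F) (hf3 F) hE2
        ((hs.fixed h hE3).resolve_right (by rintro rfl; exact hE1.off h h1))
      rw [this]; exact hE1
    · exact fun hF => hF.1

theorem Hyp.line (h : Hyp H I r) (hG : ∀ X, ∃ k, Cc H I X k) {l : L} {D0 : P} (hD0 : Cc H I D0 l) :
    G1 H I ∨ (∀ D, Cc H I D l → D = D0) ∨ ∃ Y0, I Y0 l ∧ ∀ X, I X l → X ≠ Y0 →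
      ∀ D, Cc H I D l → ∀ m, I D m → (I Y0 m → Cc H I X m) ∧ (I X m → Cc H I Y0 m) ∧
        (I X m → ∀ D', Cc H I D' l → I D' m → D' = D) := by
  classical
  have hDl := hD0.off h
  choose mm hm1 hm2 using fun X => h.pl.ln D0 X
  set A : P → ℕ := fun X => {E | Cc H I E l ∧ I E (mm X)}.ncard with hA
  set c := {E | Cc H I E l}.ncard with hc
  have hApos : ∀ X, 0 < A X := fun X => (Set.ncard_pos (Set.toFinite _)).2 ⟨D0, hD0, hm1 X⟩
  obtain ⟨X0, hX0⟩ := h.pl.line_pt l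
  obtain ⟨Y0, hY0, hmax⟩ := Set.exists_max_image {X | I X l} A (Set.toFinite _) ⟨X0, hX0⟩
  have hY0' : I Y0 l := hY0
  have part : ∀ X, I X l → X ≠ Y0 → c = A Y0 * A X ∧ ∃ X', I X' l ∧ X' ≠ X ∧ A X' = A Y0 ∧
      ∀ D, Cc H I D l → ∀ m, I D m → (I X m → Cc H I X' m) ∧ (I X' m → Cc H I X m) := by
    intro X hX hne
    obtain ⟨g, hg⟩ := hG X
    obtain ⟨X', a1, a2, a3⟩ := h.f3 hg hX hD0
    have b1 := (h.cnt hD0 a1 hX a2 (hm1 X') (hm1 X) (hm2 X') (hm2 X)).2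
      ((a3 D0 hD0 _ (hm1 X)).1 (hm2 X))
    have b2 := (h.cnt hD0 hY0' hX hne.symm (hm1 Y0) (hm1 X) (hm2 Y0) (hm2 X)).1
    have b3 := hmax X' a1
    change c = A X' * A X at b1
    change A Y0 * A X ≤ c at b2
    have b4 : A X' = A Y0 := by
      rw [b1] at b2
      exact le_antisymm b3 (Nat.le_of_mul_le_mul_right b2 (hApos X))
    exact ⟨by rw [b1, b4], X', a1, a2, b4, a3⟩
  obtain ⟨X1, hX1, hX1n, -⟩ := h.pl.pt_on l Y0 Y0
  set b := A X1 with hb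
  have hAb : ∀ X, I X l → X ≠ Y0 → A X = b := by
    intro X hX hne
    have b1 := (part X hX hne).1
    have b2 := (part X1 hX1 hX1n).1
    rw [b1] at b2
    exact Nat.eq_of_mul_eq_mul_left (hApos Y0) b2
  have hcab : c = A Y0 * b := (part X1 hX1 hX1n).1
  -- the count
  have hcnt : {E | Cc H I E l ∧ ¬ I E (mm Y0)}.ncard = r * (b - 1) := by
    have hex : ∀ E : P, ∃ X k, I X l ∧ I D0 k ∧ I E k ∧ I X k := by
      intro E
      obtain ⟨k, k1, k2⟩ := h.pl.ln D0 E
      obtain ⟨X, x1, x2⟩ := h.pl.pt k l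
      exact ⟨X, k, x2, k1, k2, x1⟩
    choose f kk f1 f2 f3 f4 using hex
    have fm : ∀ E, kk E = mm (f E) := fun E =>
      h.pl.eqL (by intro hc; have := f1 E; rw [← hc] at this; exact hDl this) (f2 E) (f4 E) (hm1 _) (hm2 _)
    rw [← h.pl.card_diff hY0']
    refine fib_card _ _ f ?_ _ ?_
    · rintro E ⟨e1, e2⟩
      refine ⟨f1 E, fun hc => e2 ?_⟩
      rw [← hc, ← fm]; exact f3 E
    · rintro X ⟨x1, x2⟩
      have e : {x | x ∈ {E | Cc H I E l ∧ ¬ I E (mm Y0)} ∧ f x = X} =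
          {E | Cc H I E l ∧ I E (mm X)} \ {D0} := by
        ext E
        simp only [Set.mem_ofPred_eq, Set.mem_sdiff, Set.mem_singleton_iff]
        constructor
        · rintro ⟨⟨a1, a2⟩, rfl⟩
          refine ⟨⟨a1, by rw [← fm]; exact f3 E⟩, ?_⟩
          rintro rfl
          exact a2 (hm1 Y0)
        · rintro ⟨⟨a1, a2⟩, a3⟩
          have e2 : mm X = kk E := h.pl.eqL a3 a2 (hm1 X) (f3 E) (f2 E)
          have e3 : f E = X := by
            refine h.pl.eqP (l := kk E) (m := l) ?_ (f4 E) (f1 E) (e2 ▸ hm2 X) x1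
            intro hc; have := f2 E; rw [hc] at this; exact hDl this
          refine ⟨⟨a1, fun hc => ?_⟩, e3⟩
          have e4 : mm X = mm Y0 := h.pl.eqL a3 a2 (hm1 X) hc (hm1 Y0)
          refine x2 (h.pl.eqP (l := mm X) (m := l) ?_ (hm2 X) x1 (e4 ▸ hm2 Y0) hY0')
          intro hc; have := hm1 X; rw [hc] at this; exact hDl this
      rw [e]
      have h5 := Set.ncard_sdiff_singleton_add_one (s := {E | Cc H I E l ∧ I E (mm X)}) (a := D0) ⟨hD0, hm1 X⟩ (Set.toFinite _)
      have h6 := hAb X x1 x2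
      change {E | Cc H I E l ∧ I E (mm X)}.ncard = b at h6
      omega
  have hsum : c = A Y0 + r * (b - 1) := by
    rw [← hcnt, hc]
    rw [← Set.ncard_union_eq]
    · congr 1
      ext E
      simp only [Set.mem_ofPred_eq, Set.mem_union]
      tauto
    · rw [Set.disjoint_left]
      rintro E ⟨_, e1⟩ ⟨_, e2⟩
      exact e2 e1
  have hbpos : 0 < b := hApos X1
  have hr2 := h.pl.two_le
  rcases Nat.lt_or_ge 1 b with hb1 | hb1
  · -- b > 1
    left
    obtain ⟨d, hd⟩ := Nat.exists_eq_add_of_lt hb1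
    have e1 : A Y0 = r := by
      have e2 : A Y0 * b = A Y0 + r * (b - 1) := hcab ▸ hsum
      have e3 : b - 1 = d + 1 := by omega
      rw [e3] at e2
      have e4 : A Y0 * (d + 1) = r * (d + 1) := by
        have : A Y0 * b = A Y0 * (d + 1) + A Y0 := by rw [hd]; ring
        omega
      exact Nat.eq_of_mul_eq_mul_right (Nat.succ_pos d) e4
    have hne : l ≠ mm Y0 := by
      rintro e; have := hm1 Y0; rw [← e] at this; exact hDl this
    have e5 : {E | Cc H I E l ∧ I E (mm Y0)} = {E | I E (mm Y0) ∧ E ≠ Y0} := by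
      refine Set.eq_of_subset_of_ncard_le ?_ ?_ (Set.toFinite _)
      · rintro E ⟨a1, a2⟩
        exact ⟨a2, by rintro rfl; exact a1.off h hY0'⟩
      · rw [h.pl.card_diff (hm2 Y0)]
        exact e1.ge
    have e6 : 0 < {E | Cc H I E l ∧ ¬ I E (mm Y0)}.ncard := by
      rw [hcnt]
      exact Nat.mul_pos (by omega) (by omega)
    obtain ⟨D2, d1, d2⟩ := (Set.ncard_pos (Set.toFinite _)).1 e6
    refine ⟨l, Y0, mm Y0, D2, hY0', hm2 Y0, hne, fun Y y1 y2 => ?_, d2, d1⟩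
    have : Y ∈ {E | I E (mm Y0) ∧ E ≠ Y0} := ⟨y1, y2⟩
    rw [← e5] at this
    exact this.1
  · right
    have hb' : b = 1 := by omega
    rw [hb', mul_one] at hcab
    by_cases hc1 : c = 1
    · left
      intro D hD
      rw [hc, Set.ncard_eq_one] at hc1
      obtain ⟨y, hy⟩ := hc1
      have h1 : D ∈ ({y} : Set P) := hy ▸ hD
      have h2 : D0 ∈ ({y} : Set P) := hy ▸ hD0
      rw [Set.mem_singleton_iff] at h1 h2
      rw [h1, h2]
    · right
      refine ⟨Y0, hY0', fun X hX hne D hD m hDm => ?_⟩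
      obtain ⟨-, X', a1, a2, a3, a4⟩ := part X hX hne
      have : X' = Y0 := by
        by_contra hcon
        have := hAb X' a1 hcon
        omega
      subst this
      refine ⟨(a4 D hD m hDm).2, (a4 D hD m hDm).1, fun hXm D' hD' hD'm => ?_⟩
      have h6 := hAb X hX hne
      rw [hb'] at h6
      have h7 := h.n_eq hX (hm2 X) hXm (hm1 X) hDm hD0 hD
      change A X = _ at h7
      rw [h6] at h7
      obtain ⟨y, hy⟩ := Set.ncard_eq_one.1 h7.symm
      have h1 : D ∈ ({y} : Set P) := hy ▸ ⟨hD, hDm⟩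
      have h2 : D' ∈ ({y} : Set P) := hy ▸ ⟨hD', hD'm⟩
      rw [Set.mem_singleton_iff] at h1 h2
      rw [h1, h2]

theorem Hyp.B (h : Hyp H I r) (hG : ∀ X, ∃ k, Cc H I X k) (hL : ∀ l, ∃ D, Cc H I D l) :
    G1 H I ∨ G1 H (fun l p => I p l) ∨ ∀ l D D', Cc H I D l → Cc H I D' l → D = D' := by
  by_cases hg : G1 H I
  · exact Or.inl hg
  right
  by_cases hu : ∀ l D D', Cc H I D l → Cc H I D' l → D = D'
  · exact Or.inr hu
  left
  push Not at hu
  obtain ⟨l, D0, D', hD0, hD', hDD⟩ := hu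
  obtain ⟨Y0, hY0, key⟩ := ((h.line hG hD0).resolve_left hg).resolve_left
    (fun hc => hDD (hc D' hD').symm)
  obtain ⟨j, j1, j2⟩ := h.pl.ln D0 Y0
  have hlj : l ≠ j := by rintro rfl; exact hD0.off h j1
  have hj : ∀ X, I X l → X ≠ Y0 → Cc H I X j := fun X x1 x2 => (key X x1 x2 D0 hD0 j j1).1 j2
  obtain ⟨Z, z1, z2, -⟩ := h.pl.pt_on l Y0 Y0
  obtain ⟨Z2, w1, w2, w3⟩ := h.pl.pt_on l Y0 Z
  have hZ := hj Z z1 z2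
  have hZ2 := hj Z2 w1 w2
  obtain ⟨Y1, hY1, key2⟩ := ((h.line hG hZ).resolve_left hg).resolve_left
    (fun hc => w3 (hc Z2 hZ2))
  have e : Y0 = Y1 := by
    by_contra hne
    exact w3 ((key2 Y0 j2 hne Z hZ l z1).2.2 hY0 Z2 hZ2 w1)
  subst e
  have fin : ∀ Z, I Z l → Z ≠ Y0 → ∀ y, I Z y → y ≠ l → Cc H I Y0 y := by
    intro Z z1 z2 y y1 y2
    obtain ⟨X, x1, x2⟩ := h.pl.pt y j
    have hX : X ≠ Y0 := by
      rintro rfl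
      exact y2 (h.pl.eqL z2 y1 x1 z1 hY0)
    exact (key2 X x2 hX Z (hj Z z1 z2) y y1).2.1 x1
  obtain ⟨y2, a1, a2, -⟩ := h.pl.ln_on Z2 l l
  refine ⟨Y0, l, Z, y2, hY0, z1, z2.symm, fun y y1 y2 => cc_dual.2 (fin Z z1 z2 y y1 y2), ?_,
    cc_dual.2 (fin Z2 w1 w2 y2 a1 a2)⟩
  intro hc
  exact w3 (h.pl.eqP a2 a1 w1 hc z1)

theorem Hyp.polarity (h : Hyp H I r) (hG : ∀ X, ∃ k, Cc H I X k) (hL : ∀ l, ∃ D, Cc H I D l)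
    (hu : ∀ l D D', Cc H I D l → Cc H I D' l → D = D') : False := by
  classical
  have := Fintype.ofFinite P
  choose k hk using hG
  have kinj : Function.Injective k := by
    intro a b hab
    exact hu (k a) a b (hk a) (hab ▸ hk b)
  have kbij : Function.Bijective k :=
    Nat.bijective_iff_injective_and_card k |>.2 ⟨kinj, by rw [h.pl.cardP, h.pl.cardL]⟩
  have kun : ∀ p m, Cc H I p m → m = k p := by
    intro p m hm
    obtain ⟨q, rfl⟩ := kbij.2 m
    rw [hu _ _ _ hm (hk q)]
  have sym : ∀ p q, I p (k q) → I q (k p) := by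
    intro p q hpq
    obtain ⟨X', a1, a2, a3⟩ := h.f3 (hk p) hpq (hk q)
    obtain ⟨m, m1, m2⟩ := h.pl.ln q X'
    rw [← kun p m ((a3 q (hk q) m m1).2 m2)]
    exact m1
  have hr2 := h.pl.two_le
  set p' := r.minFac with hp'
  have : Fact p'.Prime := ⟨Nat.minFac_prime (by omega)⟩
  have hr0 : (r : ZMod p') = 0 := (ZMod.natCast_eq_zero_iff _ _).2 (Nat.minFac_dvd r)
  let M : Matrix P P (ZMod p') := fun p q => if I p (k q) then 1 else 0
  let J : Matrix P P (ZMod p') := fun _ _ => 1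
  have hMM : M * M = J := by
    ext p q
    rw [Matrix.mul_apply]
    have e : ∀ x, M p x * M x q = if (I x (k p) ∧ I x (k q)) then 1 else 0 := by
      intro x
      have : I p (k x) ↔ I x (k p) := ⟨sym p x, sym x p⟩
      simp only [M, this]
      by_cases h1 : I x (k p) <;> by_cases h2 : I x (k q) <;> simp [h1, h2]
    simp only [e]
    rw [Finset.sum_boole]
    have e2 : (Finset.filter (fun x => I x (k p) ∧ I x (k q)) Finset.univ).card =
        {x | I x (k p) ∧ I x (k q)}.ncard := by
      rw [Set.ncard_eq_toFinset_card']
      congr 1; ext x; simp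
    rw [e2]
    by_cases hpq : p = q
    · subst hpq
      simp only [and_self]
      rw [h.pl.line_card]
      push_cast
      rw [hr0, zero_add]
    · obtain ⟨x, x1, x2⟩ := h.pl.pt (k p) (k q)
      have : {x | I x (k p) ∧ I x (k q)} = {x} := by
        ext y
        constructor
        · rintro ⟨y1, y2⟩
          exact h.pl.eqP (fun hc => hpq (kinj hc)) y1 y2 x1 x2
        · rintro rfl; exact ⟨x1, x2⟩
      rw [this, Set.ncard_singleton]; simp [J]
  have hMJ : J * M = J := by
    ext p q
    rw [Matrix.mul_apply]
    simp only [J, M, one_mul]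
    rw [Finset.sum_boole]
    have e2 : (Finset.filter (fun x => I x (k q)) Finset.univ).card =
        {x | I x (k q)}.ncard := by
      rw [Set.ncard_eq_toFinset_card']
      congr 1; ext x; simp
    rw [e2, h.pl.line_card]
    push_cast
    rw [hr0, zero_add]
  have hpow : ∀ m, M ^ (m + 2) = J := by
    intro m
    induction m with
    | zero => rw [zero_add, sq, hMM]
    | succ m ih => rw [show m + 1 + 2 = m + 2 + 1 by ring, pow_succ, ih, hMJ]
  have h1 := ZMod.trace_pow_card M
  have h2 : Matrix.trace M = 0 := by
    refine Finset.sum_eq_zero fun x _ => ?_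
    simp only [Matrix.diag, M]
    rw [if_neg ((hk x).off h)]
  have h3 : Matrix.trace J = 1 := by
    simp only [Matrix.trace, Matrix.diag, J]
    rw [Finset.sum_const, Finset.card_univ, ← Nat.card_eq_fintype_card, h.pl.cardP]
    simp [hr0]
  have hJ : M ^ p' = J := by
    have := hpow (p' - 2)
    rwa [Nat.sub_add_cancel (Fact.out : p'.Prime).two_le] at this
  rw [h2, zero_pow (Fact.out : p'.Prime).ne_zero, hJ, h3] at h1
  exact one_ne_zero h1

theorem Plane.exp_lemma (hP : Plane I r) (hp : Pres H I) (hF : Fth H P) {f e : H} {l : L} {X X2 : P}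
    (hX : I X l) (hX2 : I X2 l) (hne : X ≠ X2) (fa : Axis I f l) (fc : Center I f X2)
    (ea : Axis I e l) (ec : Center I e X) (he : e ≠ 1) :
    f * e = e * f ∧ ∀ N : ℕ, e ^ N = 1 → f ^ N = 1 := by
  have two : ∀ (g : H) c d, c ≠ d → Center I g c → Center I g d → g = 1 :=
    fun g c d hcd h1 h2 => hF g (hP.two_centers hp hcd h1 h2)
  have hcom : f * e * f⁻¹ * e⁻¹ = 1 := by
    refine two _ X X2 hne ?_ ?_
    · have := ec.conj hp f
      rw [fa X hX] at this
      exact this.mul ec.inv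
    · have := fc.inv.conj hp e
      rw [ea X2 hX2] at this
      have h2 := fc.mul this
      have e : f * (e * f⁻¹ * e⁻¹) = f * e * f⁻¹ * e⁻¹ := by simp only [mul_assoc]
      rwa [e] at h2
  have hfe : f * e = e * f := by
    have := mul_inv_eq_one.1 hcom
    exact mul_inv_eq_iff_eq_mul.1 this
  refine ⟨hfe, fun N hN => ?_⟩
  obtain ⟨Z, hZ⟩ := hP.exists_center hp (fa.mul ea)
  have hZ2 : Z ≠ X2 := by
    rintro rfl
    have := fc.inv.mul hZ
    rw [inv_mul_cancel_left] at this
    exact he (two e X Z hne ec this)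
  have h1 := hZ.pow N
  rw [(show Commute f e from hfe).mul_pow, hN, mul_one] at h1
  exact two _ _ _ hZ2 h1 (fc.pow N)

theorem Hyp.g1 (h : Hyp H I r) (hg : G1 H I) : ∃ p b : ℕ, p.Prime ∧ r = p ^ b ∧
    ∃ e : H, e ^ p = 1 ∧ Elat I e := by
  obtain ⟨l, X, m, D2, hXl, hXm, hlm, hm, hD2m, hD2⟩ := hg
  have hr2 := h.pl.two_le
  let E : Subgroup H :=
    { carrier := {g | Axis I g l ∧ Center I g X}
      mul_mem' := fun a b => ⟨a.1.mul b.1, a.2.mul b.2⟩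
      one_mem' := ⟨Axis.one, Center.one⟩
      inv_mem' := fun a => ⟨a.1.inv, a.2.inv⟩ }
  obtain ⟨D, d1, d2, -⟩ := h.pl.pt_on m X X
  have hD := hm D d1 d2
  have hcard : Nat.card E = r := by
    rw [← h.pl.card_diff hXm, ← Nat.card_coe_set_eq]
    refine Nat.card_congr (Equiv.ofBijective (fun g => ⟨g.1 • D, ?_, ?_⟩) ⟨?_, ?_⟩)
    · have := h.pr g.1 _ _ d1
      rwa [g.2.2 m hXm] at this
    · intro hc
      have h2 := h.pl.center_fix h.pr g.2.2
      exact d2 (smul_left_cancel g.1 (hc.trans h2.symm))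
    · rintro ⟨a, a1, a2⟩ ⟨b, b1, b2⟩ hab
      have hab' : a • D = b • D := congrArg Subtype.val hab
      apply Subtype.ext
      by_contra hne
      change a ≠ b at hne
      have h3 : (b⁻¹ * a) • D = D := by rw [mul_smul, hab', inv_smul_smul]
      have h4 : b⁻¹ * a ≠ 1 := fun hc => hne (by rw [inv_mul_eq_one] at hc; exact hc.symm)
      rcases h.pl.persp_fixed h.pr (b1.inv.mul a1) (b2.inv.mul a2) (fth_nt h.ft h4) h3 with h5 | h5
      · exact hD.off h h5
      · exact d2 h5
    · rintro ⟨Y, y1, y2⟩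
      obtain ⟨g, g1, g2, g3⟩ := h.f1 hD (hm Y y1 y2) d1 y1 hXm hXl
      exact ⟨⟨g, g1, g2⟩, Subtype.ext g3⟩
  obtain ⟨k, k1, k2⟩ := h.pl.ln D D2
  obtain ⟨X2, x1, x2⟩ := h.pl.pt k l
  have hDD2 : D ≠ D2 := by rintro rfl; exact hD2m d1
  have hXX2 : X ≠ X2 := by
    rintro rfl
    have := h.pl.eqL d2 d1 hXm k1 x1
    rw [this] at hD2m
    exact hD2m k2
  obtain ⟨s, hs⟩ := hD
  obtain ⟨t, ht⟩ := hD2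
  obtain ⟨f1, f2, f3⟩ := h.prod_elat hs ht hDD2 k1 k2 x1 x2
  set f := s * t
  set p := r.minFac with hp
  have hpp : p.Prime := Nat.minFac_prime (by omega)
  have : Fact p.Prime := ⟨hpp⟩
  obtain ⟨e, he⟩ := exists_prime_orderOf_dvd_card' (G := E) p (hcard ▸ Nat.minFac_dvd r)
  have hep : (e : H) ^ p = 1 := by
    have := pow_orderOf_eq_one e
    rw [he] at this
    exact congrArg Subtype.val this
  have hene : (e : H) ≠ 1 := by
    intro hc
    have : e = 1 := Subtype.ext hc
    rw [this, orderOf_one] at he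
    exact hpp.one_lt.ne he
  have hfp := (h.pl.exp_lemma h.pr h.ft hXl x2 hXX2 f2 f3 e.2.1 e.2.2 hene).2 p hep
  have hall : ∀ g : E, g ^ p = 1 := by
    intro g
    exact Subtype.ext ((h.pl.exp_lemma h.pr h.ft x2 hXl hXX2.symm g.2.1 g.2.2 f2 f3 f1).2 p hfp)
  have hpg : IsPGroup p E := fun g => ⟨1, by rw [pow_one]; exact hall g⟩
  obtain ⟨b, hb⟩ := IsPGroup.iff_card.1 hpg
  exact ⟨p, b, hpp, by rw [← hcard, hb], e, hep, l, X, hXl, e.2.1, e.2.2, fth_nt h.ft hene⟩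

/-- the conclusion of the combinatorial part -/
theorem Hyp.main (h : Hyp H I r) : ∃ p b : ℕ, p.Prime ∧ r = p ^ b ∧
    ∃ e : H, e ^ p = 1 ∧ Elat I e := by
  have dualc : G1 H (fun l p => I p l) → ∃ p b : ℕ, p.Prime ∧ r = p ^ b ∧
    ∃ e : H, e ^ p = 1 ∧ Elat I e := by
    intro hg
    obtain ⟨p, b, h1, h2, e, h3, h4⟩ := h.dual.g1 hg
    exact ⟨p, b, h1, h2, e, h3, h4.dual h.pl.dual h.pr.dual⟩
  by_cases hG : ∀ X, ∃ k, Cc H I X k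
  · by_cases hL : ∀ l, ∃ D, Cc H I D l
    · rcases h.B hG hL with h1 | h1 | h1
      · exact h.g1 h1
      · exact dualc h1
      · exact (h.polarity hG hL h1).elim
    · push Not at hL
      obtain ⟨l, hl⟩ := hL
      exact dualc (h.dual.cc (Q := l) (fun k hk => hl k (cc_dual.1 hk)))
  · push Not at hG
    obtain ⟨Q, hQ⟩ := hG
    exact h.g1 (h.cc hQ)

end cnt
end AF
namespace AF

section grp
variable {G : Type*} [Group G] {p : ℕ} [Finite G] [hp : Fact p.Prime]

theorem pelt (p : ℕ) [hp : Fact p.Prime] (g : G) :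
    ∃ m k : ℕ, m.Coprime p ∧ (g ^ m) ^ (p ^ k) = 1 := by
  obtain ⟨k, m, h1, h2⟩ := Nat.exists_eq_pow_mul_and_not_dvd (orderOf_pos g).ne' p hp.out.ne_one
  refine ⟨m, k, ?_, ?_⟩
  · exact ((Nat.Prime.coprime_iff_not_dvd hp.out).2 h1).symm
  · rw [← pow_mul, mul_comm, ← h2, pow_orderOf_eq_one]

theorem zp_pg {x : G} {k : ℕ} (hx : x ^ (p ^ k) = 1) : IsPGroup p (Subgroup.zpowers x) := by
  have h1 : orderOf x ∣ p ^ k := orderOf_dvd_of_pow_eq_one hx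
  obtain ⟨j, -, hj⟩ := (Nat.dvd_prime_pow hp.out).1 h1
  exact IsPGroup.of_card (n := j) (by rw [Nat.card_zpowers, hj])

theorem pg_sup {S : Subgroup G} (hS : IsPGroup p S) {x : G} {k : ℕ} (hx : x ^ (p ^ k) = 1)
    (hn : x ∈ Subgroup.normalizer (S : Set G)) :
    IsPGroup p (S ⊔ Subgroup.zpowers x : Subgroup G) :=
  hS.to_sup_of_normal_left' (zp_pg hx) (by rwa [Subgroup.zpowers_le])

theorem IsSyl.mem_of_norm {K S : Subgroup G} (h : IsSyl p K S) {x : G} {k : ℕ}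
    (hx : x ^ (p ^ k) = 1) (hn : x ∈ Subgroup.normalizer (S : Set G)) (hK : x ∈ K) : x ∈ S := by
  have h1 := h.max (T := S ⊔ Subgroup.zpowers x) (sup_le h.1 (by rwa [Subgroup.zpowers_le]))
    (pg_sup h.pg hx hn) le_sup_left
  rw [← h1]
  exact (le_sup_right : Subgroup.zpowers x ≤ _) (Subgroup.mem_zpowers x)

/-- descend to an element of order `p` modulo `S` -/
theorem pelt_min {S : Subgroup G} {x : G} {k : ℕ} (hx : x ^ (p ^ k) ∈ S) (hxS : x ∉ S) :
    ∃ j, x ^ (p ^ j) ∉ S ∧ (x ^ (p ^ j)) ^ p ∈ S := by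
  induction k with
  | zero => exact absurd (by simpa using hx) hxS
  | succ k ih =>
    by_cases h : x ^ (p ^ k) ∈ S
    · exact ih h
    · exact ⟨k, h, by rwa [← pow_mul, ← pow_succ]⟩

theorem grow {R S : Subgroup G} (hS : IsPGroup p S) (hRS : R < S) :
    ∃ x ∈ S, x ∉ R ∧ x ∈ Subgroup.normalizer (R : Set G) ∧ x ^ p ∈ R := by
  have : Group.IsNilpotent S := hS.isNilpotent
  have nc : NormalizerCondition S := Group.normalizerCondition_of_isNilpotent
  have h1 : R.subgroupOf S < ⊤ := by
    rw [lt_top_iff_ne_top]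
    intro hc
    rw [Subgroup.subgroupOf_eq_top] at hc
    exact not_le_of_gt hRS hc
  obtain ⟨y, y1, y2⟩ := SetLike.exists_of_lt (nc _ h1)
  have hyn : (y : G) ∈ Subgroup.normalizer (R : Set G) := by
    rw [Subgroup.mem_normalizer_iff]
    intro h
    constructor
    · intro hh
      exact (Subgroup.mem_normalizer_iff.1 y1 ⟨h, hRS.le hh⟩).1 hh
    · intro hh
      have hs : h ∈ S := by
        have h3 := S.mul_mem (S.mul_mem (S.inv_mem y.2) (hRS.le hh)) y.2
        have e : (y : G)⁻¹ * (y * h * (y : G)⁻¹) * y = h := by group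
        rwa [e] at h3
      exact (Subgroup.mem_normalizer_iff.1 y1 ⟨h, hs⟩).2 hh
  obtain ⟨k, hk⟩ := hS y
  have hk' : (y : G) ^ (p ^ k) ∈ R := by
    have := congrArg (fun z : S => (z : G)) hk
    simp only [SubmonoidClass.coe_pow, OneMemClass.coe_one] at this
    rw [this]; exact R.one_mem
  obtain ⟨j, j1, j2⟩ := pelt_min hk' y2
  exact ⟨_, S.pow_mem y.2 _, j1, Subgroup.pow_mem _ hyn _, j2⟩

theorem IsSyl.move {X : Type*} [MulAction G X] {x y : X} {S : Subgroup G}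
    (hS : IsSyl p (MulAction.stabilizer G x) S) (hy : ∀ g ∈ S, g • y = y)
    (ht : ∃ g : G, g • x = y) : IsSyl p (MulAction.stabilizer G y) S := by
  obtain ⟨g, hg⟩ := ht
  have hcard : Nat.card (MulAction.stabilizer G y) = Nat.card (MulAction.stabilizer G x) := by
    rw [← hg]
    exact Nat.card_congr (MulAction.stabilizerEquivStabilizer rfl).symm.toEquiv
  exact ⟨fun z hz => hy z hz, by rw [hcard]; exact hS.2⟩

end grp

section pl
variable {G P L : Type*} [Group G] [MulAction G P] [MulAction G L] {n : ℕ} {I : P → L → Prop}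
variable [Finite P] [Finite L] [Finite G]

theorem stab_prod {X Y : Type*} [MulAction G X] [MulAction G Y] {x : X} {y : Y} {g : G} :
    g ∈ MulAction.stabilizer G (x, y) ↔ g • x = x ∧ g • y = y := by
  rw [MulAction.mem_stabilizer_iff, Prod.smul_mk, Prod.mk.injEq]

theorem witt_aft {p : ℕ} [Fact p.Prime] (ht : AFT G I) {Q : P} {m : L} (hQ : ¬ I Q m)
    {S : Subgroup G} (hS : IsSyl p (MulAction.stabilizer G (Q, m)) S) :
    AFT (Subgroup.normalizer (S : Set G)) (FI I S) := by
  have key : ∀ (q : Fx S P) (l : Fx S L), ¬ FI I S q l →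
      ∃ k ∈ Subgroup.normalizer (S : Set G), k • (Q, m) = (q.1, l.1) := by
    intro q l hql
    refine witt hS (fun g hg => by rw [Prod.smul_mk, q.2 g hg, l.2 g hg]) ?_
    obtain ⟨g, g1, g2⟩ := ht Q m q.1 l.1 hQ hql
    exact ⟨g, by rw [Prod.smul_mk, g1, g2]⟩
  intro q l q' l' h1 h2
  obtain ⟨k, k1, k2⟩ := key q l h1
  obtain ⟨k', k1', k2'⟩ := key q' l' h2
  rw [Prod.smul_mk, Prod.mk.injEq] at k2 k2'
  refine ⟨⟨k', k1'⟩ * ⟨k, k1⟩⁻¹, Subtype.ext ?_, Subtype.ext ?_⟩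
  · rw [fx_smul]
    simp only [Subgroup.coe_mul, InvMemClass.coe_inv, mul_smul]
    rw [← k2.1, inv_smul_smul, k2'.1]
  · rw [fx_smul]
    simp only [Subgroup.coe_mul, InvMemClass.coe_inv, mul_smul]
    rw [← k2.2, inv_smul_smul, k2'.2]

theorem witt_tt {p : ℕ} [Fact p.Prime] (ht : TT G P) {A B : P} (hQ : A ≠ B)
    {S : Subgroup G} (hS : IsSyl p (MulAction.stabilizer G (A, B)) S) :
    TT (Subgroup.normalizer (S : Set G)) (Fx S P) := by
  have key : ∀ (q : Fx S P) (l : Fx S P), q ≠ l →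
      ∃ k ∈ Subgroup.normalizer (S : Set G), k • (A, B) = (q.1, l.1) := by
    intro q l hql
    refine witt hS (fun g hg => by rw [Prod.smul_mk, q.2 g hg, l.2 g hg]) ?_
    obtain ⟨g, g1, g2⟩ := ht A B q.1 l.1 hQ (fun hc => hql (Subtype.ext hc))
    exact ⟨g, by rw [Prod.smul_mk, g1, g2]⟩
  intro q l q' l' h1 h2
  obtain ⟨k, k1, k2⟩ := key q l h1
  obtain ⟨k', k1', k2'⟩ := key q' l' h2
  rw [Prod.smul_mk, Prod.mk.injEq] at k2 k2'
  refine ⟨⟨k', k1'⟩ * ⟨k, k1⟩⁻¹, Subtype.ext ?_, Subtype.ext ?_⟩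
  · rw [fx_smul]
    simp only [Subgroup.coe_mul, InvMemClass.coe_inv, mul_smul]
    rw [← k2.1, inv_smul_smul, k2'.1]
  · rw [fx_smul]
    simp only [Subgroup.coe_mul, InvMemClass.coe_inv, mul_smul]
    rw [← k2.2, inv_smul_smul, k2'.2]

/-- a perspectivity fixes an antiflag -/
theorem Plane.persp_af (hP : Plane I n) (h : Pres G I) {g : G} {l : L} (ha : Axis I g l) :
    ∃ Q m, ¬ I Q m ∧ g • Q = Q ∧ g • m = m := by
  obtain ⟨c, hc⟩ := hP.exists_center h ha
  by_cases hcl : I c l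
  · obtain ⟨Q, q1, q2, -⟩ := hP.pt_on l c c
    obtain ⟨m, m1, m2, -⟩ := hP.ln_on c l l
    exact ⟨Q, m, fun hh => m2 (hP.eqL q2 hh m1 q1 hcl), ha Q q1, hc m m1⟩
  · exact ⟨c, l, hcl, hP.center_fix h hc, hP.axis_fix h ha⟩

theorem Plane.inv_af (hP : Plane I n) (h : Pres G I) {g : G} (hg : ∀ p : P, g • g • p = p)
    (hnt : ∃ p : P, g • p ≠ p) : ∃ Q m, ¬ I Q m ∧ g • Q = Q ∧ g • m = m := by
  by_cases hax : ∀ l, ¬ Axis I g l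
  · obtain ⟨p1, p2, p3, l1, l2, l3, hC, e1, e2, e3, e4, e5, e6⟩ := hP.inv_dich h hg hnt hax
    exact ⟨p1, l2, hC.1, e1, e5⟩
  · push Not at hax
    obtain ⟨l, hl⟩ := hax
    exact hP.persp_af h hl

theorem Plane.inv_two (hP : Plane I n) (h : Pres G I) {g : G} (hg : ∀ p : P, g • g • p = p)
    (hnt : ∃ p : P, g • p ≠ p) : ∃ A B : P, A ≠ B ∧ g • A = A ∧ g • B = B := by
  by_cases hax : ∀ l, ¬ Axis I g l
  · obtain ⟨p1, p2, p3, l1, l2, l3, hC, e1, e2, e3, e4, e5, e6⟩ := hP.inv_dich h hg hnt hax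
    refine ⟨p1, p2, ?_, e1, e2⟩
    rintro rfl
    exact hC.1 hC.2.2.2.1
  · push Not at hax
    obtain ⟨l, hl⟩ := hax
    obtain ⟨A, a1⟩ := hP.line_pt l
    obtain ⟨B, b1, b2, -⟩ := hP.pt_on l A A
    exact ⟨B, A, b2, hl B b1, hl A a1⟩

/-- odd powers of a swap -/
theorem swap_pow {X : Type*} [MulAction G X] {g : G} {a b : X} (h1 : g • a = b) (h2 : g • b = a)
    {m : ℕ} (hm : Odd m) : g ^ m • a = b ∧ g ^ m • b = a := by
  obtain ⟨k, rfl⟩ := hm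
  have key : ∀ k : ℕ, g ^ (2 * k) • a = a ∧ g ^ (2 * k) • b = b := by
    intro k
    induction k with
    | zero => simp
    | succ k ih =>
      have : g ^ (2 * (k + 1)) = g ^ (2 * k) * g * g := by
        rw [mul_add, mul_one, pow_add, sq, mul_assoc]
      rw [this]
      simp only [mul_smul, h1, h2]
      exact ih
  constructor
  · rw [pow_succ, mul_smul, h1, (key k).2]
  · rw [pow_succ, mul_smul, h2, (key k).1]

theorem TT.swap {X : Type*} [MulAction G X] [Finite X] (ht : TT G X) {a b : X} (hab : a ≠ b) :
    ∃ (g : G) (k : ℕ), g ^ (2 ^ k) = 1 ∧ g • a = b ∧ g • b = a := by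
  have : Fact (Nat.Prime 2) := ⟨Nat.prime_two⟩
  obtain ⟨g, g1, g2⟩ := ht a b b a hab hab.symm
  obtain ⟨m, k, h1, h2⟩ := pelt 2 g
  have hm : Odd m := Nat.coprime_two_right.1 h1
  exact ⟨g ^ m, k, h2, swap_pow g1 g2 hm⟩

theorem fx_triv {X : Type*} [MulAction G X] {S : Subgroup G}
    {t : Subgroup.normalizer (S : Set G)} (ht : (t : G) ∈ S) (x : Fx S X) : t • x = x :=
  Subtype.ext (x.2 _ ht)

theorem Plane.n1 (hP : Plane I n) (h : Pres G I) (ht : AFT G I) {Q : P} {m : L} (hQ : ¬ I Q m)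
    {S : Subgroup G} (hS : IsSyl 2 (MulAction.stabilizer G (Q, m)) S) : ¬ Planar I S := by
  have : Fact (Nat.Prime 2) := ⟨Nat.prime_two⟩
  intro hpl
  obtain ⟨r, hr⟩ := hpl.plane hP.toPP h
  have haft := witt_aft ht hQ hS
  have htt := hr.two_trans (h.fi S) haft
  obtain ⟨l⟩ : Nonempty (Fx S L) := by
    obtain ⟨p1, p2, p3, l1, -⟩ := hr.nd
    exact ⟨l1⟩
  obtain ⟨A, hA⟩ := hr.line_pt l
  obtain ⟨B, hB, hAB, -⟩ := hr.pt_on l A A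
  obtain ⟨t, k, t1, t2, t3⟩ := htt.swap hAB.symm
  have htS : (t : G) ∉ S := by
    intro hc
    rw [fx_triv hc] at t2
    exact hAB t2.symm
  have tk : (t : G) ^ (2 ^ k) = 1 := by
    have := congrArg Subtype.val t1
    simpa using this
  obtain ⟨j, j1, j2⟩ := pelt_min (p := 2) (S := S) (by rw [tk]; exact S.one_mem) htS
  set s := t ^ (2 ^ j) with hs
  have hsG : (s : G) = (t : G) ^ (2 ^ j) := by rw [hs]; simp
  rw [← hsG] at j1 j2
  have hs2 : ∀ x : Fx S P, s • s • x = x := by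
    intro x
    rw [← mul_smul, ← sq]
    exact fx_triv (by simpa using j2) x
  have hfix : ∀ (q : Fx S P) (l : Fx S L), ¬ FI I S q l → s • q = q → s • l = l → False := by
    intro q l hql e1 e2
    have hmv := hS.move (y := (q.1, l.1))
      (fun g hg => by rw [Prod.smul_mk, q.2 g hg, l.2 g hg]) (by
        obtain ⟨g, g1, g2⟩ := ht Q m q.1 l.1 hQ hql
        exact ⟨g, by rw [Prod.smul_mk, g1, g2]⟩)
    refine j1 (hmv.mem_of_norm (x := (s : G)) (k := k) ?_ s.2 ?_)
    · rw [hsG, ← pow_mul, mul_comm, pow_mul, tk, one_pow]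
    · rw [stab_prod]
      exact ⟨congrArg Subtype.val e1, congrArg Subtype.val e2⟩
  by_cases hnt : ∃ x : Fx S P, s • x ≠ x
  · obtain ⟨q, l, h1, h2, h3⟩ := hr.inv_af (h.fi S) hs2 hnt
    exact hfix q l h1 h2 h3
  · push Not at hnt
    obtain ⟨q, hq, -⟩ := hr.pt_off l l
    exact hfix q l hq (hnt q) (hr.trivL (h.fi S) hnt l)

theorem Plane.n2 (hP : Plane I n) (h : Pres G I) (ht : TT G P) {A B : P} (hQ : A ≠ B)
    {S : Subgroup G} (hS : IsSyl 2 (MulAction.stabilizer G (A, B)) S) : ¬ Planar I S := by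
  have : Fact (Nat.Prime 2) := ⟨Nat.prime_two⟩
  intro hpl
  obtain ⟨r, hr⟩ := hpl.plane hP.toPP h
  have htt := witt_tt ht hQ hS
  let A' : Fx S P := ⟨A, fun g hg => (stab_prod.1 (hS.1 hg)).1⟩
  let B' : Fx S P := ⟨B, fun g hg => (stab_prod.1 (hS.1 hg)).2⟩
  have hAB : A' ≠ B' := fun hc => hQ (congrArg Subtype.val hc)
  obtain ⟨s, k, t1, t2, t3⟩ := htt.swap hAB
  have tk : (s : G) ^ (2 ^ k) = 1 := by
    have := congrArg Subtype.val t1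
    simpa using this
  have hsS : (s : G) ∉ S := by
    intro hc
    rw [fx_triv hc] at t2
    exact hAB t2
  have s2S : (s : G) ^ 2 ∈ S := by
    refine hS.mem_of_norm (k := k) ?_ (Subgroup.pow_mem _ s.2 2) ?_
    · rw [← pow_mul, mul_comm, pow_mul, tk, one_pow]
    · have e1 : (s : G) • A = B := congrArg Subtype.val t2
      have e2 : (s : G) • B = A := congrArg Subtype.val t3
      rw [stab_prod, sq, mul_smul, mul_smul, e1, e2, e1]
      exact ⟨rfl, rfl⟩
  have hs2 : ∀ x : Fx S P, s • s • x = x := by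
    intro x
    rw [← mul_smul, ← sq]
    exact fx_triv (by simpa using s2S) x
  obtain ⟨C, D, c1, c2, c3⟩ := hr.inv_two (h.fi S) hs2 ⟨A', by rw [t2]; exact hAB.symm⟩
  have hmv := hS.move (y := (C.1, D.1))
    (fun g hg => by rw [Prod.smul_mk, C.2 g hg, D.2 g hg]) (by
      obtain ⟨g, g1, g2⟩ := ht A B C.1 D.1 hQ (fun hc => c1 (Subtype.ext hc))
      exact ⟨g, by rw [Prod.smul_mk, g1, g2]⟩)
  refine hsS (hmv.mem_of_norm (x := (s : G)) tk s.2 ?_)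
  rw [stab_prod]
  exact ⟨congrArg Subtype.val c2, congrArg Subtype.val c3⟩

end pl
end AF
namespace AF

section img
variable (G P L : Type*) [Group G] [MulAction G P] [MulAction G L]

/-- the faithful image of `G` -/
def Img : Subgroup (Equiv.Perm P × Equiv.Perm L) :=
  ((MulAction.toPermHom G P).prod (MulAction.toPermHom G L)).range

instance imgP : MulAction (Img G P L) P where
  smul g p := g.1.1 p
  one_smul p := rfl
  mul_smul a b p := rfl

instance imgL : MulAction (Img G P L) L where
  smul g p := g.1.2 p
  one_smul p := rfl
  mul_smul a b p := rfl

variable {P L}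
/-- the projection -/
def toImg (g : G) : Img G P L := ⟨(MulAction.toPermHom G P g, MulAction.toPermHom G L g), g, rfl⟩

variable {G}
theorem toImgP (g : G) (p : P) : (toImg G g : Img G P L) • p = g • p := rfl
theorem toImgL (g : G) (p : L) : (toImg G g : Img G P L) • p = g • p := rfl
theorem toImg_surj (h : Img G P L) : ∃ g : G, toImg G g = h := by
  obtain ⟨_, g, rfl⟩ := h
  exact ⟨g, rfl⟩
theorem toImg_one : (toImg G 1 : Img G P L) = 1 :=
  Subtype.ext (Prod.ext (map_one _) (map_one _))
theorem toImg_mul (a b : G) : (toImg G (a * b) : Img G P L) = toImg G a * toImg G b :=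
  Subtype.ext (Prod.ext (map_mul _ _ _) (map_mul _ _ _))
theorem toImg_pow (a : G) (k : ℕ) : (toImg G (a ^ k) : Img G P L) = toImg G a ^ k := by
  induction k with
  | zero => simp [toImg_one]
  | succ k ih => rw [pow_succ, toImg_mul, ih, pow_succ]

variable {I : P → L → Prop} {n : ℕ} [Finite P] [Finite L]

theorem Pres.img (h : Pres G I) : Pres (Img G P L) I := by
  intro k p l hpl
  obtain ⟨g, rfl⟩ := toImg_surj k
  exact h g p l hpl

theorem AFT.img (h : AFT G I) : AFT (Img G P L) I := by
  intro p l p' l' h1 h2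
  obtain ⟨g, g1, g2⟩ := h p l p' l' h1 h2
  exact ⟨toImg G g, g1, g2⟩

theorem Plane.img_fth (hP : Plane I n) (h : Pres G I) : Fth (Img G P L) P := by
  intro k hk
  have hl := hP.trivL h.img hk
  apply Subtype.ext
  refine Prod.ext (Equiv.ext hk) (Equiv.ext hl)

theorem elat_img {g : G} : Elat I (toImg G g : Img G P L) ↔ Elat I g := Iff.rfl

instance : Finite (Img G P L) := inferInstance

end img

section pw
variable {G P L : Type*} [Group G] [MulAction G P] [MulAction G L] {n : ℕ} {I : P → L → Prop}
variable [Finite P] [Finite L] [Finite G]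

theorem ord_eq {a b : ℕ} (h : a ^ 2 + a + 1 = b ^ 2 + b + 1) : a = b := by
  rcases lt_trichotomy a b with h1 | h1 | h1
  · nlinarith
  · exact h1
  · nlinarith

theorem pow_order (hP : Plane I n) (h : Pres G I) (N : ℕ) : ∀ (R : Subgroup G) (r : ℕ),
    Nat.card R ≤ N → IsPGroup 2 R → Planar I R → Plane (FI I R) r → ∃ a, n = r ^ a := by
  have : Fact (Nat.Prime 2) := ⟨Nat.prime_two⟩
  induction N with
  | zero =>
    intro R r hc
    have : 0 < Nat.card R := Nat.card_pos
    omega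
  | succ N ih =>
    intro R r hc hp hpl hr
    by_cases hb : R = ⊥
    · refine ⟨1, ?_⟩
      rw [pow_one]
      refine ord_eq ?_
      rw [← hP.cardP, ← fx_card hr, ← Set.ncard_univ]
      congr 1
      ext p
      subst hb
      simp
    · obtain ⟨R', h1, h2, h3, h4⟩ := pg_index hp hb
      have hpl' := hpl.mono h1.le
      obtain ⟨r', hr'⟩ := hpl'.plane hP.toPP h
      have hcard : Nat.card R' < Nat.card R := by
        have hle := Subgroup.card_le_of_le h1.le
        refine lt_of_le_of_ne hle fun hc => ?_
        exact h1.ne (Subgroup.eq_of_le_of_card_ge h1.le hc.ge)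
      obtain ⟨a, ha⟩ := ih R' r' (by omega) (hp.to_le h1.le) hpl' hr'
      obtain ⟨x, hx, hx'⟩ := SetLike.exists_of_lt h1
      have hRfix : ∀ {X : Type _} [MulAction G X] (y : X), (∀ g ∈ R', g • y = y) → x • y = y →
          ∀ g ∈ R, g • y = y := by
        intro X _ y hy hxy g hg
        exact h4 x hx hx' (MulAction.stabilizer G y) (fun g hg => hy g hg) hxy hg
      let x' : Subgroup.normalizer (R' : Set G) := ⟨x, h2 hx⟩
      have hx2 : ∀ p : Fx R' P, x' • x' • p = p := by
        intro p
        rw [← mul_smul, ← sq]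
        exact fx_triv (by simpa using h3 x hx) p
      by_cases hnt : ∃ p : Fx R' P, x' • p ≠ p
      · have hpz : Planar (FI I R') (Subgroup.zpowers x') := by
          rw [planar_zp]
          obtain ⟨p1, p2, p3, l1, l2, l3, hC, hf⟩ := hpl
          have hf' := fun g hg => hf g (h1.le hg)
          refine ⟨⟨p1, fun g hg => (hf' g hg).1⟩, ⟨p2, fun g hg => (hf' g hg).2.1⟩,
            ⟨p3, fun g hg => (hf' g hg).2.2.1⟩, ⟨l1, fun g hg => (hf' g hg).2.2.2.1⟩,
            ⟨l2, fun g hg => (hf' g hg).2.2.2.2.1⟩, ⟨l3, fun g hg => (hf' g hg).2.2.2.2.2⟩,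
            hC, ?_⟩
          obtain ⟨a1, a2, a3, a4, a5, a6⟩ := hf x hx
          exact ⟨Subtype.ext a1, Subtype.ext a2, Subtype.ext a3, Subtype.ext a4, Subtype.ext a5,
            Subtype.ext a6⟩
        obtain ⟨s, hs⟩ := hpz.plane hr'.toPP (h.fi R')
        have hb := hr'.baer (h.fi R') hx2 hnt hs
        have hsr : s = r := by
          refine ord_eq ?_
          rw [← fx_card hs, ← hr.cardP, ← Nat.card_coe_set_eq]
          refine Nat.card_congr ⟨fun y => ⟨y.1.1, ?_⟩, fun y => ⟨⟨y.1, ?_⟩, ?_⟩, ?_, ?_⟩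
          · exact hRfix _ y.1.2 (congrArg Subtype.val (show x' • (y.1 : Fx R' P) = y.1 from zp_fix.1 y.2))
          · exact fun g hg => y.2 g (h1.le hg)
          · let w : Fx R' P := ⟨y.1, fun g hg => y.2 g (h1.le hg)⟩
            have : x' • w = w := Subtype.ext (y.2 x hx)
            exact zp_fix.2 this
          · intro y; rfl
          · intro y; rfl
        subst hsr
        refine ⟨2 * a, ?_⟩
        rw [pow_mul, ← hb, ha]
      · push Not at hnt
        have : r' = r := by
          refine ord_eq ?_
          rw [← hr.cardP, ← hr'.cardP]
          refine Nat.card_congr ⟨fun y => ⟨y.1, ?_⟩, fun y => ⟨y.1, ?_⟩, ?_, ?_⟩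
          · exact hRfix _ y.2 (congrArg Subtype.val (hnt y))
          · exact fun g hg => y.2 g (h1.le hg)
          · intro y; rfl
          · intro y; rfl
        subst this
        exact ⟨a, ha⟩

end pw
end AF
namespace AF

section fb
variable {G P L : Type*} [Group G] [MulAction G P] [MulAction G L] {n : ℕ} {I : P → L → Prop}
variable [Finite P] [Finite L] [Finite G]

theorem sup_fix {X : Type*} [MulAction G X] {R : Subgroup G} {x : G} {y : X}
    (h1 : ∀ g ∈ R, g • y = y) (h2 : x • y = y) : ∀ g ∈ R ⊔ Subgroup.zpowers x, g • y = y := by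
  intro g hg
  have : R ⊔ Subgroup.zpowers x ≤ MulAction.stabilizer G y := by
    refine sup_le (fun g hg => h1 g hg) ?_
    rw [Subgroup.zpowers_le]
    exact h2
  exact this hg

theorem planar_sup {R : Subgroup G} {x : G} {p1 p2 p3 : Fx R P} {l1 l2 l3 : Fx R L}
    (hC : Cfg (FI I R) p1 p2 p3 l1 l2 l3) (e1 : x • p1.1 = p1.1) (e2 : x • p2.1 = p2.1)
    (e3 : x • p3.1 = p3.1) (e4 : x • l1.1 = l1.1) (e5 : x • l2.1 = l2.1) (e6 : x • l3.1 = l3.1) :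
    Planar I (R ⊔ Subgroup.zpowers x) :=
  ⟨p1.1, p2.1, p3.1, l1.1, l2.1, l3.1, hC, fun g hg => ⟨sup_fix p1.2 e1 g hg,
    sup_fix p2.2 e2 g hg, sup_fix p3.2 e3 g hg, sup_fix l1.2 e4 g hg, sup_fix l2.2 e5 g hg,
    sup_fix l3.2 e6 g hg⟩⟩

/-- `R` is a planar 2-subgroup of maximal order -/
structure MaxPl (G : Type*) {P L : Type*} [Group G] [MulAction G P] [MulAction G L]
    (I : P → L → Prop) (R : Subgroup G) : Prop where
  pg : IsPGroup 2 R
  pl : Planar I R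
  mx : ∀ T : Subgroup G, IsPGroup 2 T → Planar I T → Nat.card T ≤ Nat.card R

theorem MaxPl.no {R : Subgroup G} (hR : MaxPl G I R) {x : G} {k : ℕ} (hx : x ^ (2 ^ k) = 1)
    (hn : x ∈ Subgroup.normalizer (R : Set G)) (hpl : Planar I (R ⊔ Subgroup.zpowers x)) :
    x ∈ R := by
  have : Fact (Nat.Prime 2) := ⟨Nat.prime_two⟩
  have h1 := hR.mx _ (pg_sup hR.pg hx hn) hpl
  have h2 := Subgroup.eq_of_le_of_card_ge (le_sup_left : R ≤ R ⊔ Subgroup.zpowers x) h1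
  rw [h2]
  exact (le_sup_right : Subgroup.zpowers x ≤ _) (Subgroup.mem_zpowers x)

/-- group acting on the fixed subplane -/
abbrev HH (P L : Type*) [MulAction G P] [MulAction G L] (R : Subgroup G) :=
  Img (Subgroup.normalizer (R : Set G)) (Fx R P) (Fx R L)

theorem MaxPl.one {R : Subgroup G} (hP : Plane I n) (h : Pres G I) (hR : MaxPl G I R)
    {x : Subgroup.normalizer (R : Set G)} (hx : (x : G) ∈ R) : (toImg _ x : HH P L R) = 1 := by
  obtain ⟨r, hr⟩ := hR.pl.plane hP.toPP h
  refine hr.img_fth (h.fi R) _ fun p => ?_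
  rw [toImgP]
  exact fx_triv hx p

theorem MaxPl.nb {R : Subgroup G} (hP : Plane I n) (h : Pres G I) (hR : MaxPl G I R)
    (k : HH P L R) (h1 : k ≠ 1) (h2 : k * k = 1) : ∃ l, Axis (FI I R) k l := by
  have : Fact (Nat.Prime 2) := ⟨Nat.prime_two⟩
  obtain ⟨r, hr⟩ := hR.pl.plane hP.toPP h
  obtain ⟨g, hg⟩ := toImg_surj k
  obtain ⟨m, j, m1, m2⟩ := pelt 2 g
  have hm : Odd m := Nat.coprime_two_right.1 m1
  have hk : toImg _ (g ^ m) = k := by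
    obtain ⟨i, rfl⟩ := hm
    rw [toImg_pow, hg, pow_succ, pow_mul, sq, h2, one_pow, one_mul]
  by_contra hc
  push Not at hc
  obtain ⟨p1, p2, p3, l1, l2, l3, hC, e1, e2, e3, e4, e5, e6⟩ := hr.inv_dich (h.fi R).img
    (g := k) (fun p => by rw [← mul_smul, h2, one_smul]) (fth_nt (hr.img_fth (h.fi R)) h1) hc
  rw [← hk] at e1 e2 e3 e4 e5 e6
  have := hR.no (x := ((g ^ m : Subgroup.normalizer (R : Set G)) : G)) (k := j)
    (by have := congrArg Subtype.val m2; simpa using this) (g ^ m).2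
    (planar_sup hC (congrArg Subtype.val e1) (congrArg Subtype.val e2) (congrArg Subtype.val e3)
      (congrArg Subtype.val e4) (congrArg Subtype.val e5) (congrArg Subtype.val e6))
  have := hR.one hP h this
  rw [hk] at this
  exact h1 this

theorem MaxPl.key {R T : Subgroup G} (hP : Plane I n) (h : Pres G I) (hR : MaxPl G I R)
    (hT : IsPGroup 2 T) (hRT : R ≤ T) (hTp : ¬ Planar I T) :
    ∃ (k : HH P L R) (C : Fx R P) (l : Fx R L), Inv (FI I R) k C l ∧
      (∀ x : Fx R P, (∀ t ∈ T, t • x.1 = x.1) → I x.1 l.1 ∨ x = C) ∧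
      (∀ x : Fx R L, (∀ t ∈ T, t • x.1 = x.1) → I C.1 x.1 ∨ x = l) := by
  have : Fact (Nat.Prime 2) := ⟨Nat.prime_two⟩
  obtain ⟨r, hr⟩ := hR.pl.plane hP.toPP h
  have hlt : R < T := lt_of_le_of_ne hRT (by rintro rfl; exact hTp hR.pl)
  obtain ⟨x, x1, x2, x3, x4⟩ := grow hT hlt
  let y : Subgroup.normalizer (R : Set G) := ⟨x, x3⟩
  have k1 : (toImg _ y : HH P L R) ≠ 1 := by
    intro hc
    apply x2
    obtain ⟨j, hj⟩ := hT ⟨x, x1⟩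
    refine hR.no (k := j) (by simpa using congrArg Subtype.val hj) x3 ?_
    obtain ⟨p1, p2, p3, l1, l2, l3, hC⟩ := hr.nd
    have hfP : ∀ p : Fx R P, x • p.1 = p.1 := by
      intro p
      have : (toImg _ y : HH P L R) • p = p := by rw [hc, one_smul]
      exact congrArg Subtype.val this
    have hfL : ∀ p : Fx R L, x • p.1 = p.1 := by
      intro p
      have : (toImg _ y : HH P L R) • p = p := by rw [hc, one_smul]
      exact congrArg Subtype.val this
    exact planar_sup hC (hfP _) (hfP _) (hfP _) (hfL _) (hfL _) (hfL _)
  have k2 : (toImg _ y : HH P L R) * toImg _ y = 1 := by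
    rw [← toImg_mul, ← sq]
    exact hR.one hP h (by simpa using x4)
  obtain ⟨l, hl⟩ := hR.nb hP h _ k1 k2
  obtain ⟨C, hC⟩ := hr.exists_center (h.fi R).img hl
  refine ⟨toImg _ y, C, l, ⟨k1, k2, hl, hC⟩, ?_, ?_⟩
  · intro z hz
    exact hr.persp_fixed (h.fi R).img hl hC (fth_nt (hr.img_fth (h.fi R)) k1)
      (show (toImg _ y : HH P L R) • z = z from Subtype.ext (hz x x1))
  · intro z hz
    exact hr.dual.persp_fixed (h.fi R).img.dual hC.axis hl.center
      (fth_nt (hr.fth_dual (h.fi R).img (hr.img_fth (h.fi R))) k1)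
      (show (toImg _ y : HH P L R) • z = z from Subtype.ext (hz x x1))

theorem MaxPl.hyp {R : Subgroup G} {r : ℕ} (hP : Plane I n) (h : Pres G I) (hR : MaxPl G I R)
    (ht : AFT G I) (hr : Plane (FI I R) r) (hro : Odd r) : Hyp (HH P L R) (FI I R) r where
  pl := hr
  pr := (h.fi R).img
  ft := hr.img_fth (h.fi R)
  od := hro
  nb := hR.nb hP h
  af := by
    have : Fact (Nat.Prime 2) := ⟨Nat.prime_two⟩
    intro Q m hQ
    obtain ⟨S, hS, hRS⟩ := exists_syl (p := 2) (K := MulAction.stabilizer G (Q.1, m.1))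
      (fun g hg => stab_prod.2 ⟨Q.2 g hg, m.2 g hg⟩) hR.pg
    obtain ⟨k, C, l, hi, h1, h2⟩ := hR.key hP h hS.pg hRS (hP.n1 h ht hQ hS)
    rcases h1 Q (fun t ht => (stab_prod.1 (hS.1 ht)).1) with h3 | h3 <;>
    rcases h2 m (fun t ht => (stab_prod.1 (hS.1 ht)).2) with h4 | h4
    · exact Or.inr ⟨C, l, h4, h3, k, hi⟩
    · subst h4; exact absurd h3 hQ
    · subst h3; exact absurd h4 hQ
    · subst h3; subst h4; exact Or.inl ⟨k, hi⟩
  pp := by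
    have : Fact (Nat.Prime 2) := ⟨Nat.prime_two⟩
    intro A B hAB
    have hAB' : A.1 ≠ B.1 := fun hc => hAB (Subtype.ext hc)
    obtain ⟨S, hS, hRS⟩ := exists_syl (p := 2) (K := MulAction.stabilizer G (A.1, B.1))
      (fun g hg => stab_prod.2 ⟨A.2 g hg, B.2 g hg⟩) hR.pg
    obtain ⟨k, C, l, hi, h1, -⟩ := hR.key hP h hS.pg hRS (hP.n2 h (hP.two_trans h ht) hAB' hS)
    rcases h1 A (fun t ht => (stab_prod.1 (hS.1 ht)).1) with h2 | h2 <;>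
    rcases h1 B (fun t ht => (stab_prod.1 (hS.1 ht)).2) with h3 | h3
    · exact Or.inl ⟨l, C, h2, h3, k, hi⟩
    · subst h3; exact Or.inr (Or.inr ⟨l, h2, k, hi⟩)
    · subst h2; exact Or.inr (Or.inl ⟨l, h3, k, hi⟩)
    · subst h3; exact absurd h2 hAB
  ll := by
    have : Fact (Nat.Prime 2) := ⟨Nat.prime_two⟩
    intro A B hAB
    have hAB' : A.1 ≠ B.1 := fun hc => hAB (Subtype.ext hc)
    obtain ⟨S, hS, hRS⟩ := exists_syl (p := 2) (K := MulAction.stabilizer G (A.1, B.1))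
      (fun g hg => stab_prod.2 ⟨A.2 g hg, B.2 g hg⟩) hR.pg
    obtain ⟨k, C, l, hi, -, h1⟩ := hR.key hP h hS.pg hRS (fun hc =>
      hP.dual.n2 h.dual (hP.dual.two_trans h.dual ht.dual) hAB' hS hc.dual)
    rcases h1 A (fun t ht => (stab_prod.1 (hS.1 ht)).1) with h2 | h2 <;>
    rcases h1 B (fun t ht => (stab_prod.1 (hS.1 ht)).2) with h3 | h3
    · exact Or.inl ⟨C, l, h2, h3, k, hi⟩
    · subst h3; exact Or.inr (Or.inr ⟨C, h2, k, hi⟩)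
    · subst h2; exact Or.inr (Or.inl ⟨C, h3, k, hi⟩)
    · subst h3; exact absurd h2 hAB

theorem Plane.fourb (hP : Plane I n) (h : Pres G I) (ht : AFT G I) (hF : Fth G P) (hn : Odd n)
    (hax : ∀ g : G, g ≠ 1 → g * g = 1 → ∀ l, ¬ Axis I g l) :
    ∃ p a : ℕ, p.Prime ∧ n = p ^ a ∧ ∃ (Q : P) (m : L), ¬ I Q m ∧
      p ∣ Nat.card (MulAction.stabilizer G (Q, m)) := by
  have : Fact (Nat.Prime 2) := ⟨Nat.prime_two⟩
  obtain ⟨l⟩ : Nonempty L := by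
    obtain ⟨p1, p2, p3, l1, -⟩ := hP.nd
    exact ⟨l1⟩
  obtain ⟨A, hA⟩ := hP.line_pt l
  obtain ⟨B, hB, hAB, -⟩ := hP.pt_on l A A
  obtain ⟨t, k, t1, t2, t3⟩ := (hP.two_trans h ht).swap hAB
  obtain ⟨j, j1, j2⟩ := pelt_min (p := 2) (S := (⊥ : Subgroup G)) (x := t) (k := k)
    (by rw [t1]; exact Subgroup.one_mem _) (by
      intro hc
      rw [Subgroup.mem_bot] at hc
      rw [hc, one_smul] at t2
      exact hAB t2)
  rw [Subgroup.mem_bot] at j1 j2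
  set s := t ^ 2 ^ j
  have hz : Planar I (Subgroup.zpowers s) := by
    rw [planar_zp]
    exact hP.inv_dich h (fun p => by rw [← mul_smul, ← sq, j2, one_smul]) (fth_nt hF j1)
      (hax s j1 (by rw [← sq, j2]))
  obtain ⟨R, ⟨hR1, hR2⟩, hR3⟩ := Set.exists_max_image
    {R : Subgroup G | IsPGroup 2 R ∧ Planar I R} (fun R => Nat.card R) (Set.toFinite _)
    ⟨_, zp_pg (k := 1) (by simpa using j2), hz⟩
  have hR : MaxPl G I R := ⟨hR1, hR2, fun T h1 h2 => hR3 T ⟨h1, h2⟩⟩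
  obtain ⟨r, hr⟩ := hR.pl.plane hP.toPP h
  obtain ⟨a, ha⟩ := pow_order hP h _ R r le_rfl hR1 hR2 hr
  have hro : Odd r := by
    rw [ha] at hn
    refine (Nat.odd_pow_iff ?_).1 hn
    rintro rfl
    have := hP.two_le
    simp at ha; omega
  obtain ⟨p, b, hp, hb, e, he, hel⟩ := (hR.hyp hP h ht hr hro).main
  refine ⟨p, b * a, hp, by rw [pow_mul, ← hb, ha], ?_⟩
  obtain ⟨g, rfl⟩ := toImg_surj e
  obtain ⟨l, c, h1, h2, h3, h4⟩ := hel
  obtain ⟨Q, m, q1, q2, q3⟩ := hr.persp_af (h.fi R).img h2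
  refine ⟨Q.1, m.1, q1, ?_⟩
  have hgs : (g : G) ∈ MulAction.stabilizer G (Q.1, m.1) := stab_prod.2
    ⟨congrArg Subtype.val q2, congrArg Subtype.val q3⟩
  have : Fact p.Prime := ⟨hp⟩
  have ho : orderOf (toImg _ g : HH P L R) = p := orderOf_eq_prime he (nt_ne h4)
  have hd : p ∣ orderOf (g : G) := by
    rw [← ho]
    refine orderOf_dvd_of_pow_eq_one ?_
    rw [← toImg_pow, ← toImg_one]
    congr 1
    exact Subtype.ext (by simp [pow_orderOf_eq_one])
  refine hd.trans ?_
  rw [← Subgroup.orderOf_mk (g : G) hgs]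
  exact orderOf_dvd_natCard _

end fb
end AF
namespace AF

section gl
variable {G P L : Type*} [Group G] [MulAction G P] [MulAction G L] {n : ℕ} {I : P → L → Prop}
variable [Finite P] [Finite L] [Finite G]

/-- elation with axis `l` -/
def ElA (I : P → L → Prop) (g : G) (l : L) : Prop := Axis I g l ∧ ∃ c, I c l ∧ Center I g c

theorem ElA.free (hP : Plane I n) (h : Pres G I) (hF : Fth G P) {g : G} {l : L} (hg : ElA I g l)
    {p : P} (hp : ¬ I p l) (he : g • p = p) : g = 1 := by
  by_contra hc
  obtain ⟨h1, c, h2, h3⟩ := hg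
  rcases hP.persp_fixed h h1 h3 (fth_nt hF hc) he with h4 | h4
  · exact hp h4
  · subst h4; exact hp h2

theorem ElA.mul (hP : Plane I n) (h : Pres G I) (hF : Fth G P) {g k : G} {l : L} (hg : ElA I g l)
    (hk : ElA I k l) : ElA I (g * k) l := by
  refine ⟨hg.1.mul hk.1, ?_⟩
  have hg' := hg
  have hk' := hk
  obtain ⟨h1, X, h2, h3⟩ := hg
  obtain ⟨k1, Y, k2, k3⟩ := hk
  by_cases hXY : X = Y
  · subst hXY
    exact ⟨X, h2, h3.mul k3⟩
  obtain ⟨Z, hZ⟩ := hP.exists_center h (h1.mul k1)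
  by_cases hZl : I Z l
  · exact ⟨Z, hZl, hZ⟩
  have hgk : g • k • Z = Z := by rw [← mul_smul]; exact hP.center_fix h hZ
  obtain ⟨a, a1, a2⟩ := hP.ln Z X
  obtain ⟨b, b1, b2⟩ := hP.ln Z Y
  have hab : a ≠ b := by
    rintro rfl
    have := hP.eqL hXY a2 b2 h2 k2
    subst this
    exact hZl a1
  have e1 : I (k • Z) b := h.fixP (k3 b b2) b1
  have e2 : I (k • Z) a := by
    have : I (g • k • Z) a := by rw [hgk]; exact a1
    exact (h.fixP' (h3 a a2)).1 this
  have e3 : k • Z = Z := hP.eqP hab e2 e1 a1 b1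
  have e4 := hk'.free hP h hF hZl e3
  rw [e3] at hgk
  have e5 := hg'.free hP h hF hZl hgk
  refine ⟨X, h2, ?_⟩
  rw [e4, e5, one_mul]
  exact Center.one

/-- the elation group -/
def EA (hP : Plane I n) (h : Pres G I) (hF : Fth G P) (l : L) : Subgroup G where
  carrier := {g | ElA I g l}
  mul_mem' := fun h1 h2 => ElA.mul hP h hF h1 h2
  one_mem' := by
    obtain ⟨c, hc⟩ := hP.line_pt l
    exact ⟨Axis.one, c, hc, Center.one⟩
  inv_mem' := fun {g} h1 => ⟨h1.1.inv, h1.2.choose, h1.2.choose_spec.1, h1.2.choose_spec.2.inv⟩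

/-- elations with given center and axis -/
def EC (G : Type*) {P L : Type*} [Group G] [MulAction G P] [MulAction G L] (I : P → L → Prop)
    (X : P) (l : L) : Subgroup G where
  carrier := {g | Axis I g l ∧ Center I g X}
  mul_mem' := fun h1 h2 => ⟨h1.1.mul h2.1, h1.2.mul h2.2⟩
  one_mem' := ⟨Axis.one, Center.one⟩
  inv_mem' := fun h1 => ⟨h1.1.inv, h1.2.inv⟩

theorem free_orbit {S : Subgroup G} {X : Type*} [MulAction G X] [Finite X] {x : X}
    (hf : ∀ g ∈ S, g • x = x → g = 1) : (MulAction.orbit S x).ncard = Nat.card S := by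
  have h1 := orbit_card S x
  have : Nat.card (MulAction.stabilizer S x) = 1 := by
    rw [Subgroup.card_eq_one, eq_bot_iff]
    intro g hg
    rw [Subgroup.mem_bot]
    exact Subtype.ext (hf g.1 g.2 hg)
  rw [this, mul_one] at h1
  exact h1

theorem gl_arith {n h t : ℕ} (h2 : 2 ≤ h) (hn : 0 < n) (ht : t = (n + 1) * (h - 1) + 1)
    (h1 : h ∣ n) (h3 : t ∣ n ^ 2) : h = n := by
  obtain ⟨k, rfl⟩ := h1
  obtain ⟨s, hs⟩ := h3
  obtain ⟨j, rfl⟩ := Nat.exists_eq_add_of_le' h2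
  have hj : j + 2 - 1 = j + 1 := by omega
  rw [hj] at ht
  have hu : t = (j + 2) * (k * (j + 1) + 1) := by rw [ht]; ring
  rw [hu] at hs
  have e : (k * (j + 1) + 1) * s = (j + 2) * k ^ 2 := by
    have : (j + 2) * ((k * (j + 1) + 1) * s) = (j + 2) * ((j + 2) * k ^ 2) := by
      rw [← mul_assoc, ← hs]; ring
    exact Nat.eq_of_mul_eq_mul_left (by omega) this
  have hcop : Nat.Coprime (k * (j + 1) + 1) (k ^ 2) := by
    apply Nat.Coprime.pow_right
    rw [Nat.coprime_mul_left_add_left]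
    exact Nat.coprime_one_left k
  have hd : (k * (j + 1) + 1) ∣ j + 2 := hcop.dvd_of_dvd_mul_right (Dvd.intro _ e)
  have hle := Nat.le_of_dvd (by omega) hd
  have hk : k ≤ 1 := by
    by_contra hc
    push Not at hc
    nlinarith
  have : k ≠ 0 := by rintro rfl; simp at hn
  have : k = 1 := by omega
  subst this; ring

theorem EC.conj_card (h : Pres G I) {X X' : P} {l l' : L} (g : G) (h1 : g • X = X')
    (h2 : g • l = l') : Nat.card (EC G I X l) ≤ Nat.card (EC G I X' l') := by
  subst h1; subst h2
  refine Nat.card_le_card_of_injective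
    (fun k => ⟨g * k.1 * g⁻¹, k.2.1.conj h g, k.2.2.conj h g⟩) ?_
  intro a b hab
  have := congrArg Subtype.val hab
  simp only [mul_left_inj, mul_right_inj] at this
  exact Subtype.ext this

theorem EC.free (hP : Plane I n) (h : Pres G I) (hF : Fth G P) {X : P} {l : L} (hX : I X l)
    {p : P} (hp : ¬ I p l) : ∀ g ∈ EC G I X l, g • p = p → g = 1 := fun g hg he =>
  ElA.free hP h hF ⟨hg.1, X, hX, hg.2⟩ hp he

theorem off_of {hP : PP I} {X p : P} {l m : L} (hX : I X l) (hXm : I X m) (hml : m ≠ l)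
    (hp : I p m) (hpX : p ≠ X) : ¬ I p l := fun hc => hml (hP.eqL hpX hp hXm hc hX)

theorem EC.card_dvd (hP : Plane I n) (h : Pres G I) (hF : Fth G P) {X : P} {l : L} (hX : I X l) :
    Nat.card (EC G I X l) ∣ n := by
  obtain ⟨m, m1, m2, -⟩ := hP.ln_on X l l
  rw [← hP.card_diff m1]
  refine dvd_of_orbits (EC G I X l) _ ?_ _ ?_
  · rintro g hg x ⟨x1, x2⟩
    refine ⟨h.fixP (hg.2 m m1) x1, fun hc => x2 ?_⟩
    have := hP.center_fix h hg.2
    rw [← this] at hc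
    exact smul_left_cancel _ hc
  · rintro x ⟨x1, x2⟩
    rw [free_orbit (EC.free hP h hF hX (off_of (hP := hP.toPP) hX m1 m2 x1 x2))]

theorem EC.card_eq (hP : Plane I n) (h : Pres G I) (ht : AFT G I) (hF : Fth G P)
    (he : ∃ e : G, Elat I e) {X : P} {l : L} (hX : I X l) : Nat.card (EC G I X l) = n := by
  classical
  have hall : ∀ X', I X' l → Nat.card (EC G I X' l) = Nat.card (EC G I X l) := by
    intro X' hX'
    obtain ⟨g, g1, g2⟩ := hP.flag_trans h ht hX hX'
    obtain ⟨k, k1, k2⟩ := hP.flag_trans h ht hX' hX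
    exact le_antisymm (EC.conj_card h k k1 k2) (EC.conj_card h g g1 g2)
  have h2 : 2 ≤ Nat.card (EC G I X l) := by
    obtain ⟨e, l', c', e1, e2, e3, e4⟩ := he
    obtain ⟨g, g1, g2⟩ := hP.flag_trans h ht e1 hX
    refine le_trans ?_ (EC.conj_card h g g1 g2)
    have : Nontrivial (EC G I c' l') := by
      refine ⟨⟨e, e2, e3⟩, 1, fun hc => nt_ne e4 (congrArg Subtype.val hc)⟩
    exact Finite.one_lt_card
  have hn : 0 < n := by have := hP.two_le; omega
  have hcen : ∀ g : G, ∃ c, ElA I g l → I c l ∧ Center I g c := by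
    intro g
    by_cases hg : ElA I g l
    · obtain ⟨_, c, c1, c2⟩ := hg
      exact ⟨c, fun _ => ⟨c1, c2⟩⟩
    · exact ⟨X, fun hc => absurd hc hg⟩
  choose f hf using hcen
  have hcount := fib_card {g : G | ElA I g l ∧ g ≠ 1} {Y : P | I Y l} f (fun g hg => (hf g hg.1).1)
    (Nat.card (EC G I X l) - 1) (by
      intro Y hY
      rw [← hall Y hY]
      have hset : {x | x ∈ {g : G | ElA I g l ∧ g ≠ 1} ∧ f x = Y} =
          ((EC G I Y l : Subgroup G) : Set G) \ {1} := by
        ext g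
        constructor
        · rintro ⟨⟨a1, a2⟩, rfl⟩
          exact ⟨⟨a1.1, (hf g a1).2⟩, a2⟩
        · rintro ⟨a1, a2⟩
          have hE : ElA I g l := ⟨a1.1, Y, hY, a1.2⟩
          exact ⟨⟨hE, a2⟩, hP.center_unique h (hf g hE).2 a1.2 (fth_nt hF a2)⟩
      rw [hset]
      have := Set.ncard_sdiff_singleton_add_one (Subgroup.one_mem (EC G I Y l)) (Set.toFinite _)
      rw [← Nat.card_coe_set_eq ((EC G I Y l : Subgroup G) : Set G)] at this
      have e : Nat.card ↑((EC G I Y l : Subgroup G) : Set G) = Nat.card (EC G I Y l) := rfl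
      rw [e] at this
      omega)
  rw [hP.line_card] at hcount
  have htot : Nat.card (EA hP h hF l) = (n + 1) * (Nat.card (EC G I X l) - 1) + 1 := by
    rw [← hcount]
    have hset : {g : G | ElA I g l ∧ g ≠ 1} = ((EA hP h hF l : Subgroup G) : Set G) \ {1} := rfl
    rw [hset]
    rw [Set.ncard_sdiff_singleton_add_one (Subgroup.one_mem (EA hP h hF l)) (Set.toFinite _)]
    rfl
  refine gl_arith h2 hn htot (EC.card_dvd hP h hF hX) ?_
  rw [← hP.card_off l]
  refine dvd_of_orbits (EA hP h hF l) _ ?_ _ ?_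
  · rintro g hg x hx
    exact fun hc => hx ((h.fixP' (hP.axis_fix h hg.1)).1 hc)
  · intro x hx
    rw [free_orbit (fun g hg he => ElA.free hP h hF hg hx he)]

theorem EC.trans (hP : Plane I n) (h : Pres G I) (ht : AFT G I) (hF : Fth G P)
    (he : ∃ e : G, Elat I e) {X Y Y' : P} {l m : L} (hX : I X l) (hXm : I X m) (hml : m ≠ l)
    (hY : I Y m) (hYX : Y ≠ X) (hY' : I Y' m) (hYX' : Y' ≠ X) :
    ∃ g : G, Axis I g l ∧ Center I g X ∧ g • Y = Y' := by
  have h1 := free_orbit (EC.free hP h hF hX (off_of (hP := hP.toPP) hX hXm hml hY hYX))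
  rw [EC.card_eq hP h ht hF he hX, ← hP.card_diff hXm] at h1
  have hsub : MulAction.orbit (EC G I X l) Y ⊆ {p | I p m ∧ p ≠ X} := by
    rintro _ ⟨g, rfl⟩
    refine ⟨h.fixP (g.2.2 m hXm) hY, fun hc => hYX ?_⟩
    have hcf := hP.center_fix h g.2.2
    have hc' : (g : G) • Y = X := hc
    exact smul_left_cancel _ (hc'.trans hcf.symm)
  have := Set.eq_of_subset_of_ncard_le hsub h1.ge (Set.toFinite _)
  have hmem : Y' ∈ MulAction.orbit (EC G I X l) Y := by rw [this]; exact ⟨hY', hYX'⟩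
  obtain ⟨g, hg⟩ := hmem
  exact ⟨g.1, g.2.1, g.2.2, hg⟩

theorem Plane.gleason (hP : Plane I n) (h : Pres G I) (ht : AFT G I) (hF : Fth G P)
    (he : ∃ e : G, Elat I e) : ∃ p k : ℕ, p.Prime ∧ n = p ^ k ∧ (∃ e : G, e ^ p = 1 ∧ Elat I e) ∧
      ∀ (l : L) (g : G), ElA I g l → g ^ p = 1 ∧ ∀ k : G, ElA I k l → g * k = k * g := by
  have hn : n ≠ 1 := by have := hP.two_le; omega
  obtain ⟨p, hp, hpn⟩ := Nat.exists_prime_and_dvd hn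
  have : Fact p.Prime := ⟨hp⟩
  have hord : ∀ X l, I X l → ∃ e : G, Axis I e l ∧ Center I e X ∧ e ^ p = 1 ∧ e ≠ 1 := by
    intro X l hX
    have hd : p ∣ Nat.card (EC G I X l) := by rwa [EC.card_eq hP h ht hF he hX]
    obtain ⟨e, he⟩ := exists_prime_orderOf_dvd_card' p hd
    have h1 : orderOf (e : G) = p := by rw [Subgroup.orderOf_coe, he]
    refine ⟨e.1, e.2.1, e.2.2, by rw [← h1]; exact pow_orderOf_eq_one _, ?_⟩
    intro hc
    rw [hc, orderOf_one] at h1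
    exact hp.ne_one h1.symm
  have hexp : ∀ (l : L) (g : G), ElA I g l → g ^ p = 1 := by
    rintro l g ⟨g1, c, g2, g3⟩
    obtain ⟨X, x1, x2, -⟩ := hP.pt_on l c c
    obtain ⟨e, e1, e2, e3, e4⟩ := hord X l x1
    exact (hP.exp_lemma h hF x1 g2 x2 g1 g3 e1 e2 e4).2 p e3
  have hcom1 : ∀ (l : L) (g k : G) (c d : P), I c l → I d l → c ≠ d → Axis I g l → Axis I k l →
      Center I g c → Center I k d → g * k = k * g := by
    intro l g k c d hc hd hcd h1 h2 h3 h4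
    by_cases hk : k = 1
    · subst hk; simp
    · exact (hP.exp_lemma h hF hd hc hcd.symm h1 h3 h2 h4 hk).1
  have hcom : ∀ (l : L) (g k : G), ElA I g l → ElA I k l → g * k = k * g := by
    rintro l g k hg hk
    by_cases hg1 : g = 1
    · subst hg1; simp
    have hg' := hg
    have hk' := hk
    obtain ⟨g1, c, g2, g3⟩ := hg
    obtain ⟨k1, d, k2, k3⟩ := hk
    by_cases hcd : c = d
    · subst hcd
      obtain ⟨X, x1, x2, -⟩ := hP.pt_on l c c
      obtain ⟨f, f1, f2, f3, f4⟩ := hord X l x1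
      have hf : ElA I f l := ⟨f1, X, x1, f2⟩
      obtain ⟨m1, Z, z1, z2⟩ := hf.mul hP h hF hg'
      have hZ : Z ≠ c := by
        rintro rfl
        have := z2.mul g3.inv
        rw [mul_inv_cancel_right] at this
        exact f4 (hF f (hP.two_centers h x2 f2 this))
      have e1 := hcom1 l (f * g) k Z c z1 g2 hZ m1 k1 z2 k3
      have e2 := hcom1 l f k X c x1 g2 x2 f1 k1 f2 k3
      rw [← mul_assoc, ← e2, mul_assoc, mul_assoc] at e1
      exact mul_left_cancel e1
    · exact hcom1 l g k c d g2 k2 hcd g1 k1 g3 k3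
  obtain ⟨e, he'⟩ := he
  have he'' := he'
  obtain ⟨l, X, hX, e2, e3, e4⟩ := he''
  have hpg : IsPGroup p (EC G I X l) := by
    intro g
    refine ⟨1, Subtype.ext ?_⟩
    have := hexp l g.1 ⟨g.2.1, X, hX, g.2.2⟩
    simpa using this
  obtain ⟨k, hk⟩ := IsPGroup.iff_card.1 hpg
  rw [EC.card_eq hP h ht hF ⟨e, he'⟩ hX] at hk
  exact ⟨p, k, hp, hk, ⟨e, hexp l e ⟨e2, X, hX, e3⟩, he'⟩,
    fun l g hg => ⟨hexp l g hg, fun k hk => hcom l g k hg hk⟩⟩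

end gl
end AF
namespace AF

section fc
variable {G P L : Type*} [Group G] [MulAction G P] [MulAction G L] {n : ℕ} {I : P → L → Prop}
variable [Finite P] [Finite L] [Finite G]

theorem syl_trans {X : Type*} [MulAction G X] [Finite X] {p j : ℕ} [hp : Fact p.Prime]
    {K S : Subgroup G} (hS : IsSyl p K S) {s : Set X} (hs : s.ncard = p ^ j)
    (hK : ∀ x ∈ s, ∀ y ∈ s, ∃ g ∈ K, g • x = y) (hK' : ∀ g ∈ K, ∀ x ∈ s, g • x ∈ s) :
    ∀ x ∈ s, ∀ y ∈ s, ∃ g ∈ S, g • x = y := by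
  intro x hx y hy
  have h1 : MulAction.orbit K x = s := by
    ext z
    constructor
    · rintro ⟨g, rfl⟩
      exact hK' g.1 g.2 x hx
    · intro hz
      obtain ⟨g, g1, g2⟩ := hK x hx z hz
      exact ⟨⟨g, g1⟩, g2⟩
  have h2 := hS.orb x
  rw [h1, hs, Nat.Prime.factorization_pow hp.out, Finsupp.single_eq_same, ← hs] at h2
  have h3 : MulAction.orbit S x ⊆ s := by
    rintro _ ⟨g, rfl⟩
    exact hK' g.1 (hS.1 g.2) x hx
  have hpos : 0 < (MulAction.orbit S x).ncard := by
    rw [Set.ncard_pos (Set.toFinite _)]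
    exact ⟨x, MulAction.mem_orbit_self x⟩
  have h4 := Set.eq_of_subset_of_ncard_le h3 (Nat.le_of_dvd hpos h2) (Set.toFinite _)
  rw [← h4] at hy
  obtain ⟨g, hg⟩ := hy
  exact ⟨g.1, g.2, hg⟩

theorem coprime_mem {H : Subgroup G} {g : G} {a b : ℕ} (hab : a.Coprime b) (h1 : g ^ a ∈ H)
    (h2 : g ^ b ∈ H) : g ∈ H := by
  have e := Nat.gcd_eq_gcd_ab a b
  rw [hab] at e
  have : g = (g ^ a) ^ (Nat.gcdA a b) * (g ^ b) ^ (Nat.gcdB a b) := by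
    rw [← zpow_natCast g a, ← zpow_natCast g b, ← zpow_mul, ← zpow_mul, ← zpow_add, ← e]
    simp
  rw [this]
  exact H.mul_mem (H.zpow_mem h1 _) (H.zpow_mem h2 _)

theorem Plane.fourc (hP : Plane I n) (h : Pres G I) (ht : AFT G I) (hF : Fth G P)
    {p a : ℕ} (hp : p.Prime) (hn : n = p ^ a) {Q : P} {l : L} (hQ : ¬ I Q l)
    (hd : p ∣ Nat.card (MulAction.stabilizer G (Q, l)))
    (IH : ∀ (S : Subgroup G) (r : ℕ), Plane (FI I S) r → r < n →
      AFT (Subgroup.normalizer (S : Set G)) (FI I S) → ∃ q b : ℕ, q.Prime ∧ r = q ^ b ∧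
        ∃ e : Subgroup.normalizer (S : Set G), Elat (FI I S) e ∧ ∀ x : Fx S P, e ^ q • x = x) :
    ∃ e : G, Elat I e := by
  have : Fact p.Prime := ⟨hp⟩
  have hpn : p ∣ n := by
    rw [hn]
    refine dvd_pow_self p ?_
    rintro rfl
    have := hP.two_le
    simp at hn; omega
  obtain ⟨S, hS⟩ := exists_syl' p (MulAction.stabilizer G (Q, l))
  have hSb := hS.ne_bot hd
  obtain ⟨T, hT, hST⟩ := exists_syl (p := p) (K := MulAction.stabilizer G l) (Q := S)
    (fun g hg => (stab_prod.1 (hS.1 hg)).2) hS.pg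
  have hTl : ∀ g ∈ T, g • l = l := fun g hg => hT.1 hg
  have hSQ : ∀ g ∈ S, g • Q = Q := fun g hg => (stab_prod.1 (hS.1 hg)).1
  have hSl : ∀ g ∈ S, g • l = l := fun g hg => (stab_prod.1 (hS.1 hg)).2
  -- fixed point on l
  obtain ⟨A, hA, hTA⟩ : ∃ A, I A l ∧ ∀ g ∈ T, g • A = A := by
    have h1 := pg_fix hT.pg {x | I x l} (fun g hg x hx => h.fixP (hTl g hg) hx)
    rw [hP.line_card] at h1
    by_contra hc
    have h2 : {x | x ∈ {x | I x l} ∧ ∀ g ∈ T, g • x = x} = ∅ := by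
      ext x
      simp only [Set.mem_ofPred_eq, Set.mem_empty_iff_false, iff_false]
      exact fun hx => hc ⟨x, hx⟩
    rw [h2, Set.ncard_empty] at h1
    have h3 := (Nat.modEq_zero_iff_dvd).1 h1
    have := (Nat.dvd_add_right hpn).1 h3
    exact hp.one_lt.ne' (Nat.dvd_one.1 this)
  have hSA : ∀ g ∈ S, g • A = A := fun g hg => hTA g (hST hg)
  have hAT : IsSyl p (MulAction.stabilizer G (A, l)) T :=
    hT.down (fun g hg => (stab_prod.1 hg).2) (fun g hg => stab_prod.2 ⟨hTA g hg, hTl g hg⟩)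
  have t1 : ∀ x ∈ {x | ¬ I x l}, ∀ y ∈ {x | ¬ I x l}, ∃ g ∈ T, g • x = y := by
    refine syl_trans (j := a * 2) hT (by rw [hP.card_off, hn, pow_mul]) ?_ ?_
    · intro x hx y hy
      obtain ⟨g, g1, g2⟩ := ht x l y l hx hy
      exact ⟨g, g2, g1⟩
    · intro g hg x hx hc
      exact hx ((h.fixP' hg).1 hc)
  have t2 : ∀ x ∈ {x | I x l ∧ x ≠ A}, ∀ y ∈ {x | I x l ∧ x ≠ A}, ∃ g ∈ T, g • x = y := by
    refine syl_trans (j := a) hAT (by rw [hP.card_diff hA, hn]) ?_ ?_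
    · rintro x ⟨x1, x2⟩ y ⟨y1, y2⟩
      obtain ⟨g, g1, g2⟩ := hP.two_trans h ht A x A y x2.symm y2.symm
      refine ⟨g, stab_prod.2 ⟨g1, ?_⟩, g2⟩
      have e1 := h g _ _ hA
      have e2 := h g _ _ x1
      rw [g1] at e1
      rw [g2] at e2
      exact hP.eqL y2.symm e1 e2 hA y1
    · rintro g hg x ⟨x1, x2⟩
      have := stab_prod.1 hg
      refine ⟨h.fixP this.2 x1, fun hc => x2 ?_⟩
      exact smul_left_cancel g (hc.trans this.1.symm)
  have t3 : ∀ x ∈ {x | I A x ∧ x ≠ l}, ∀ y ∈ {x | I A x ∧ x ≠ l}, ∃ g ∈ T, g • x = y := by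
    refine syl_trans (j := a) hAT (by rw [← hn]; exact hP.dual.card_diff hA) ?_ ?_
    · rintro x ⟨x1, x2⟩ y ⟨y1, y2⟩
      obtain ⟨g, g1, g2⟩ := hP.dual.two_trans h.dual ht.dual l x l y x2.symm y2.symm
      refine ⟨g, stab_prod.2 ⟨?_, g1⟩, g2⟩
      have e1 := h g _ _ hA
      have e2 := h g _ _ x1
      rw [g1] at e1
      rw [g2] at e2
      exact hP.eqP y2.symm e1 e2 hA y1
    · rintro g hg x ⟨x1, x2⟩
      have := stab_prod.1 hg
      refine ⟨h.fixL this.1 x1, fun hc => x2 ?_⟩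
      exact smul_left_cancel g (hc.trans this.2.symm)
  have hTb : T ≠ ⊥ := by
    rintro rfl
    exact hSb (le_bot_iff.1 hST)
  obtain ⟨z, z1, z2, z3, z4⟩ := exists_central hT.pg hTb
  have hznt : ∃ x : P, z • x ≠ x := fth_nt hF z2
  have hconj : ∀ s ∈ T, s * z * s⁻¹ = z := fun s hs => by rw [z4 s hs, mul_inv_cancel_right]
  by_cases c1 : ∃ x, (I x l ∧ x ≠ A) ∧ z • x = x
  · obtain ⟨x, hx, hzx⟩ := c1
    have hax : Axis I z l := by
      intro y hy
      by_cases hyA : y = A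
      · subst hyA; exact hTA z z1
      · obtain ⟨g, g1, rfl⟩ := t2 x hx y ⟨hy, hyA⟩
        rw [← mul_smul, ← z4 g g1, mul_smul, hzx]
    obtain ⟨c, hc⟩ := hP.exists_center h hax
    by_cases hcl : I c l
    · exact ⟨z, l, c, hcl, hax, hc, hznt⟩
    exfalso
    have hfix : ∀ s ∈ T, s • c = c := by
      intro s hs
      have := hc.conj h s
      rw [hconj s hs] at this
      exact hP.center_unique h this hc hznt
    obtain ⟨m, m1, m2⟩ := hP.ln c A
    obtain ⟨c', c1, c2, c3⟩ := hP.pt_on m A c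
    obtain ⟨g, g1, g2⟩ := t1 c hcl c' (off_of (hP := hP.toPP) hA m2
      (by rintro rfl; exact hcl m1) c1 c2)
    rw [hfix g g1] at g2
    exact c3 g2.symm
  by_cases c2 : ∃ x, (I A x ∧ x ≠ l) ∧ z • x = x
  · obtain ⟨x, hx, hzx⟩ := c2
    have hax : Center I z A := by
      intro y hy
      by_cases hyA : y = l
      · subst hyA; exact hTl z z1
      · obtain ⟨g, g1, rfl⟩ := t3 x hx y ⟨hy, hyA⟩
        rw [← mul_smul, ← z4 g g1, mul_smul, hzx]
    obtain ⟨c, hc⟩ := hP.exists_axis h hax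
    by_cases hcl : I A c
    · exact ⟨z, c, A, hcl, hc, hax, hznt⟩
    exfalso
    have hfix : ∀ s ∈ T, s • c = c := by
      intro s hs
      have := hc.conj h s
      rw [hconj s hs] at this
      exact hP.axis_unique h this hc hznt
    obtain ⟨m, m1, m2⟩ := hP.pt c l
    obtain ⟨c', c1, c2, c3⟩ := hP.pt_on l A m
    have hmA : m ≠ A := by rintro rfl; exact hcl m1
    obtain ⟨g, g1, g2⟩ := t2 m ⟨m2, hmA⟩ c' ⟨c1, c2⟩
    rw [hP.fix_pt h (by rintro rfl; exact hcl hA) m1 m2 (hfix g g1) (hTl g g1)] at g2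
    exact c3 g2.symm
  -- main case
  exfalso
  push Not at c2
  obtain ⟨m, m1, m2⟩ := hP.ln Q A
  have hQA : Q ≠ A := by rintro rfl; exact hQ hA
  have hml : m ≠ l := by rintro rfl; exact hQ m1
  have hSm : ∀ g ∈ S, g • m = m := fun g hg => hP.fix_line h hQA m1 m2 (hSQ g hg) (hSA g hg)
  have hcnt := pg_fix hS.pg {x | I x m} (fun g hg x hx => h.fixP (hSm g hg) hx)
  rw [hP.line_card] at hcnt
  have hn1 : n + 1 ≡ 1 [MOD p] := by
    have := (Nat.modEq_zero_iff_dvd.2 hpn).add_right 1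
    simpa using this
  obtain ⟨Q2, q1, q2, q3, q4⟩ : ∃ Q2, I Q2 m ∧ Q2 ≠ Q ∧ Q2 ≠ A ∧ ∀ g ∈ S, g • Q2 = Q2 := by
    by_contra hc
    push Not at hc
    have : {x | x ∈ {x | I x m} ∧ ∀ g ∈ S, g • x = x} = {Q, A} := by
      ext x
      constructor
      · rintro ⟨x1, x2⟩
        by_contra hx
        simp only [Set.mem_insert_iff, Set.mem_singleton_iff, not_or] at hx
        obtain ⟨g, g1, g2⟩ := hc x x1 hx.1 hx.2
        exact g2 (x2 g g1)
      · rintro (rfl | rfl)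
        · exact ⟨m1, hSQ⟩
        · exact ⟨m2, hSA⟩
    rw [this, Set.ncard_pair hQA] at hcnt
    have h5 := (Nat.modEq_iff_dvd' (by norm_num)).1 (hn1.symm.trans hcnt)
    exact hp.one_lt.ne' (Nat.dvd_one.1 h5)
  have zc : ∀ (x : P), (∀ g ∈ S, g • x = x) → ∀ g ∈ S, g • z • x = z • x := by
    intro x hx g hg
    rw [← mul_smul, z4 g (hST hg), mul_smul, hx g hg]
  have zcL : ∀ (x : L), (∀ g ∈ S, g • x = x) → ∀ g ∈ S, g • z • x = z • x := by
    intro x hx g hg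
    rw [← mul_smul, z4 g (hST hg), mul_smul, hx g hg]
  have zm : z • m ≠ m := c2 m ⟨m2, hml⟩
  have zmA : I A (z • m) := h.fixL (hTA z z1) m2
  obtain ⟨k, k1, k2⟩ := hP.ln Q (z • Q)
  have hQzm : ¬ I Q (z • m) := fun hc => zm (hP.eqL hQA hc zmA m1 m2)
  have hzQ : I (z • Q) (z • m) := h z _ _ m1
  have hzQ2 : I (z • Q2) (z • m) := h z _ _ q1
  have hzne : ∀ x, x ≠ A → z • x ≠ A := by
    intro x hx hc
    exact hx (smul_left_cancel z (hc.trans (hTA z z1).symm))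
  have hkm : k ≠ m := by
    rintro rfl
    exact zm (hP.eqL (hzne Q hQA) hzQ zmA k2 m2)
  have hkzm : k ≠ z • m := by
    rintro rfl; exact hQzm k1
  have hplS : Planar I S := by
    refine ⟨z • Q2, Q, Q2, z • m, m, k, ⟨?_, ?_, ?_, ?_, ?_, ?_, ?_, ?_⟩, fun g hg => ⟨zc Q2 q4 g hg,
      hSQ g hg, q4 g hg, zcL m hSm g hg, hSm g hg, ?_⟩⟩
    · intro hc
      exact zm (hP.eqL (hzne Q2 q3) hzQ2 zmA hc m2)
    · intro hc
      exact q2 (smul_left_cancel z (hP.eqP hkzm hc hzQ2 k2 hzQ))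
    · exact hQzm
    · exact m1
    · exact k1
    · intro hc
      exact zm (hP.eqL q3 hc zmA q1 m2)
    · exact q1
    · intro hc
      exact q2 (hP.eqP hkm hc q1 k1 m1)
    · refine hP.fix_line h ?_ k1 k2 (hSQ g hg) (zc Q hSQ g hg)
      intro hc
      rw [← hc] at hzQ
      exact hQzm hzQ
  obtain ⟨r, hr⟩ := hplS.plane hP.toPP h
  have hrn : r < n := by
    refine hP.order_lt hr ?_
    obtain ⟨s, s1, s2⟩ := S.ne_bot_iff_exists_ne_one.1 hSb |>.imp fun s hs => And.intro s.2 hs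
    exact ⟨s, s1, fth_nt hF (fun hc => s2 (Subtype.ext hc))⟩
  have haft := witt_aft ht hQ hS
  obtain ⟨q, b, hq, hb, e, he, hep⟩ := IH S r hr hrn haft
  have hpr : p ∣ r := by
    have h6 := fx_line_card hr hSm
    have h7 : {x | x ∈ {x | I x m} ∧ ∀ g ∈ S, g • x = x} =
      {x : P | I x m ∧ ∀ g ∈ S, g • x = x} := rfl
    rw [h7, h6] at hcnt
    have h8 := (Nat.modEq_iff_dvd' (by omega)).1 (hn1.symm.trans hcnt)
    simpa using h8
  have hpq : p = q := by
    rw [hb] at hpr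
    exact (Nat.prime_dvd_prime_iff_eq hp hq).1 (hp.dvd_of_dvd_pow hpr)
  subst hpq
  obtain ⟨j, k', j1, j2⟩ := pelt p e
  obtain ⟨l0, c0, e1, e2, e3, x0, e4⟩ := he
  obtain ⟨Q', m', w1, w2, w3⟩ := hr.persp_af (h.fi S) e2
  have hmv := hS.move (y := (Q'.1, m'.1))
    (fun g hg => by rw [Prod.smul_mk, Q'.2 g hg, m'.2 g hg]) (by
      obtain ⟨g, g1, g2⟩ := ht Q l Q'.1 m'.1 hQ w1
      exact ⟨g, by rw [Prod.smul_mk, g1, g2]⟩)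
  have hmem : ((e ^ j : Subgroup.normalizer (S : Set G)) : G) ∈ S := by
    refine hmv.mem_of_norm (k := k') ?_ (e ^ j).2 ?_
    · simpa using congrArg Subtype.val j2
    · rw [stab_prod]
      have u1 : e ^ j ∈ MulAction.stabilizer _ Q' := Subgroup.pow_mem _ w2 j
      have u2 : e ^ j ∈ MulAction.stabilizer _ m' := Subgroup.pow_mem _ w3 j
      exact ⟨congrArg Subtype.val u1, congrArg Subtype.val u2⟩
  have hex : e ∈ MulAction.stabilizer _ x0 :=
    coprime_mem j1 (fx_triv hmem x0) (hep x0)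
  exact e4 hex

end fc

/-- Existence of elations -/
theorem main_E (N : ℕ) : ∀ (G P L : Type) [Group G] [MulAction G P] [MulAction G L] [Finite G]
    [Finite P] [Finite L] (I : P → L → Prop) (n : ℕ), Nat.card P ≤ N → Plane I n → Pres G I →
    AFT G I → ∃ p k : ℕ, p.Prime ∧ n = p ^ k ∧ ∃ e : G, Elat I e ∧ ∀ x : P, e ^ p • x = x := by
  induction N with
  | zero =>
    intro G P L _ _ _ _ _ _ I n hc hP
    rw [hP.cardP] at hc
    omega
  | succ N ih =>
    intro G P L _ _ _ _ _ _ I n hc hP h ht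
    have hF := hP.img_fth h
    have hel : ∃ e : Img G P L, Elat I e := by
      rcases Nat.even_or_odd n with hn | hn
      · exact hP.even_elat h.img ht.img hF hn
      · by_cases hax : ∀ g : Img G P L, g ≠ 1 → g * g = 1 → ∀ l, ¬ Axis I g l
        · obtain ⟨p, a, hp, ha, Q, m, hQ, hd⟩ := hP.fourb h.img ht.img hF hn hax
          refine hP.fourc h.img ht.img hF hp ha hQ hd ?_
          intro S r hr hrn haft
          refine ih _ _ _ (FI I S) r ?_ hr (h.img.fi S) haft
          rw [hP.cardP] at hc
          rw [hr.cardP]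
          nlinarith
        · push Not at hax
          obtain ⟨g, g1, g2, l, hl⟩ := hax
          obtain ⟨c, hc⟩ := hP.exists_center h.img hl
          have hnt := fth_nt hF g1
          exact hP.homology_elat h.img ht.img hl hc (hP.inv_odd h.img
            (fun p => by rw [← mul_smul, g2, one_smul]) hnt hn hl hc) hnt g2
    obtain ⟨p, k, hp, hk, ⟨e, e1, e2⟩, -⟩ := hP.gleason h.img ht.img hF hel
    obtain ⟨g, rfl⟩ := toImg_surj e
    refine ⟨p, k, hp, hk, g, e2, fun x => ?_⟩
    rw [← toImgP (L := L), toImg_pow, e1, one_smul]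

end AF

namespace AF

section alg

theorem jordan_span {K A : Type*} [Field K] [Ring A] [Algebra K A] (T : Set A)
    (hadd : ∀ a ∈ T, ∀ b ∈ T, a + b ∈ T) (hneg : ∀ a ∈ T, -a ∈ T)
    (hJ : ∀ a ∈ T, ∀ b ∈ T, a * b * a ∈ T) :
    ∀ x ∈ Submodule.span K T, ∀ y ∈ Submodule.span K T, x * y * x ∈ Submodule.span K T := by
  set S := Submodule.span K T with hS
  have hT : ∀ a ∈ T, a ∈ S := fun a ha => Submodule.subset_span ha
  have h0 : ∀ a ∈ T, ∀ b ∈ T, ∀ c ∈ T, a * b * c + c * b * a ∈ S := by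
    intro a ha b hb c hc
    have h1 := hT _ (hJ _ (hadd a ha c hc) b hb)
    have h2 := hT _ (hJ a ha b hb)
    have h3 := hT _ (hJ c hc b hb)
    have : a * b * c + c * b * a = (a + c) * b * (a + c) - a * b * a - c * b * c := by
      noncomm_ring
    rw [this]
    exact S.sub_mem (S.sub_mem h1 h2) h3
  have h1 : ∀ a ∈ T, ∀ b ∈ T, ∀ c ∈ S, a * b * c + c * b * a ∈ S := by
    intro a ha b hb c hc
    refine Submodule.span_induction (p := fun c _ => a * b * c + c * b * a ∈ S) ?_ ?_ ?_ ?_ hc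
    · exact fun c hc => h0 a ha b hb c hc
    · simp
    · intro x y _ _ hx hy
      have : a * b * (x + y) + (x + y) * b * a =
        (a * b * x + x * b * a) + (a * b * y + y * b * a) := by noncomm_ring
      rw [this]; exact S.add_mem hx hy
    · intro k x _ hx
      have : a * b * (k • x) + (k • x) * b * a = k • (a * b * x + x * b * a) := by
        simp [smul_add]
      rw [this]; exact S.smul_mem k hx
  have h2 : ∀ a ∈ T, ∀ b ∈ S, ∀ c ∈ S, a * b * c + c * b * a ∈ S := by
    intro a ha b hb c hc
    refine Submodule.span_induction (p := fun b _ => a * b * c + c * b * a ∈ S) ?_ ?_ ?_ ?_ hb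
    · exact fun b hb => h1 a ha b hb c hc
    · simp
    · intro x y _ _ hx hy
      have : a * (x + y) * c + c * (x + y) * a =
        (a * x * c + c * x * a) + (a * y * c + c * y * a) := by noncomm_ring
      rw [this]; exact S.add_mem hx hy
    · intro k x _ hx
      have : a * (k • x) * c + c * (k • x) * a = k • (a * x * c + c * x * a) := by
        simp [smul_add]
      rw [this]; exact S.smul_mem k hx
  have h3 : ∀ a ∈ S, ∀ b ∈ S, ∀ c ∈ S, a * b * c + c * b * a ∈ S := by
    intro a ha b hb c hc
    refine Submodule.span_induction (p := fun a _ => a * b * c + c * b * a ∈ S) ?_ ?_ ?_ ?_ ha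
    · exact fun a ha => h2 a ha b hb c hc
    · simp
    · intro x y _ _ hx hy
      have : (x + y) * b * c + c * b * (x + y) =
        (x * b * c + c * b * x) + (y * b * c + c * b * y) := by noncomm_ring
      rw [this]; exact S.add_mem hx hy
    · intro k x _ hx
      have : (k • x) * b * c + c * b * (k • x) = k • (x * b * c + c * b * x) := by
        simp [smul_add]
      rw [this]; exact S.smul_mem k hx
  have h4 : ∀ a ∈ T, ∀ b ∈ S, a * b * a ∈ S := by
    intro a ha b hb
    refine Submodule.span_induction (p := fun b _ => a * b * a ∈ S) ?_ ?_ ?_ ?_ hb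
    · exact fun b hb => hT _ (hJ a ha b hb)
    · simp
    · intro x y _ _ hx hy
      have : a * (x + y) * a = a * x * a + a * y * a := by noncomm_ring
      rw [this]; exact S.add_mem hx hy
    · intro k x _ hx
      have : a * (k • x) * a = k • (a * x * a) := by simp
      rw [this]; exact S.smul_mem k hx
  intro x hx y hy
  refine Submodule.span_induction (p := fun x _ => x * y * x ∈ S) ?_ ?_ ?_ ?_ hx
  · exact fun a ha => h4 a ha y hy
  · simp
  · intro x1 x2 hx1 hx2 h5 h6
    have : (x1 + x2) * y * (x1 + x2) = x1 * y * x1 + x2 * y * x2 +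
      (x1 * y * x2 + x2 * y * x1) := by noncomm_ring
    rw [this]; exact S.add_mem (S.add_mem h5 h6) (h3 _ hx1 _ hy _ hx2)
  · intro k x _ hx
    have : (k • x) * y * (k • x) = k • k • (x * y * x) := by simp
    rw [this]; exact S.smul_mem k (S.smul_mem k hx)

theorem jordan_pow {K A : Type*} [Field K] [Ring A] [Algebra K A] (S : Submodule K A)
    (hJ : ∀ x ∈ S, ∀ y ∈ S, x * y * x ∈ S) (h1 : 1 ∈ S) {x : A} (hx : x ∈ S) :
    ∀ k : ℕ, x ^ k ∈ S ∧ x ^ (k + 1) ∈ S := by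
  intro k
  induction k with
  | zero => simpa using ⟨h1, hx⟩
  | succ k ih =>
    refine ⟨ih.2, ?_⟩
    have : x ^ (k + 1 + 1) = x * x ^ k * x := by
      rw [pow_succ, pow_succ']
    rw [this]
    exact hJ x hx _ ih.1

open MvPolynomial in
/-- generic element has irreducible characteristic polynomial -/
theorem generic_irred {p e : ℕ} [Fact p.Prime] (he : 0 < e)
    (b : Fin e → Matrix (Fin e) (Fin e) (ZMod p))
    (hdet : ∀ t : Fin e → ZMod p, (∑ i, t i • b i).det = 0 → t = 0) :
    Irreducible (Matrix.charpoly (∑ i, (X i : MvPolynomial (Fin e) (ZMod p)) • (b i).map (C : ZMod p →+* MvPolynomial (Fin e) (ZMod p)))) := by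
  set M : Matrix (Fin e) (Fin e) (MvPolynomial (Fin e) (ZMod p)) :=
    ∑ i, (X i : MvPolynomial (Fin e) (ZMod p)) • (b i).map (C : ZMod p →+* MvPolynomial (Fin e) (ZMod p)) with hM
  have : NeZero e := ⟨he.ne'⟩
  have hev : ∀ t : Fin e → ZMod p, M.map (eval t) = ∑ i, t i • b i := by
    intro t
    ext i j
    simp [hM, Matrix.sum_apply]
  have hdetev : ∀ t, eval t M.det = (∑ i, t i • b i).det := by
    intro t
    rw [RingHom.map_det, ← hev]; rfl
  have hdeg : M.det.totalDegree ≤ e := by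
    rw [Matrix.det_apply]
    refine totalDegree_finsetSum_le fun σ _ => ?_
    refine (totalDegree_smul_le _ _).trans ?_
    refine (totalDegree_finsetProd _ _).trans ?_
    refine (Finset.sum_le_sum (g := fun _ => 1) fun i _ => ?_).trans (by simp)
    simp only [hM, Matrix.sum_apply, Matrix.smul_apply, Matrix.map_apply, smul_eq_mul]
    refine totalDegree_finsetSum_le fun j _ => ?_
    refine (totalDegree_mul _ _).trans ?_
    simp
  have hne : M.det ≠ 0 := by
    intro hc
    have h1 := hdetev (fun _ => 1)
    rw [hc, map_zero] at h1
    have := congrFun (hdet _ h1.symm) 0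
    simp at this
  have hc0 : M.charpoly.coeff 0 = (-1) ^ e * M.det := by
    have := M.det_eq_sign_charpoly_coeff
    rw [this, Fintype.card_fin, ← mul_assoc, ← mul_pow]; simp
  have hz : M.charpoly.map (eval (0 : Fin e → ZMod p)) = Polynomial.X ^ e := by
    rw [← Matrix.charpoly_map]
    have : M.map (eval (0 : Fin e → ZMod p)) = 0 := by rw [hev]; simp
    rw [this, Matrix.charpoly_zero]; simp
  have hmon := M.charpoly_monic
  have key : ∀ f g : Polynomial (MvPolynomial (Fin e) (ZMod p)), f.Monic → g.Monic →
      f * g = M.charpoly → f ≠ 1 → e ≤ (f.coeff 0).totalDegree := by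
    intro f g hf hg hfg hf1
    by_contra hlt
    push Not at hlt
    have h1 := char_dvd_card_solutions p (f := f.coeff 0) (by simpa using hlt)
    have hzero : ∀ t, eval t (f.coeff 0) = 0 ↔ t = 0 := by
      intro t
      constructor
      · intro ht
        refine hdet t ?_
        rw [← hdetev]
        have h2 : eval t (M.charpoly.coeff 0) = 0 := by
          rw [← hfg, Polynomial.mul_coeff_zero, map_mul, ht, zero_mul]
        rw [hc0, map_mul] at h2
        refine (mul_eq_zero.1 h2).resolve_left ?_
        simp
      · rintro rfl
        have h2 : f.map (eval (0 : Fin e → ZMod p)) ∣ Polynomial.X ^ e := by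
          rw [← hz, ← hfg, Polynomial.map_mul]; exact dvd_mul_right _ _
        obtain ⟨k, -, hk⟩ := (dvd_prime_pow Polynomial.prime_X _).1 h2
        have h3 := Polynomial.eq_of_monic_of_associated (hf.map _) (Polynomial.monic_X_pow k) hk
        have h4 : k ≠ 0 := by
          rintro rfl
          have h5 := hf.natDegree_map (eval (0 : Fin e → ZMod p))
          rw [h3] at h5
          simp at h5
          exact hf1 (hf.natDegree_eq_zero.1 h5.symm)
        rw [← Polynomial.coeff_map, h3]
        simp [Ne.symm h4]
    have h6 : Fintype.card {x : Fin e → ZMod p // eval x (f.coeff 0) = 0} = 1 := by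
      rw [Fintype.card_eq_one_iff]
      exact ⟨⟨0, (hzero 0).2 rfl⟩, fun y => Subtype.ext ((hzero _).1 y.2)⟩
    rw [h6] at h1
    exact (Fact.out : p.Prime).one_lt.ne' (Nat.dvd_one.1 h1)
  have hχ1 : M.charpoly ≠ 1 := by
    intro hc
    have := M.charpoly_natDegree_eq_dim
    rw [hc] at this
    simp at this
    omega
  rw [Polynomial.irreducible_of_monic hmon hχ1]
  intro f g hf hg hfg
  by_contra hc
  push Not at hc
  have k1 := key f g hf hg hfg hc.1
  have k2 := key g f hg hf (by rw [mul_comm, hfg]) hc.2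
  have k3 : f.coeff 0 * g.coeff 0 = (-1) ^ e * M.det := by
    rw [← hc0, ← hfg, Polynomial.mul_coeff_zero]
  have k4 : f.coeff 0 * g.coeff 0 ≠ 0 := by
    rw [k3]; exact mul_ne_zero (pow_ne_zero _ (neg_ne_zero.2 one_ne_zero)) hne
  have k5 := totalDegree_mul_of_isDomain (left_ne_zero_of_mul k4) (right_ne_zero_of_mul k4)
  have k6 : ((-1) ^ e * M.det).totalDegree ≤ e := by
    rcases neg_one_pow_eq_or (MvPolynomial (Fin e) (ZMod p)) e with h | h
    · rwa [h, one_mul]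
    · rwa [h, neg_one_mul, totalDegree_neg]
  rw [← k3, k5] at k6
  omega

open MvPolynomial in
theorem spread_comm_mat {p e : ℕ} [Fact p.Prime] (he : 0 < e)
    (S : Submodule (ZMod p) (Matrix (Fin e) (Fin e) (ZMod p)))
    (hdim : Module.finrank (ZMod p) S = e) (h1 : 1 ∈ S)
    (hJ : ∀ a ∈ S, ∀ b ∈ S, a * b * a ∈ S) (hdet : ∀ a ∈ S, a.det = 0 → a = 0) :
    ∀ a ∈ S, ∀ b ∈ S, a * b = b * a := by
  let B := Module.finBasisOfFinrankEq (ZMod p) S hdim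
  have hB : ∀ t : Fin e → ZMod p, (∑ i, t i • (B i : Matrix (Fin e) (Fin e) (ZMod p))) =
      ((∑ i, t i • B i : S) : Matrix (Fin e) (Fin e) (ZMod p)) := by
    intro t; simp
  have hirr := generic_irred he (fun i => (B i : Matrix (Fin e) (Fin e) (ZMod p))) (by
    intro t ht
    rw [hB] at ht
    have h2 := hdet _ (Subtype.mem _) ht
    have h3 : (∑ i, t i • B i : S) = 0 := Subtype.ext h2
    funext i
    exact Fintype.linearIndependent_iff.1 B.linearIndependent t h3 i)
  let Q := MvPolynomial (Fin e) (ZMod p)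
  let K := FractionRing Q
  let M : Matrix (Fin e) (Fin e) Q :=
    ∑ i, (X i : Q) • (B i : Matrix (Fin e) (Fin e) (ZMod p)).map (C : ZMod p →+* Q)
  change Irreducible M.charpoly at hirr
  have hirr2 := (M.charpoly_monic.irreducible_iff_irreducible_map_fraction_map (K := K)).1 hirr
  rw [← Matrix.charpoly_map] at hirr2
  let ψ : ZMod p →+* K := (algebraMap Q K).comp C
  have hψ : Function.Injective ψ := ψ.injective
  let φ : Matrix (Fin e) (Fin e) (ZMod p) →+* Matrix (Fin e) (Fin e) K := ψ.mapMatrix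
  have hφ : Function.Injective φ := Matrix.map_injective hψ
  let T : Set (Matrix (Fin e) (Fin e) K) := φ '' S
  let S' := Submodule.span K T
  let x : Matrix (Fin e) (Fin e) K := M.map (algebraMap Q K)
  have hx : x = ∑ i, (algebraMap Q K (X i)) • φ (B i) := by
    ext i j
    simp [x, M, φ, ψ, Matrix.sum_apply]
    refine Finset.sum_congr rfl fun c _ => ?_
    exact (Algebra.smul_def _ _).symm
  have hxS : x ∈ S' := by
    rw [hx]
    refine Submodule.sum_mem _ fun i _ => Submodule.smul_mem _ _ (Submodule.subset_span ?_)
    exact ⟨B i, (B i).2, rfl⟩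
  have hJ' := jordan_span (K := K) T
    (by rintro _ ⟨a, ha, rfl⟩ _ ⟨b, hb, rfl⟩; exact ⟨a + b, S.add_mem ha hb, map_add _ _ _⟩)
    (by rintro _ ⟨a, ha, rfl⟩; exact ⟨-a, S.neg_mem ha, map_neg _ _⟩)
    (by rintro _ ⟨a, ha, rfl⟩ _ ⟨b, hb, rfl⟩; exact ⟨a * b * a, hJ a ha b hb, by simp⟩)
  have hpow := jordan_pow S' hJ' (Submodule.subset_span ⟨1, h1, map_one _⟩) hxS
  have hS'le : S' ≤ Submodule.span K (Set.range fun i => φ (B i)) := by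
    refine Submodule.span_le.2 ?_
    rintro _ ⟨a, ha, rfl⟩
    have h2 := B.sum_repr ⟨a, ha⟩
    have h3 : a = ∑ i, B.repr ⟨a, ha⟩ i • (B i : Matrix (Fin e) (Fin e) (ZMod p)) := by
      rw [hB, h2]
    rw [h3, map_sum]
    refine Submodule.sum_mem _ fun i _ => ?_
    have h4 : ∀ (c : ZMod p) (A : Matrix (Fin e) (Fin e) (ZMod p)), φ (c • A) = ψ c • φ A := by
      intro c A; ext i j; simp [φ]
    rw [h4]
    exact Submodule.smul_mem _ _ (Submodule.subset_span ⟨i, rfl⟩)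
  have hfr : Module.finrank K S' ≤ e := by
    refine (Submodule.finrank_mono hS'le).trans ?_
    exact (finrank_range_le_card (R := K) (fun i => φ (B i))).trans (by simp)
  have : NeZero e := ⟨he.ne'⟩
  have hmin : minpoly K x = x.charpoly := by
    have h2 := minpoly.eq_of_irreducible_of_monic hirr2 (Matrix.aeval_self_charpoly x)
      (Matrix.charpoly_monic x)
    exact h2.symm
  have hli := linearIndependent_pow (K := K) x
  have hdeg : (minpoly K x).natDegree = e := by
    rw [hmin, Matrix.charpoly_natDegree_eq_dim, Fintype.card_fin]
  let W := Submodule.span K (Set.range fun i : Fin (minpoly K x).natDegree => x ^ (i : ℕ))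
  have hWS : W ≤ S' := by
    refine Submodule.span_le.2 ?_
    rintro _ ⟨i, rfl⟩
    exact (hpow i).1
  have hWd : Module.finrank K W = e := by
    exact (finrank_span_eq_card hli).trans (by simp [hdeg])
  have hWe : W = S' := Submodule.eq_of_le_of_finrank_le hWS (by rw [hWd]; exact hfr)
  have hWa : ∀ w ∈ W, w ∈ Algebra.adjoin K {x} := by
    intro w hw
    refine Submodule.span_induction (p := fun w _ => w ∈ Algebra.adjoin K {x}) ?_ ?_ ?_ ?_ hw
    · rintro _ ⟨i, rfl⟩
      exact Subalgebra.pow_mem _ (Algebra.self_mem_adjoin_singleton K x) _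
    · exact Subalgebra.zero_mem _
    · intro a b _ _ ha hb; exact Subalgebra.add_mem _ ha hb
    · intro k a _ ha; exact Subalgebra.smul_mem _ ha k
  intro a ha b hb
  apply hφ
  rw [map_mul, map_mul]
  have ha' := hWa (φ a) (by rw [hWe]; exact Submodule.subset_span ⟨a, ha, rfl⟩)
  have hb' := hWa (φ b) (by rw [hWe]; exact Submodule.subset_span ⟨b, hb, rfl⟩)
  rw [Algebra.adjoin_singleton_eq_range_aeval] at ha' hb'
  obtain ⟨u, hu⟩ := ha'
  obtain ⟨v, hv⟩ := hb'
  rw [← hu, ← hv]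
  change Polynomial.aeval x u * Polynomial.aeval x v = Polynomial.aeval x v * Polynomial.aeval x u
  rw [← map_mul, ← map_mul, mul_comm]

end alg
end AF

namespace AF

section spr

/-- Spread set axioms -/
structure Spread {V : Type*} [AddCommGroup V] (S : AddSubgroup (AddMonoid.End V)) : Prop where
  one : 1 ∈ S
  inj : ∀ a ∈ S, ∀ v, v ≠ 0 → a v = 0 → a = 0
  trans : ∀ v w : V, v ≠ 0 → ∃ a ∈ S, a v = w
  inv : ∀ a ∈ S, a ≠ 0 → ∃ a' : AddMonoid.End V, a * a' = 1 ∧ a' * a = 1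
  hua : ∀ a ∈ S, ∀ b ∈ S, ∀ a' b' : AddMonoid.End V, a * a' = 1 → a' * a = 1 → b * b' = 1 →
    b' * b = 1 → a' + b' = 0 ∨ ∃ c ∈ S, c * (a' + b') = 1

variable {V : Type*} [AddCommGroup V] [Nontrivial V] {S : AddSubgroup (AddMonoid.End V)}

theorem Spread.aca (hS : Spread S) {a c c' : AddMonoid.End V} (ha : a ∈ S) (hc : c ∈ S)
    (h1 : c * c' = 1) (h2 : c' * c = 1) : a * c' * a ∈ S := by
  by_cases a0 : a = 0
  · subst a0; simp
  by_cases hca : c - a = 0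
  · rw [sub_eq_zero] at hca; subst hca; rw [h1, one_mul]; exact hc
  obtain ⟨a', a1, a2⟩ := hS.inv a ha a0
  have hd : c - a ∈ S := S.sub_mem hc ha
  obtain ⟨d', d1, d2⟩ := hS.inv _ hd hca
  have e1 : a' + d' = a' * c * d' := by
    calc a' + d' = a' * ((c - a) * d') + (a' * a) * d' := by rw [d1, a2, mul_one, one_mul]
      _ = a' * c * d' := by noncomm_ring
  have e2 : (a' * c * d') * ((c - a) * c' * a) = 1 := by
    calc (a' * c * d') * ((c - a) * c' * a) = a' * c * (d' * (c - a)) * c' * a := by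
          simp only [mul_assoc]
      _ = a' * (c * c') * a := by rw [d2]; simp only [mul_assoc, mul_one]
      _ = 1 := by rw [h1, mul_one, a2]
  rcases hS.hua a ha _ hd a' d' a1 a2 d1 d2 with h | ⟨x, hx, h⟩
  · rw [e1] at h
    rw [h, zero_mul] at e2
    obtain ⟨v, hv⟩ := exists_ne (0 : V)
    have := congrArg (fun f : AddMonoid.End V => f v) e2
    exact absurd this.symm hv
  · rw [e1] at h
    have e3 : x = (c - a) * c' * a := by
      calc x = x * ((a' * c * d') * ((c - a) * c' * a)) := by rw [e2, mul_one]
        _ = (c - a) * c' * a := by rw [← mul_assoc, h, one_mul]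
    have e4 : a * c' * a = a - x := by
      rw [e3, sub_mul, h1, sub_mul, one_mul]; abel
    rw [e4]
    exact S.sub_mem ha hx

theorem Spread.aba (hS : Spread S) {a b : AddMonoid.End V} (ha : a ∈ S) (hb : b ∈ S) :
    a * b * a ∈ S := by
  by_cases b0 : b = 0
  · subst b0; simp
  obtain ⟨b', b1, b2⟩ := hS.inv b hb b0
  have h := hS.aca hS.one hb b1 b2
  rw [one_mul, mul_one] at h
  exact hS.aca ha h b2 b1

theorem Spread.comm0 [Finite V] {p : ℕ} [Fact p.Prime] [Module (ZMod p) V]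
    (hS : Spread S) : ∀ a ∈ S, ∀ b ∈ S, a * b = b * a := by
  have hp : p.Prime := Fact.out
  have hfin : Module.Finite (ZMod p) V := Module.Finite.of_finite
  let e := Module.finrank (ZMod p) V
  let B : Module.Basis (Fin e) (ZMod p) V :=
    Module.finBasisOfFinrankEq (ZMod p) V rfl
  let Φ : AddMonoid.End V →+* Matrix (Fin e) (Fin e) (ZMod p) :=
    { toFun := fun a => LinearMap.toMatrixAlgEquiv B (AddMonoidHom.toZModLinearMap p a)
      map_one' := by
        rw [← map_one (LinearMap.toMatrixAlgEquiv B)]; congr 1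
      map_mul' := fun a b => by
        rw [← map_mul (LinearMap.toMatrixAlgEquiv B)]; congr 1
      map_zero' := by
        rw [← map_zero (LinearMap.toMatrixAlgEquiv B)]; congr 1
      map_add' := fun a b => by
        rw [← map_add (LinearMap.toMatrixAlgEquiv B)]; congr 1 }
  have hΦ : Function.Injective Φ := by
    intro a b hab
    have h1 := (LinearMap.toMatrixAlgEquiv B).injective hab
    ext v
    exact congrArg (fun f : V →ₗ[ZMod p] V => f v) h1
  let T : Submodule (ZMod p) (Matrix (Fin e) (Fin e) (ZMod p)) :=
    AddSubgroup.toZModSubmodule p (S.map (Φ : AddMonoid.End V →+ _))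
  have hT : ∀ x, x ∈ T ↔ ∃ a ∈ S, Φ a = x := fun x => Iff.rfl
  have he : 0 < e := Module.finrank_pos
  obtain ⟨v, hv⟩ := exists_ne (0 : V)
  have hcard : Nat.card T = Nat.card V := by
    refine (Nat.card_congr (Equiv.ofBijective (fun a : S => (⟨Φ a, a, a.2, rfl⟩ : T)) ?_)).symm.trans
      (Nat.card_congr (Equiv.ofBijective (fun a : S => (a : AddMonoid.End V) v) ?_))
    · constructor
      · intro a b h
        exact Subtype.ext (hΦ (congrArg Subtype.val h))
      · rintro ⟨_, a, ha, rfl⟩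
        exact ⟨⟨a, ha⟩, rfl⟩
    · constructor
      · intro a b h
        have h1 := hS.inj _ (S.sub_mem a.2 b.2) v hv (by
          change (a : AddMonoid.End V) v - (b : AddMonoid.End V) v = 0
          exact sub_eq_zero.2 h)
        exact Subtype.ext (sub_eq_zero.1 h1)
      · intro w
        obtain ⟨a, ha, h⟩ := hS.trans v w hv
        exact ⟨⟨a, ha⟩, h⟩
  have hdim : Module.finrank (ZMod p) T = e := by
    have h1 := Module.natCard_eq_pow_finrank (K := ZMod p) (V := T)
    have h2 := Module.natCard_eq_pow_finrank (K := ZMod p) (V := V)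
    rw [hcard, h2, Nat.card_zmod] at h1
    exact (Nat.pow_right_injective hp.two_le h1).symm
  have key := spread_comm_mat he T hdim ⟨1, hS.one, map_one Φ⟩
    (by
      rintro _ ⟨a, ha, rfl⟩ _ ⟨b, hb, rfl⟩
      exact ⟨a * b * a, hS.aba ha hb, by simp⟩)
    (by
      rintro _ ⟨a, ha, rfl⟩ h
      by_contra hc
      have a0 : a ≠ 0 := by rintro rfl; exact hc (map_zero Φ)
      obtain ⟨a', a1, a2⟩ := hS.inv a ha a0
      have h3 : (Φ a).det * (Φ a').det = 1 := by
        rw [← Matrix.det_mul, ← map_mul, a1, map_one, Matrix.det_one]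
      have h4 : (Φ a).det = 0 := h
      rw [h4, zero_mul] at h3
      exact zero_ne_one h3)
  intro a ha b hb
  apply hΦ
  rw [map_mul, map_mul]
  exact key _ ⟨a, ha, rfl⟩ _ ⟨b, hb, rfl⟩

theorem Spread.comm [Finite V] {p : ℕ} (hp : p.Prime) (hexp : ∀ v : V, p • v = 0)
    (hS : Spread S) : ∀ a ∈ S, ∀ b ∈ S, a * b = b * a := by
  have : Fact p.Prime := ⟨hp⟩
  let _ : Module (ZMod p) V := AddCommGroup.zmodModule hexp
  exact hS.comm0 (p := p)

theorem Spread.mul [Finite V] {p : ℕ} (hp : p.Prime) (hexp : ∀ v : V, p • v = 0)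
    (hS : Spread S) : ∀ a ∈ S, ∀ b ∈ S, a * b ∈ S := by
  have hc := hS.comm hp hexp
  intro a ha b hb
  obtain ⟨v, hv⟩ := exists_ne (0 : V)
  obtain ⟨c, c1, c2⟩ := hS.trans v ((a * b) v) hv
  have : a * b = c := by
    ext w
    obtain ⟨d, d1, rfl⟩ := hS.trans v w hv
    have h1 : a * b * d = d * (a * b) := by
      rw [mul_assoc, hc b hb d d1, ← mul_assoc, hc a ha d d1, mul_assoc]
    calc (a * b) (d v) = (a * b * d) v := rfl
      _ = (d * (a * b)) v := by rw [h1]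
      _ = d ((a * b) v) := rfl
      _ = d (c v) := by rw [c2]
      _ = (d * c) v := rfl
      _ = (c * d) v := by rw [hc d d1 c c1]
      _ = c (d v) := rfl
  rw [this]; exact c1

/-- The field of a spread set -/
theorem Spread.field {V : Type} [AddCommGroup V] [Nontrivial V]
    {S : AddSubgroup (AddMonoid.End V)} [Finite V] {p : ℕ} (hp : p.Prime)
    (hexp : ∀ v : V, p • v = 0) (hS : Spread S) :
    ∃ (F : Type) (_ : Field F) (_ : Finite F) (ι : F → AddMonoid.End V) (ev : F → V),
      Function.Injective ι ∧ (∀ a, a ∈ S ↔ ∃ c, ι c = a) ∧ Function.Bijective ev ∧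
      (∀ c d, ev (c * d) = ι c (ev d)) ∧ (∀ c d, ev (c - d) = ev c - ev d) := by
  let R : Subring (AddMonoid.End V) :=
    { S with
      mul_mem' := fun {a b} ha hb => hS.mul hp hexp a ha b hb
      one_mem' := hS.one }
  have hR : ∀ a, a ∈ R ↔ a ∈ S := fun a => Iff.rfl
  obtain ⟨v, hv⟩ := exists_ne (0 : V)
  have hf : IsField R :=
    { exists_pair_ne := ⟨0, 1, fun h => by
        have h1 := congrArg (fun f : R => (f : AddMonoid.End V) v) h
        exact hv h1.symm⟩
      mul_comm := fun a b => Subtype.ext (hS.comm hp hexp a a.2 b b.2)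
      mul_inv_cancel := fun {a} ha => by
        obtain ⟨a', a1, a2⟩ := hS.inv a a.2 (fun h => ha (Subtype.ext h))
        have h := hS.aca hS.one a.2 a1 a2
        rw [one_mul, mul_one] at h
        exact ⟨⟨a', h⟩, Subtype.ext a1⟩ }
  let _ : Field R := hf.toField
  have hb : Function.Bijective (fun a : R => (a : AddMonoid.End V) v) := by
    constructor
    · intro a b h
      have h1 := hS.inj _ (S.sub_mem a.2 b.2) v hv (by
          change (a : AddMonoid.End V) v - (b : AddMonoid.End V) v = 0
          exact sub_eq_zero.2 h)
      exact Subtype.ext (sub_eq_zero.1 h1)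
    · intro w
      obtain ⟨a, ha, h⟩ := hS.trans v w hv
      exact ⟨⟨a, ha⟩, h⟩
  refine ⟨R, hf.toField, Finite.of_injective _ hb.1, fun a => a, fun a => (a : AddMonoid.End V) v,
    Subtype.val_injective, fun a => ⟨fun h => ⟨⟨a, h⟩, rfl⟩, ?_⟩, hb, fun c d => rfl, fun c d => rfl⟩
  rintro ⟨c, rfl⟩; exact c.2

end spr
end AF

namespace AF

section vec
variable {P L : Type*} {I : P → L → Prop} {F : Type} [Field F]

theorem finrank_ker_dot {g : Fin 3 → F} (hg : g ≠ 0) :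
    Module.finrank F (LinearMap.ker (dotProductEquiv F (Fin 3) g)) = 2 := by
  have h1 : dotProductEquiv F (Fin 3) g ≠ 0 := by
    simpa using hg
  have h2 := Module.Dual.finrank_ker_add_one_of_ne_zero h1
  simp at h2
  exact h2

theorem desarg_of_vec (hP : PP I) (f : P → Fin 3 → F) (g : L → Fin 3 → F)
    (hf : ∀ p, f p ≠ 0) (hg : ∀ l, g l ≠ 0) (hI : ∀ p l, I p l ↔ g l ⬝ᵥ f p = 0)
    (hs : ∀ v : Fin 3 → F, v ≠ 0 → ∃ (p : P) (c : F), v = c • f p)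
    (hln : ∀ p q : P, p ≠ q → ∃ l, I p l ∧ ¬ I q l)
    (hpt : ∀ l m : L, l ≠ m → ∃ p, I p l ∧ ¬ I p m) :
    IsDesarguesianOver F I := by
  let σ : P → {V : Submodule F (Fin 3 → F) // Module.finrank F V = 1} :=
    fun p => ⟨Submodule.span F {f p}, finrank_span_singleton (hf p)⟩
  let τ : L → {W : Submodule F (Fin 3 → F) // Module.finrank F W = 2} :=
    fun l => ⟨LinearMap.ker (dotProductEquiv F (Fin 3) (g l)), finrank_ker_dot (hg l)⟩
  have hστ : ∀ p l, I p l ↔ (σ p).1 ≤ (τ l).1 := by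
    intro p l
    simp only [σ, τ]
    rw [Submodule.span_singleton_le_iff_mem, LinearMap.mem_ker, dotProductEquiv_apply_apply]
    exact hI p l
  have hσi : Function.Injective σ := by
    intro p q h
    by_contra hc
    obtain ⟨l, h1, h2⟩ := hln p q hc
    rw [hστ] at h1 h2
    rw [h] at h1
    exact h2 h1
  have hτi : Function.Injective τ := by
    intro p q h
    by_contra hc
    obtain ⟨l, h1, h2⟩ := hpt p q hc
    rw [hστ] at h1 h2
    rw [h] at h1
    exact h2 h1
  have hσs : Function.Surjective σ := by
    rintro ⟨V, hV⟩
    obtain ⟨v, hv, hv0⟩ := V.ne_bot_iff.1 (by rintro rfl; simp at hV)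
    obtain ⟨p, c, hc⟩ := hs v hv0
    refine ⟨p, Subtype.ext ?_⟩
    have hc0 : c ≠ 0 := by rintro rfl; simp at hc; exact hv0 hc
    have h1 : f p ∈ V := by
      have : f p = c⁻¹ • v := by rw [hc, smul_smul, inv_mul_cancel₀ hc0, one_smul]
      rw [this]; exact V.smul_mem _ hv
    refine Submodule.eq_of_le_of_finrank_eq ?_ ?_
    · rw [Submodule.span_singleton_le_iff_mem]; exact h1
    · rw [hV]; exact finrank_span_singleton (hf p)
  have hτs : Function.Surjective τ := by
    rintro ⟨W, hW⟩
    obtain ⟨v, hv, hv0⟩ := W.ne_bot_iff.1 (by rintro rfl; simp at hW)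
    obtain ⟨w, hw, hwv⟩ : ∃ w ∈ W, w ∉ Submodule.span F {v} := by
      by_contra hc
      push Not at hc
      have h1 := Submodule.finrank_mono (show W ≤ Submodule.span F {v} from hc)
      rw [finrank_span_singleton hv0, hW] at h1
      omega
    have hw0 : w ≠ 0 := by rintro rfl; exact hwv (Submodule.zero_mem _)
    obtain ⟨p, hp⟩ := hσs ⟨Submodule.span F {v}, finrank_span_singleton hv0⟩
    obtain ⟨q, hq⟩ := hσs ⟨Submodule.span F {w}, finrank_span_singleton hw0⟩
    obtain ⟨l, l1, l2⟩ := hP.ln p q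
    refine ⟨l, Subtype.ext ?_⟩
    rw [hστ, hp, Submodule.span_singleton_le_iff_mem] at l1
    rw [hστ, hq, Submodule.span_singleton_le_iff_mem] at l2
    have h3 : Module.finrank F (Submodule.span F {v, w}) = 2 := by
      have hli : LinearIndependent F ![v, w] := by
        rw [LinearIndependent.pair_iff' hv0]
        intro a ha
        exact hwv (Submodule.mem_span_singleton.2 ⟨a, ha⟩)
      have h6 : Set.range ![v, w] = {v, w} := by
        rw [Matrix.range_cons, Matrix.range_cons, Matrix.range_empty, Set.union_empty]; rfl
      rw [← h6]
      exact (finrank_span_eq_card hli).trans (by simp)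
    have h4 : Submodule.span F {v, w} = W := by
      refine Submodule.eq_of_le_of_finrank_eq (Submodule.span_le.2 ?_) (h3.trans hW.symm)
      rintro x (rfl | rfl)
      · exact hv
      · exact hw
    have h5 : Submodule.span F {v, w} = (τ l).1 := by
      refine Submodule.eq_of_le_of_finrank_eq (Submodule.span_le.2 ?_) (h3.trans (τ l).2.symm)
      rintro x (rfl | rfl)
      · exact l1
      · exact l2
    rw [← h5, h4]
  exact ⟨Equiv.ofBijective σ ⟨hσi, hσs⟩, Equiv.ofBijective τ ⟨hτi, hτs⟩, hστ⟩

theorem coord [Finite P] [Finite L] {n : ℕ} (hP : Plane I n) {l : L} {Xi : P} (hXi : I Xi l)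
    (x y s : P → F)
    (hxy : ∀ a b, ∃ p, ¬ I p l ∧ x p = a ∧ y p = b)
    (hs : ∀ c, ∃ p, I p l ∧ p ≠ Xi ∧ s p = c)
    (hinf : ∀ p q m, ¬ I p l → ¬ I q l → I q m → I Xi m → (I p m ↔ x p = x q))
    (hsl : ∀ p q X m, ¬ I p l → ¬ I q l → I X l → X ≠ Xi → I X m → I q m →
      (I p m ↔ s X * (x p - x q) = y p - y q)) : IsDesarguesianOver F I := by
  classical
  have hsinj : ∀ X Y, I X l → I Y l → X ≠ Xi → Y ≠ Xi → s X = s Y → X = Y := by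
    intro X Y hX hY hXi hYi hXY
    by_contra hc
    obtain ⟨q, hq, -⟩ := hP.pt_off l l
    obtain ⟨m, m1, m2⟩ := hP.ln q X
    obtain ⟨m', k1, k2⟩ := hP.ln q Y
    obtain ⟨r, r1, r2, r3⟩ := hP.pt_on m q X
    have hml : m ≠ l := by rintro rfl; exact hq m1
    have hr : ¬ I r l := fun h => r3 (hP.eqP hml r1 h m2 hX)
    have h1 := (hsl r q X m hr hq hX hXi m2 m1).1 r1
    rw [hXY] at h1
    have h2 := (hsl r q Y m' hr hq hY hYi k2 k1).2 h1
    have h3 := hP.eqL r2 r1 m1 h2 k1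
    subst h3
    exact hc (hP.eqP hml m2 hX k2 hY)
  have hq : ∀ m : L, ∃ q, m ≠ l → (I q m ∧ ¬ I q l) := by
    intro m
    by_cases hm : m = l
    · obtain ⟨q, -⟩ := hP.line_pt m
      exact ⟨q, fun h => absurd hm h⟩
    · obtain ⟨q, h⟩ := hP.pt_ne_ln hm
      exact ⟨q, fun _ => h⟩
  choose q hq using hq
  have hX : ∀ m : L, ∃ X, I X m ∧ I X l := fun m => hP.pt m l
  choose X hX1 hX2 using hX
  let f : P → Fin 3 → F := fun p => if I p l then (if p = Xi then ![0, 1, 0] else ![1, s p, 0])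
    else ![x p, y p, 1]
  let g : L → Fin 3 → F := fun m => if m = l then ![0, 0, 1] else
    if X m = Xi then ![1, 0, - x (q m)] else ![s (X m), -1, y (q m) - s (X m) * x (q m)]
  refine desarg_of_vec hP.toPP f g ?_ ?_ ?_ ?_ (fun p q h => hP.ln_ne_pt h) (fun p q h => hP.pt_ne_ln h)
  · intro p hc
    simp only [f] at hc
    split_ifs at hc
    · simpa using congrFun hc 1
    · simpa using congrFun hc 0
    · simpa using congrFun hc 2
  · intro p hc
    simp only [g] at hc
    split_ifs at hc
    · simpa using congrFun hc 2
    · simpa using congrFun hc 0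
    · simpa using congrFun hc 1
  · intro p m
    by_cases hm : m = l
    · subst hm
      by_cases hp : I p m
      · by_cases hpx : p = Xi <;> simp [f, g, hp, hpx, hXi, dotProduct, Fin.sum_univ_three]
      · simp [f, g, hp, dotProduct, Fin.sum_univ_three]
    obtain ⟨q1, q2⟩ := hq m hm
    by_cases hx : X m = Xi
    · have hXm : I Xi m := by rw [← hx]; exact hX1 m
      by_cases hp : I p l
      · by_cases hpx : p = Xi
        · subst hpx
          simp [f, g, hp, hm, hx, hXm, dotProduct, Fin.sum_univ_three]
        · have : ¬ I p m := fun h => hpx (hP.eqP hm h hp hXm hXi)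
          simp [f, g, hp, hpx, hm, hx, this, dotProduct, Fin.sum_univ_three]
      · rw [hinf p (q m) m hp q2 q1 hXm]
        simp [f, g, hp, hm, hx, dotProduct, Fin.sum_univ_three]
        exact (sub_eq_zero (a := x p)).symm.trans (by rw [sub_eq_add_neg])
    · by_cases hp : I p l
      · by_cases hpx : p = Xi
        · subst hpx
          have : ¬ I p m := fun h => hx (hP.eqP hm (hX1 m) (hX2 m) h hp)
          simp [f, g, hp, hm, hx, this, dotProduct, Fin.sum_univ_three]
        · have h1 : I p m ↔ s (X m) = s p := by
            constructor
            · intro h; rw [hP.eqP hm (hX1 m) (hX2 m) h hp]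
            · intro h
              rw [← hsinj _ _ (hX2 m) hp hx hpx h]; exact hX1 m
          rw [h1]
          simp [f, g, hp, hpx, hm, hx, dotProduct, Fin.sum_univ_three]
          exact (sub_eq_zero (b := s p)).symm.trans (by rw [sub_eq_add_neg])
      · rw [hsl p (q m) (X m) m hp q2 (hX2 m) hx (hX1 m) q1]
        simp [f, g, hp, hm, hx, dotProduct, Fin.sum_univ_three]
        constructor
        · intro h; linear_combination h
        · intro h; linear_combination h
  · intro v hv
    by_cases h2 : v 2 = 0
    · by_cases h0 : v 0 = 0
      · refine ⟨Xi, v 1, ?_⟩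
        ext i; fin_cases i <;> simp [f, hXi, h0, h2]
      · obtain ⟨p, p1, p2, p3⟩ := hs ((v 0)⁻¹ * v 1)
        refine ⟨p, v 0, ?_⟩
        ext i; fin_cases i <;> simp [f, p1, p2, p3, h0, h2]
    · obtain ⟨p, p1, p2, p3⟩ := hxy ((v 2)⁻¹ * v 0) ((v 2)⁻¹ * v 1)
      refine ⟨p, v 2, ?_⟩
      ext i; fin_cases i <;> simp [f, p1, p2, p3, h2]

/-- Part 6 -/
theorem desarg_aft (h : IsDesarguesianOver F I) (p : P) (M : L) (p' : P) (M' : L)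
    (h1 : ¬ I p M) (h2 : ¬ I p' M') : ∃ (s : Equiv.Perm P) (t : Equiv.Perm L),
        (∀ (q : P) (N : L), I q N ↔ I (s q) (t N)) ∧ s p = p' ∧ t M = M' := by
  obtain ⟨σ, τ, hI⟩ := h
  have hc : ∀ p M, ¬ I p M → IsCompl (σ p).1 (τ M).1 := by
    intro p M h
    rw [hI] at h
    have hd : Disjoint (σ p).1 (τ M).1 := by
      obtain ⟨v, hv0, hv⟩ := finrank_eq_one_iff'.1 (σ p).2
      rw [Submodule.disjoint_def]
      intro w w1 w2
      obtain ⟨c, hc⟩ := hv ⟨w, w1⟩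
      by_cases c0 : c = 0
      · subst c0
        rw [zero_smul] at hc
        exact (congrArg Subtype.val hc).symm
      · exfalso
        apply h
        intro u hu
        obtain ⟨d, hd⟩ := hv ⟨u, hu⟩
        have e1 : c • (v : Fin 3 → F) = w := congrArg Subtype.val hc
        have e2 : d • (v : Fin 3 → F) = u := congrArg Subtype.val hd
        have e3 : u = (d * c⁻¹) • w := by
          rw [← e1, smul_smul, mul_assoc, inv_mul_cancel₀ c0, mul_one, e2]
        rw [e3]
        exact Submodule.smul_mem _ _ w2
    refine ⟨hd, ?_⟩
    rw [codisjoint_iff]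
    refine Submodule.eq_top_of_finrank_eq ?_
    have h5 := Submodule.finrank_sup_add_finrank_inf_eq (σ p).1 (τ M).1
    rw [disjoint_iff.1 hd, (σ p).2, (τ M).2] at h5
    simp at h5
    simp [h5]
  let e1 := Submodule.prodEquivOfIsCompl _ _ (hc p M h1)
  let e2 := Submodule.prodEquivOfIsCompl _ _ (hc p' M' h2)
  let a : (σ p).1 ≃ₗ[F] (σ p').1 := LinearEquiv.ofFinrankEq _ _ ((σ p).2.trans (σ p').2.symm)
  let b : (τ M).1 ≃ₗ[F] (τ M').1 := LinearEquiv.ofFinrankEq _ _ ((τ M).2.trans (τ M').2.symm)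
  let φ : (Fin 3 → F) ≃ₗ[F] (Fin 3 → F) := (e1.symm.trans (a.prodCongr b)).trans e2
  have hφ1 : (σ p).1.map φ.toLinearMap ≤ (σ p').1 := by
    rintro _ ⟨v, hv, rfl⟩
    have : e1.symm v = (⟨v, hv⟩, 0) := Submodule.prodEquivOfIsCompl_symm_apply_left _ _ _ ⟨v, hv⟩
    simp [φ, this, e2]
  have hφ2 : (τ M).1.map φ.toLinearMap ≤ (τ M').1 := by
    rintro _ ⟨v, hv, rfl⟩
    have : e1.symm v = (0, ⟨v, hv⟩) := Submodule.prodEquivOfIsCompl_symm_apply_right _ _ _ ⟨v, hv⟩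
    simp [φ, this, e2]
  have hk : ∀ (V : Submodule F (Fin 3 → F)), Module.finrank F (V.map φ.toLinearMap) =
      Module.finrank F V := fun V => LinearEquiv.finrank_map_eq φ V
  let A : ∀ k, {V : Submodule F (Fin 3 → F) // Module.finrank F V = k} ≃
      {V : Submodule F (Fin 3 → F) // Module.finrank F V = k} := fun k =>
    (Submodule.orderIsoMapComap φ).toEquiv.subtypeEquiv (fun V => by
      rw [← hk V]; rfl)
  have hA : ∀ k V, ((A k V).1 : Submodule F (Fin 3 → F)) = V.1.map φ.toLinearMap := fun k V => rfl
  refine ⟨(σ.trans (A 1)).trans σ.symm, (τ.trans (A 2)).trans τ.symm, ?_, ?_, ?_⟩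
  · intro q N
    rw [hI, hI]
    simp only [Equiv.trans_apply, Equiv.apply_symm_apply, hA]
    exact (Submodule.map_le_map_iff_of_injective φ.injective _ _).symm
  · simp only [Equiv.trans_apply]
    rw [Equiv.symm_apply_eq]
    apply Subtype.ext
    refine Submodule.eq_of_le_of_finrank_eq hφ1 ?_
    exact (A 1 (σ p)).2.trans (σ p').2.symm
  · simp only [Equiv.trans_apply]
    rw [Equiv.symm_apply_eq]
    apply Subtype.ext
    refine Submodule.eq_of_le_of_finrank_eq hφ2 ?_
    exact (A 2 (τ M)).2.trans (τ M').2.symm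
end vec
end AF

namespace AF

section tr

/-- translation group with a congruence partition and shears -/
structure Trl {T Λ : Type*} [AddCommGroup T] (E : Λ → AddSubgroup T) : Prop where
  cover : ∀ t, ∃ X, t ∈ E X
  disj : ∀ X Y, X ≠ Y → ∀ t, t ∈ E X → t ∈ E Y → t = 0
  sum : ∀ X Y, X ≠ Y → ∀ t, ∃ a ∈ E X, t - a ∈ E Y
  shear : ∀ A B Y, A ≠ B → Y ≠ A → ∃ (γ : T →+ T) (π : Λ → Λ), (∀ X, X ≠ A → π X ≠ A) ∧
    (∀ b ∈ E A, γ b = b) ∧ (∀ X, ∀ t ∈ E X, γ t ∈ E (π X)) ∧ π B = Y ∧ (∀ a ∈ E B, γ a - a ∈ E A)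

variable {T Λ : Type*} [AddCommGroup T] {E : Λ → AddSubgroup T}

theorem Trl.eqU (hE : Trl E) {X Y : Λ} (hXY : X ≠ Y) {t a b : T} (ha : a ∈ E X) (ha' : t - a ∈ E Y)
    (hb : b ∈ E X) (hb' : t - b ∈ E Y) : a = b := by
  have h1 : b - a = 0 := hE.disj X Y hXY _ ((E X).sub_mem hb ha) (by
    have := (E Y).sub_mem ha' hb'
    have e : t - a - (t - b) = b - a := by abel
    rwa [e] at this)
  exact (sub_eq_zero.1 h1).symm

theorem Trl.exists_pr (hE : Trl E) : ∃ pr : Λ → Λ → T →+ T, ∀ X Y, X ≠ Y → ∀ t,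
    pr X Y t ∈ E X ∧ t - pr X Y t ∈ E Y := by
  classical
  have : ∀ X Y, ∃ f : T →+ T, X ≠ Y → ∀ t, f t ∈ E X ∧ t - f t ∈ E Y := by
    intro X Y
    by_cases hXY : X = Y
    · exact ⟨0, fun h => absurd hXY h⟩
    choose f h1 h2 using hE.sum X Y hXY
    refine ⟨AddMonoidHom.mk' f ?_, fun _ t => ⟨h1 t, h2 t⟩⟩
    intro a b
    refine hE.eqU hXY (h1 _) (h2 _) ((E X).add_mem (h1 a) (h1 b)) ?_
    have e : a + b - (f a + f b) = (a - f a) + (b - f b) := by abel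
    rw [e]
    exact (E Y).add_mem (h2 a) (h2 b)
  choose pr h using this
  exact ⟨pr, h⟩

variable {pr : Λ → Λ → T →+ T}

/-- projections -/
def IsPr (E : Λ → AddSubgroup T) (pr : Λ → Λ → T →+ T) : Prop := ∀ X Y, X ≠ Y → ∀ t,
    pr X Y t ∈ E X ∧ t - pr X Y t ∈ E Y

theorem Trl.pr_eq (hE : Trl E) (hpr : IsPr E pr) {X Y : Λ} (hXY : X ≠ Y) {t a : T} (ha : a ∈ E X)
    (ha' : t - a ∈ E Y) : pr X Y t = a := hE.eqU hXY (hpr X Y hXY t).1 (hpr X Y hXY t).2 ha ha'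

theorem Trl.pr_add (hE : Trl E) (hpr : IsPr E pr) {A B X Y : Λ} (hAB : A ≠ B) (hX : X ≠ A)
    (hY : Y ≠ A) : ∃ Z, Z ≠ A ∧ ∀ v ∈ E B, pr A Z v = pr A X v + pr A Y v := by
  obtain ⟨γ, π, h1, h2, h3, h4, h5⟩ := hE.shear A B Y hAB hY
  refine ⟨π X, h1 X hX, fun v hv => ?_⟩
  have hw := h5 v hv
  have hy : γ v ∈ E Y := by rw [← h4]; exact h3 B v hv
  have e1 : pr A Y v = -(γ v - v) := by
    refine hE.pr_eq hpr hY.symm ((E A).neg_mem hw) ?_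
    have e : v - -(γ v - v) = γ v := by abel
    rwa [e]
  obtain ⟨b1, b2⟩ := hpr A X hX.symm v
  refine hE.pr_eq hpr (h1 X hX).symm ((E A).add_mem b1 (by rw [e1]; exact (E A).neg_mem hw)) ?_
  have h6 := h3 X _ b2
  rw [map_sub, h2 _ b1] at h6
  have e : v - (pr A X v + pr A Y v) = γ v - pr A X v := by rw [e1]; abel
  rwa [e]

theorem Trl.field {T Λ : Type} [AddCommGroup T] {E : Λ → AddSubgroup T} [Finite T] {p : ℕ}
    (hp : p.Prime) (hexp : ∀ t : T, p • t = 0) (hE : Trl E) {X0 X1 Xi : Λ} (h01 : X0 ≠ X1)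
    (h0i : X0 ≠ Xi) (h1i : X1 ≠ Xi) (hnt : ∃ t ∈ E X0, t ≠ 0) :
    ∃ (F : Type) (_ : Field F) (_ : Finite F) (x y : T → F) (s : Λ → F),
      (∀ t u, x (t - u) = x t - x u) ∧ (∀ t u, y (t - u) = y t - y u) ∧
      (∀ a b, ∃ t, x t = a ∧ y t = b) ∧ (∀ c, ∃ X, X ≠ Xi ∧ s X = c) ∧
      (∀ X, X ≠ Xi → ∀ t, t ∈ E X ↔ s X * x t = y t) ∧ (∀ t, t ∈ E Xi ↔ x t = 0) := by
  classical
  obtain ⟨pr, hpr'⟩ := hE.exists_pr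
  have hpr : IsPr E pr := hpr'
  have pr0 : ∀ {X Y}, X ≠ Y → ∀ {t}, pr X Y t = 0 → t ∈ E Y := by
    intro X Y hXY t h
    have := (hpr X Y hXY t).2
    rwa [h, sub_zero] at this
  let V := E X0
  have hV : Nontrivial V := by
    obtain ⟨t, h1, h2⟩ := hnt
    exact ⟨⟨t, h1⟩, 0, fun h => h2 (congrArg Subtype.val h)⟩
  let s : Λ → AddMonoid.End V := fun X =>
    (((pr X0 X1).comp (pr Xi X)).comp V.subtype).codRestrict V (fun v => (hpr X0 X1 h01 _).1)
  let r : Λ → AddMonoid.End V := fun X =>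
    if h : X0 ≠ X then
    (((pr X0 X).comp (pr Xi X1)).comp V.subtype).codRestrict V (fun v => (hpr X0 X h _).1) else 0
  have hs : ∀ X (v : V), ((s X v : V) : T) = pr X0 X1 (pr Xi X v) := fun X v => rfl
  have hr : ∀ X, X0 ≠ X → ∀ (v : V), ((r X v : V) : T) = pr X0 X (pr Xi X1 v) := by
    intro X hX v
    have e : r X = (((pr X0 X).comp (pr Xi X1)).comp V.subtype).codRestrict V
        (fun v => (hpr X0 X hX _).1) := dif_pos hX
    rw [e]; rfl
  have hs0 : s X0 = 0 := by
    ext v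
    rw [hs, hE.pr_eq hpr h0i.symm (a := 0) (zero_mem _) (by rw [sub_zero]; exact v.2), map_zero]
    rfl
  have hs1 : s X1 = 1 := by
    ext v
    rw [hs]
    obtain ⟨b1, b2⟩ := hpr Xi X1 h1i.symm v
    refine hE.pr_eq hpr h01 v.2 ?_
    have := (E X1).neg_mem b2
    rwa [neg_sub] at this
  have hsadd : ∀ X Y, X ≠ Xi → Y ≠ Xi → ∃ Z, Z ≠ Xi ∧ s Z = s X + s Y := by
    intro X Y hX hY
    obtain ⟨Z, h1, h2⟩ := hE.pr_add hpr h0i.symm hX hY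
    refine ⟨Z, h1, ?_⟩
    ext v
    change ((s Z v : V) : T) = ((s X v : V) : T) + ((s Y v : V) : T)
    rw [hs, hs, hs, h2 v v.2, map_add]
  let S0 : AddSubmonoid (AddMonoid.End V) :=
    { carrier := {a | ∃ X, X ≠ Xi ∧ s X = a}
      zero_mem' := ⟨X0, h0i, hs0⟩
      add_mem' := by
        rintro _ _ ⟨X, hX, rfl⟩ ⟨Y, hY, rfl⟩
        exact hsadd X Y hX hY }
  have hexp' : ∀ v : V, p • v = 0 := fun v => Subtype.ext (by
    rw [AddSubgroup.coe_nsmul]; exact hexp v)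
  let S : AddSubgroup (AddMonoid.End V) :=
    { S0 with
      neg_mem' := by
        intro a ha
        have h1 : p • a = 0 := by
          ext v
          have := hexp' (a v)
          change ((p • a v : V) : T) = 0
          rw [this]; rfl
        have h2 : -a = (p - 1) • a := by
          obtain ⟨k, hk⟩ := Nat.exists_eq_add_of_lt hp.pos
          rw [zero_add] at hk
          subst hk
          rw [succ_nsmul] at h1
          simp only [Nat.add_sub_cancel]
          exact neg_eq_of_add_eq_zero_left h1
        change -a ∈ S0
        rw [h2]
        exact S0.nsmul_mem ha _ }
  have hS : ∀ a, a ∈ S ↔ ∃ X, X ≠ Xi ∧ s X = a := fun a => Iff.rfl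
  have hsr : ∀ X, X ≠ Xi → X0 ≠ X → s X * r X = 1 := by
    intro X hXi hX
    ext v
    change ((s X (r X v) : V) : T) = v
    rw [hs, hr X hX]
    obtain ⟨u1, u2⟩ := hpr Xi X1 h1i.symm v
    obtain ⟨a1, a2⟩ := hpr X0 X hX (pr Xi X1 v)
    have e1 : pr Xi X (pr X0 X (pr Xi X1 v)) = pr Xi X1 v := by
      refine hE.pr_eq hpr hXi.symm u1 ?_
      have := (E X).neg_mem a2
      rwa [neg_sub] at this
    rw [e1]
    refine hE.pr_eq hpr h01 v.2 ?_
    have := (E X1).neg_mem u2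
    rwa [neg_sub] at this
  have hrs : ∀ X, X ≠ Xi → X0 ≠ X → r X * s X = 1 := by
    intro X hXi hX
    ext v
    change ((r X (s X v) : V) : T) = v
    rw [hr X hX, hs]
    obtain ⟨u1, u2⟩ := hpr Xi X hXi.symm v
    obtain ⟨a1, a2⟩ := hpr X0 X1 h01 (pr Xi X v)
    have e1 : pr Xi X1 (pr X0 X1 (pr Xi X v)) = pr Xi X v := by
      refine hE.pr_eq hpr h1i.symm u1 ?_
      have := (E X1).neg_mem a2
      rwa [neg_sub] at this
    rw [e1]
    refine hE.pr_eq hpr hX v.2 ?_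
    have := (E X).neg_mem u2
    rwa [neg_sub] at this
  have hkey : ∀ X, X ≠ Xi → ∀ b ∈ E Xi, ∀ v : V, pr X0 X1 (pr Xi X v) = pr X0 X1 b →
      pr Xi X v = b := by
    intro X hX b hb v h
    have h1 : pr X0 X1 (pr Xi X v - b) = 0 := by rw [map_sub, h, sub_self]
    have h2 := hE.disj Xi X1 h1i.symm _ ((E Xi).sub_mem (hpr Xi X hX.symm v).1 hb) (pr0 h01 h1)
    exact sub_eq_zero.1 h2
  have hsp : Spread S := by
    refine ⟨⟨X1, h1i, hs1⟩, ?_, ?_, ?_, ?_⟩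
    · rintro _ ⟨X, hX, rfl⟩ v hv h
      have h1 : pr X0 X1 (pr Xi X v) = pr X0 X1 0 := by rw [← hs, h, map_zero]; rfl
      have h2 := pr0 hX.symm (hkey X hX 0 (zero_mem _) v h1)
      have h3 : X = X0 := by
        by_contra hc
        exact hv (Subtype.ext (hE.disj X X0 hc _ h2 v.2))
      rw [h3, hs0]
    · intro v w hv
      obtain ⟨b1, b2⟩ := hpr Xi X1 h1i.symm w
      obtain ⟨X, hX⟩ := hE.cover ((v : T) - pr Xi X1 w)
      have hXi : X ≠ Xi := by
        rintro rfl
        have h1 := (E X).add_mem hX b1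
        rw [sub_add_cancel] at h1
        exact hv (Subtype.ext (hE.disj X0 X h0i _ v.2 h1))
      refine ⟨s X, ⟨X, hXi, rfl⟩, Subtype.ext ?_⟩
      rw [hs, hE.pr_eq hpr hXi.symm b1 hX]
      refine hE.pr_eq hpr h01 w.2 ?_
      have := (E X1).neg_mem b2
      rwa [neg_sub] at this
    · rintro _ ⟨X, hX, rfl⟩ h
      have h0 : X0 ≠ X := by rintro rfl; exact h hs0
      exact ⟨r X, hsr X hX h0, hrs X hX h0⟩
    · rintro _ ⟨X, hX, rfl⟩ _ ⟨Y, hY, rfl⟩ a' b' a1 a2 b1 b2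
      have hne : (0 : AddMonoid.End V) ≠ 1 := by
        intro h
        obtain ⟨v, hv⟩ := exists_ne (0 : V)
        exact hv (congrArg (fun f : AddMonoid.End V => f v) h).symm
      have hX0 : X0 ≠ X := by
        rintro rfl; rw [hs0, zero_mul] at a1; exact hne a1
      have hY0 : X0 ≠ Y := by
        rintro rfl; rw [hs0, zero_mul] at b1; exact hne b1
      have ea : a' = r X := left_inv_eq_right_inv a2 (hsr X hX hX0)
      have eb : b' = r Y := left_inv_eq_right_inv b2 (hsr Y hY hY0)
      obtain ⟨Z, h1, h2⟩ := hE.pr_add hpr h0i hX0.symm hY0.symm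
      have e3 : ∀ v, (((a' + b') v : V) : T) = pr X0 Z (pr Xi X1 v) := by
        intro v
        rw [ea, eb]
        change ((r X v : V) : T) + ((r Y v : V) : T) = _
        rw [hr X hX0, hr Y hY0, h2 _ (hpr Xi X1 h1i.symm v).1]
      by_cases hZ : Z = Xi
      · left
        ext v
        rw [e3, hZ]
        change _ = (0 : T)
        exact hE.pr_eq hpr h0i (zero_mem _) (by rw [sub_zero]; exact (hpr Xi X1 h1i.symm v).1)
      · right
        refine ⟨s Z, ⟨Z, hZ, rfl⟩, ?_⟩
        have : a' + b' = r Z := by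
          ext v
          rw [e3, hr Z h1.symm]
        rw [this]
        exact hsr Z hZ h1.symm
  obtain ⟨F, hF, hFin, ι, ev, hι, hιS, hev, hmul, hsub⟩ := hsp.field hp hexp'
  let e : F ≃ V := Equiv.ofBijective ev hev
  have hes : ∀ v w, e.symm (v - w) = e.symm v - e.symm w := by
    intro v w
    rw [Equiv.symm_apply_eq]
    change _ = ev _
    rw [hsub]
    change _ = e _ - e _
    simp
  have hch : ∀ X, ∃ c, X ≠ Xi → ι c = s X := by
    intro X
    by_cases hX : X = Xi
    · exact ⟨0, fun h => absurd hX h⟩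
    · obtain ⟨c, hc⟩ := (hιS (s X)).1 ⟨X, hX, rfl⟩
      exact ⟨c, fun _ => hc⟩
  choose σ hσ using hch
  let a : T → V := fun t => ⟨pr X0 Xi t, (hpr X0 Xi h0i t).1⟩
  let b : T → V := fun t => ⟨pr X0 X1 (pr Xi X0 (-t)), (hpr X0 X1 h01 _).1⟩
  refine ⟨F, hF, hFin, fun t => e.symm (a t), fun t => e.symm (b t), σ, ?_, ?_, ?_, ?_, ?_, ?_⟩
  · intro t u
    change e.symm (a (t - u)) = e.symm (a t) - e.symm (a u)
    rw [← hes]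
    exact congrArg e.symm (Subtype.ext (by simp [a]))
  · intro t u
    change e.symm (b (t - u)) = e.symm (b t) - e.symm (b u)
    rw [← hes]
    refine congrArg e.symm (Subtype.ext ?_)
    simp only [b, AddSubgroup.coe_sub, map_sub, map_neg]
    abel
  · intro α β
    obtain ⟨b1, b2⟩ := hpr Xi X1 h1i.symm (e β : V)
    refine ⟨(e α : V) - pr Xi X1 (e β : V), ?_, ?_⟩
    · rw [Equiv.symm_apply_eq]
      refine Subtype.ext (hE.pr_eq hpr h0i (e α).2 ?_)
      have e1 : ((e α : V) : T) - pr Xi X1 (e β : V) - (e α : V) = -pr Xi X1 (e β : V) := by abel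
      rw [e1]
      exact (E Xi).neg_mem b1
    · rw [Equiv.symm_apply_eq]
      refine Subtype.ext ?_
      have e2 : pr Xi X0 (-(((e α : V) : T) - pr Xi X1 (e β : V))) = pr Xi X1 (e β : V) := by
        refine hE.pr_eq hpr h0i.symm b1 ?_
        have e1 : -(((e α : V) : T) - pr Xi X1 (e β : V)) - pr Xi X1 (e β : V) = -(e α : V) := by
          abel
        rw [e1]
        exact (E X0).neg_mem (e α).2
      simp only [b]
      rw [e2]
      refine hE.pr_eq hpr h01 (e β).2 ?_
      have := (E X1).neg_mem b2
      rwa [neg_sub] at this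
  · intro c
    obtain ⟨X, hX, h⟩ := (hιS (ι c)).2 ⟨c, rfl⟩
    exact ⟨X, hX, hι ((hσ X hX).trans h)⟩
  · intro X hX t
    have h1 : σ X * e.symm (a t) = e.symm (b t) ↔ s X (a t) = b t := by
      rw [Equiv.eq_symm_apply]
      change ev _ = _ ↔ _
      rw [hmul, hσ X hX]
      change s X (e _) = _ ↔ _
      rw [Equiv.apply_symm_apply]
    rw [h1]
    have hbt : pr Xi X0 (-t) = -(t - pr X0 Xi t) := by
      obtain ⟨k1, k2⟩ := hpr X0 Xi h0i t
      refine hE.pr_eq hpr h0i.symm ((E Xi).neg_mem k2) ?_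
      have e1 : -t - -(t - pr X0 Xi t) = - pr X0 Xi t := by abel
      rw [e1]
      exact (E X0).neg_mem k1
    have hb' : pr Xi X0 (-t) ∈ E Xi := (hpr Xi X0 h0i.symm _).1
    constructor
    · intro ht
      refine Subtype.ext ?_
      rw [hs]
      have : pr Xi X (a t) = pr Xi X0 (-t) := by
        refine hE.pr_eq hpr hX.symm hb' ?_
        rw [hbt]
        have e1 : ((a t : V) : T) - -(t - pr X0 Xi t) = t := by simp only [a]; abel
        rwa [e1]
      rw [this]
    · intro h
      have h2 : pr X0 X1 (pr Xi X (a t)) = pr X0 X1 (pr Xi X0 (-t)) := by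
        rw [← hs, h]
      have h3 := hkey X hX _ hb' (a t) h2
      have h4 := (hpr Xi X hX.symm (a t)).2
      rw [h3, hbt] at h4
      have e1 : ((a t : V) : T) - -(t - pr X0 Xi t) = t := by simp only [a]; abel
      rwa [e1] at h4
  · intro t
    have h0 : e.symm (a t) = 0 ↔ a t = 0 := by
      have : e.symm 0 = 0 := by
        have := hes 0 0
        rwa [sub_zero, sub_self] at this
      constructor
      · intro h; exact e.symm.injective (h.trans this.symm)
      · intro h; rw [h, this]
    rw [h0]
    constructor
    · intro ht
      exact Subtype.ext (hE.pr_eq hpr h0i (a := (0 : T)) (zero_mem _) (by rwa [sub_zero]))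
    · intro h
      exact pr0 h0i (congrArg Subtype.val h)

end tr
end AF

namespace AF

section geo

variable {G P L : Type*} [Group G] [MulAction G P] [MulAction G L] {n : ℕ} {I : P → L → Prop}
variable [Finite P] [Finite L] [Finite G]

theorem ElA.off (hP : Plane I n) (h : Pres G I) {g : G} {l : L} (hg : ElA I g l) {p : P}
    (hp : ¬ I p l) : ¬ I (g • p) l := by
  intro hc
  have := h.fixP' (hP.axis_fix h hg.1) (p := p)
  tauto

theorem ElA.inv {g : G} {l : L} (hg : ElA I g l) : ElA I g⁻¹ l :=
  ⟨hg.1.inv, hg.2.choose, hg.2.choose_spec.1, hg.2.choose_spec.2.inv⟩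

theorem ElA.of {X : P} {l : L} (hX : I X l) {g : G} (hg : g ∈ EC G I X l) : ElA I g l :=
  ⟨hg.1, X, hX, hg.2⟩

theorem ElA.ext (hP : Plane I n) (h : Pres G I) (hF : Fth G P) {g k : G} {l : L} (hg : ElA I g l)
    (hk : ElA I k l) {p : P} (hp : ¬ I p l) (he : g • p = k • p) : g = k := by
  have h1 := ElA.free hP h hF (ElA.mul hP h hF hk.inv hg) hp (by
    rw [mul_smul, he, inv_smul_smul])
  exact (inv_mul_eq_one.1 h1).symm

theorem ElA.mem_iff (hP : Plane I n) (h : Pres G I) (ht : AFT G I) (hF : Fth G P)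
    (he : ∃ e : G, Elat I e) {g : G} {l m : L} (hg : ElA I g l) {p X : P} (hp : ¬ I p l)
    (hX : I X l) (hXm : I X m) (hpm : I p m) : g ∈ EC G I X l ↔ I (g • p) m := by
  constructor
  · intro hgX
    exact h.fixP (hgX.2 m hXm) hpm
  · intro hgp
    have hml : m ≠ l := by rintro rfl; exact hp hpm
    have h1 := hg.off hP h hp
    obtain ⟨w, w1, w2, w3⟩ := EC.trans hP h ht hF he hX hXm hml hpm (by rintro rfl; exact hp hX)
      hgp (by intro hc; rw [hc] at h1; exact h1 hX)
    have : g = w := ElA.ext hP h hF hg ⟨w1, X, hX, w2⟩ hp w3.symm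
    rw [this]; exact ⟨w1, w2⟩

theorem ElA.reach (hP : Plane I n) (h : Pres G I) (ht : AFT G I) (hF : Fth G P)
    (he : ∃ e : G, Elat I e) {l : L} {p q X Y : P} (hp : ¬ I p l) (hq : ¬ I q l)
    (hX : I X l) (hY : I Y l) (hXY : X ≠ Y) :
    ∃ a ∈ EC G I X l, ∃ b ∈ EC G I Y l, (b * a) • p = q := by
  obtain ⟨m, m1, m2⟩ := hP.ln p X
  obtain ⟨k, k1, k2⟩ := hP.ln q Y
  obtain ⟨r, r1, r2⟩ := hP.pt m k
  have hml : m ≠ l := by rintro rfl; exact hp m1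
  have hkl : k ≠ l := by rintro rfl; exact hq k1
  have hr : ¬ I r l := by
    intro hc
    have e1 : r = X := hP.eqP hml r1 hc m2 hX
    have e2 : r = Y := hP.eqP hkl r2 hc k2 hY
    exact hXY (e1.symm.trans e2)
  have ne : ∀ {a b : P}, ¬ I a l → I b l → a ≠ b := by
    rintro a b h1 h2 rfl; exact h1 h2
  obtain ⟨a, a1, a2, a3⟩ := EC.trans hP h ht hF he hX m2 hml m1 (ne hp hX) r1 (ne hr hX)
  obtain ⟨b, b1, b2, b3⟩ := EC.trans hP h ht hF he hY k2 hkl r2 (ne hr hY) k1 (ne hq hY)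
  exact ⟨a, ⟨a1, a2⟩, b, ⟨b1, b2⟩, by rw [mul_smul, a3, b3]⟩

theorem ElA.conj (h : Pres G I) {g k : G} {l : L} (hg : ElA I g l) (hk : k • l = l) :
    ElA I (k * g * k⁻¹) l := by
  obtain ⟨h1, c, h2, h3⟩ := hg
  refine ⟨?_, k • c, h.fixP hk h2, h3.conj h k⟩
  have := h1.conj h k
  rwa [hk] at this

theorem ElA.shear (hP : Plane I n) (h : Pres G I) (ht : AFT G I) (hF : Fth G P)
    (he : ∃ e : G, Elat I e) {l : L} {O A B Y : P} (hO : ¬ I O l) (hA : I A l) (hB : I B l)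
    (hY : I Y l) (hAB : A ≠ B) (hYA : Y ≠ A) :
    ∃ g : G, g • l = l ∧ g • A = A ∧ g • B = Y ∧ (∀ b ∈ EC G I A l, g * b * g⁻¹ = b) ∧
      ∀ a, ElA I a l → g * a * g⁻¹ * a⁻¹ ∈ EC G I A l := by
  obtain ⟨m, m1, m2⟩ := hP.ln O A
  have hml : m ≠ l := by rintro rfl; exact hO m1
  obtain ⟨g, g1, g2, g3⟩ := EC.trans hP h ht hF he m2 hA hml.symm hB hAB.symm hY hYA
  have gl : g • l = l := g2 l hA
  have gO : g⁻¹ • O = O := by rw [inv_smul_eq_iff, g1 O m1]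
  refine ⟨g, gl, g1 A m2, g3, ?_, ?_⟩
  · intro b hb
    have hb' := ElA.of hA hb
    refine ElA.ext hP h hF (hb'.conj h gl) hb' hO ?_
    rw [mul_smul, mul_smul, gO]
    exact g1 _ (h.fixP (hb.2 m m2) m1)
  · intro a ha
    obtain ⟨k, k1, k2⟩ := hP.ln (a • O) A
    rw [ElA.mem_iff hP h ht hF he (ElA.mul hP h hF (ha.conj h gl) ha.inv) (ha.off hP h hO) hA k2 k1]
    rw [mul_smul, inv_smul_smul, mul_smul, mul_smul, gO]
    exact h.fixP (g2 k k2) k1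

/-- the additive translation group -/
@[reducible] def TA (hP : Plane I n) (h : Pres G I) (hF : Fth G P) (l : L)
    (hc : ∀ g k : G, ElA I g l → ElA I k l → g * k = k * g) :
    AddCommGroup (Additive (EA hP h hF l)) :=
  { (inferInstance : AddGroup (Additive (EA hP h hF l))) with
    add_comm := fun a b => Subtype.ext (hc a.toMul.1 b.toMul.1 a.toMul.2 b.toMul.2) }

/-- translations with given direction -/
def TE (hP : Plane I n) (h : Pres G I) (hF : Fth G P) (l : L) (X : {X : P // I X l}) :
    AddSubgroup (Additive (EA hP h hF l)) :=
  Subgroup.toAddSubgroup ((EC G I X.1 l).subgroupOf (EA hP h hF l))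

theorem mem_TE {hP : Plane I n} {h : Pres G I} {hF : Fth G P} {l : L} {X : {X : P // I X l}}
    {t : Additive (EA hP h hF l)} : t ∈ TE hP h hF l X ↔ (t.toMul : G) ∈ EC G I X.1 l := Iff.rfl

theorem TA_sub {hP : Plane I n} {h : Pres G I} {hF : Fth G P} {l : L}
    (hc : ∀ g k : G, ElA I g l → ElA I k l → g * k = k * g) (a b : Additive (EA hP h hF l)) :
    ((a - b).toMul : G) = a.toMul * (b.toMul : G)⁻¹ := by
  rw [toMul_sub, div_eq_mul_inv]; rfl

theorem trl (hP : Plane I n) (h : Pres G I) (ht : AFT G I) (hF : Fth G P)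
    (he : ∃ e : G, Elat I e) {l : L} {O : P} (hO : ¬ I O l)
    (hc : ∀ g k : G, ElA I g l → ElA I k l → g * k = k * g) :
    @Trl _ _ (TA hP h hF l hc) (TE hP h hF l) := by
  let inst := TA hP h hF l hc
  refine @Trl.mk _ _ inst _ ?_ ?_ ?_ ?_
  · intro t
    obtain ⟨h1, c, h2, h3⟩ := t.toMul.2
    exact ⟨⟨c, h2⟩, mem_TE.2 ⟨h1, h3⟩⟩
  · intro X Y hXY t h1 h2
    have h3 : (t.toMul : G) = 1 := by
      refine hF _ (hP.two_centers h (fun hc => hXY (Subtype.ext hc)) (mem_TE.1 h1).2 (mem_TE.1 h2).2)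
    exact Subtype.ext h3
  · intro X Y hXY t
    have tO := ElA.off hP h (t.toMul.2 : ElA I _ l) hO
    obtain ⟨a, ha, b, hb, e⟩ := ElA.reach hP h ht hF he hO tO X.2 Y.2
      (fun hc => hXY (Subtype.ext hc))
    have ha' := ElA.of X.2 ha
    have hb' := ElA.of Y.2 hb
    have e2 : b * a = t.toMul := ElA.ext hP h hF (ElA.mul hP h hF hb' ha') t.toMul.2 hO e
    let u : Additive (EA hP h hF l) := Additive.ofMul (⟨a, ha'⟩ : EA hP h hF l)
    refine ⟨u, ha, mem_TE.2 ?_⟩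
    have e3 := TA_sub hc t u
    have e4 : ((t - u).toMul : G) = b := by
      refine e3.trans ?_
      rw [← e2]
      exact mul_inv_cancel_right b a
    rw [e4]; exact hb
  · intro A B Y hAB hYA
    obtain ⟨g, gl, gA, gB, g1, g2⟩ := ElA.shear hP h ht hF he hO A.2 B.2 Y.2
      (fun hc => hAB (Subtype.ext hc)) (fun hc => hYA (Subtype.ext hc))
    let f : EA hP h hF l →* EA hP h hF l :=
      { toFun := fun t => ⟨g * t.1 * g⁻¹, ElA.conj h t.2 gl⟩
        map_one' := Subtype.ext (by simp)
        map_mul' := fun a b => Subtype.ext (by simp) }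
    refine ⟨MonoidHom.toAdditive f, fun X => ⟨g • X.1, h.fixP gl X.2⟩, ?_, ?_, ?_, ?_, ?_⟩
    · intro X hX hc
      have := congrArg Subtype.val hc
      change g • X.1 = A.1 at this
      rw [← gA] at this
      exact hX (Subtype.ext (smul_left_cancel g this))
    · intro b hb
      exact Subtype.ext (g1 _ hb)
    · intro X t hX
      refine mem_TE.2 ⟨?_, (mem_TE.1 hX).2.conj h g⟩
      have := (mem_TE.1 hX).1.conj h g
      rwa [gl] at this
    · exact Subtype.ext gB
    · intro a ha
      refine mem_TE.2 ?_
      have e3 := TA_sub hc (MonoidHom.toAdditive f a) a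
      have := g2 _ a.toMul.2
      exact e3 ▸ this

end geo

theorem desarg_of_elat {G P L : Type} [Group G] [MulAction G P] [MulAction G L] {n : ℕ}
    {I : P → L → Prop} [Finite P] [Finite L] [Finite G]
    (hP : Plane I n) (h : Pres G I) (ht : AFT G I) (hF : Fth G P)
    (he : ∃ e : G, Elat I e) :
    ∃ (F : Type) (hF : Field F), Finite F ∧ @IsDesarguesianOver F hF P L I := by
  classical
  obtain ⟨p, k, hp, -, -, hgl⟩ := hP.gleason h ht hF he
  obtain ⟨l⟩ : Nonempty L := by
    obtain ⟨-, -, -, l, -⟩ := hP.nd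
    exact ⟨l⟩
  obtain ⟨O, hO, -⟩ := hP.pt_off l l
  obtain ⟨X0, hX0⟩ := hP.line_pt l
  obtain ⟨X1, hX1, h10, -⟩ := hP.pt_on l X0 X0
  obtain ⟨Xi, hXi, hi0, hi1⟩ := hP.pt_on l X0 X1
  have hc : ∀ g k : G, ElA I g l → ElA I k l → g * k = k * g := fun g k h1 h2 => (hgl l g h1).2 k h2
  have hT := trl hP h ht hF he hO hc
  let inst := TA hP h hF l hc
  have hexp : ∀ t : Additive (EA hP h hF l), p • t = 0 := by
    intro t
    exact Subtype.ext (hgl l _ t.toMul.2).1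
  have hnt : ∃ t ∈ TE hP h hF l ⟨X0, hX0⟩, t ≠ 0 := by
    obtain ⟨m, m1, m2⟩ := hP.ln O X0
    have hml : m ≠ l := by rintro rfl; exact hO m1
    obtain ⟨q, q1, q2, q3⟩ := hP.pt_on m O X0
    obtain ⟨w, w1, w2, w3⟩ := EC.trans hP h ht hF he hX0 m2 hml m1 (by rintro rfl; exact hO hX0)
      q1 q3
    refine ⟨Additive.ofMul ⟨w, w1, X0, hX0, w2⟩, ⟨w1, w2⟩, fun hz => q2 ?_⟩
    have hw : w = 1 := congrArg (fun t : Additive (EA hP h hF l) => (t.toMul : G)) hz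
    rw [← w3, hw, one_smul]
  obtain ⟨F, hFi, hFin, x, y, s, hx, hy, hxy, hs, hsl, hinf⟩ := @Trl.field _ _ inst _ _ _ hp hexp hT
    ⟨X0, hX0⟩ ⟨X1, hX1⟩ ⟨Xi, hXi⟩ (fun hc => h10 (congrArg Subtype.val hc).symm)
    (fun hc => hi0 (congrArg Subtype.val hc).symm) (fun hc => hi1 (congrArg Subtype.val hc).symm) hnt
  have hex : ∀ q : P, ∃ t : Additive (EA hP h hF l), ¬ I q l → (t.toMul : G) • O = q := by
    intro q
    by_cases hq : I q l
    · exact ⟨0, fun h => absurd hq h⟩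
    · obtain ⟨a, ha, b, hb, e⟩ := ElA.reach hP h ht hF he hO hq hX0 hX1 h10.symm
      exact ⟨Additive.ofMul ⟨b * a, ElA.mul hP h hF (ElA.of hX1 hb) (ElA.of hX0 ha)⟩, fun _ => e⟩
  choose τ hτ using hex
  have key : ∀ (q r X : P) (m : L) (hX : I X l), ¬ I q l → ¬ I r l → I X m → I r m →
      (I q m ↔ τ q - τ r ∈ TE hP h hF l ⟨X, hX⟩) := by
    intro q r X m hX hq hr hXm hrm
    rw [mem_TE]
    have e1 := TA_sub hc (τ q) (τ r)
    have e2 : ((τ q - τ r).toMul : G) • r = q := by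
      refine (congrArg (fun u : G => u • r) e1).trans ?_
      change (_ * _ : G) • r = q
      have e5 : ((τ r).toMul : G)⁻¹ • r = O := by
        rw [inv_smul_eq_iff]; exact (hτ r hr).symm
      rw [mul_smul, e5, hτ q hq]
    rw [ElA.mem_iff hP h ht hF he (τ q - τ r).toMul.2 hr hX hXm hrm, e2]
  refine ⟨F, hFi, hFin, coord hP hXi (fun q => x (τ q)) (fun q => y (τ q))
    (fun X => if hX : I X l then s ⟨X, hX⟩ else 0) ?_ ?_ ?_ ?_⟩
  · intro a b
    obtain ⟨t, t1, t2⟩ := hxy a b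
    have hq := ElA.off hP h (t.toMul.2 : ElA I _ l) hO
    have : τ ((t.toMul : G) • O) = t :=
      Subtype.ext (ElA.ext hP h hF (τ _).toMul.2 t.toMul.2 hO (hτ _ hq))
    exact ⟨(t.toMul : G) • O, hq, by simp only [this]; exact t1, by simp only [this]; exact t2⟩
  · intro c
    obtain ⟨X, hX, e⟩ := hs c
    exact ⟨X.1, X.2, fun hc => hX (Subtype.ext hc), by rw [dif_pos X.2]; exact e⟩
  · intro q r m hq hr hrm hXm
    rw [key q r Xi m hXi hq hr hXm hrm]
    refine (hinf _).trans ?_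
    rw [hx, sub_eq_zero]
  · intro q r X m hq hr hX hne hXm hrm
    rw [key q r X m hX hq hr hXm hrm]
    refine (hsl ⟨X, hX⟩ (fun hc => hne (congrArg Subtype.val hc)) _).trans ?_
    rw [hx, hy, dif_pos hX]

end AF

namespace AF

/-- automorphisms -/
def AutG {P L : Type*} (I : P → L → Prop) : Subgroup (Equiv.Perm P × Equiv.Perm L) where
  carrier := {g | ∀ p l, I p l ↔ I (g.1 p) (g.2 l)}
  mul_mem' := fun {a b} ha hb p l => (hb p l).trans (ha _ _)
  one_mem' := fun p l => Iff.rfl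
  inv_mem' := fun {a} ha p l => by
    have := ha (a.1.symm p) (a.2.symm l)
    rw [Equiv.apply_symm_apply, Equiv.apply_symm_apply] at this
    exact this.symm

instance autP {P L : Type*} (I : P → L → Prop) : MulAction (AutG I) P where
  smul g p := g.1.1 p
  one_smul p := rfl
  mul_smul a b p := rfl

instance autL {P L : Type*} (I : P → L → Prop) : MulAction (AutG I) L where
  smul g p := g.1.2 p
  one_smul p := rfl
  mul_smul a b p := rfl

theorem desarg_of_aft_type {P L : Type} [Finite P] [Finite L] {I : P → L → Prop} (hI : PP I)
    (ht : ∀ (p : P) (M : L) (p' : P) (M' : L), ¬ I p M → ¬ I p' M' →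
      ∃ (s : Equiv.Perm P) (t : Equiv.Perm L),
        (∀ (q : P) (N : L), I q N ↔ I (s q) (t N)) ∧ s p = p' ∧ t M = M') :
    ∃ (F : Type) (hF : Field F), Finite F ∧ @IsDesarguesianOver F hF P L I := by
  obtain ⟨n, hP⟩ := hI.exists_plane
  have h : Pres (AutG I) I := fun g p l hpl => (g.2 p l).1 hpl
  have ht' : AFT (AutG I) I := by
    intro p l p' l' h1 h2
    obtain ⟨s, t, h3, h4, h5⟩ := ht p l p' l' h1 h2
    exact ⟨⟨(s, t), h3⟩, h4, h5⟩
  have hF : Fth (AutG I) P := by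
    intro k hk
    have hl := hP.trivL h hk
    apply Subtype.ext
    exact Prod.ext (Equiv.ext hk) (Equiv.ext hl)
  obtain ⟨-, -, -, -, e, he, -⟩ := main_E _ (AutG I) P L I n le_rfl hP h ht'
  exact desarg_of_elat hP h ht' hF ⟨e, he⟩

theorem desarg_of_aft {P L : Type*} [Finite P] [Finite L] {I : P → L → Prop} (hI : PP I)
    (ht : ∀ (p : P) (M : L) (p' : P) (M' : L), ¬ I p M → ¬ I p' M' →
      ∃ (s : Equiv.Perm P) (t : Equiv.Perm L),
        (∀ (q : P) (N : L), I q N ↔ I (s q) (t N)) ∧ s p = p' ∧ t M = M') :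
    ∃ (F : Type) (hF : Field F), Finite F ∧ @IsDesarguesianOver F hF P L I := by
  let a := Finite.equivFin P
  let b := Finite.equivFin L
  let J : Fin (Nat.card P) → Fin (Nat.card L) → Prop := fun p l => I (a.symm p) (b.symm l)
  have hJ : PP J := by
    refine ⟨?_, ?_, ?_, ?_⟩
    · intro p q
      obtain ⟨l, h1, h2⟩ := hI.ln (a.symm p) (a.symm q)
      exact ⟨b l, by simpa [J] using h1, by simpa [J] using h2⟩
    · intro p q
      obtain ⟨l, h1, h2⟩ := hI.pt (b.symm p) (b.symm q)
      exact ⟨a l, by simpa [J] using h1, by simpa [J] using h2⟩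
    · intro p q l m h1 h2 h3 h4
      rcases hI.uq h1 h2 h3 h4 with h5 | h5
      · exact Or.inl (a.symm.injective h5)
      · exact Or.inr (b.symm.injective h5)
    · obtain ⟨p1, p2, p3, l1, l2, l3, h⟩ := hI.nd
      exact ⟨a p1, a p2, a p3, b l1, b l2, b l3, by simpa [J] using h⟩
  obtain ⟨F, hF, hFin, σ, τ, h⟩ := desarg_of_aft_type hJ (by
    intro p M p' M' h1 h2
    obtain ⟨s, t, h3, h4, h5⟩ := ht _ _ _ _ h1 h2
    refine ⟨(a.symm.trans s).trans a, (b.symm.trans t).trans b, ?_, ?_, ?_⟩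
    · intro q N
      simpa [J] using h3 (a.symm q) (b.symm N)
    · simp [h4]
    · simp [h5])
  refine ⟨F, hF, hFin, a.trans σ, b.trans τ, ?_⟩
  intro p M
  have := h (a p) (b M)
  simpa [J] using this

end AF

theorem desarguesian_iff_antiflag_transitive {P L : Type*} [Finite P] [Finite L]
    (I : P → L → Prop) (hplane : IsProjectivePlane I) :
    (∃ (F : Type) (hF : Field F), Finite F ∧ @IsDesarguesianOver F hF P L I) ↔
    (∀ (p : P) (M : L) (p' : P) (M' : L), ¬ I p M → ¬ I p' M' →
      ∃ (s : Equiv.Perm P) (t : Equiv.Perm L),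
        (∀ (q : P) (N : L), I q N ↔ I (s q) (t N)) ∧ s p = p' ∧ t M = M') := by
  constructor
  · rintro ⟨F, hF, -, h⟩ p M p' M' h1 h2
    exact AF.desarg_aft h p M p' M' h1 h2
  · intro ht
    exact AF.desarg_of_aft (AF.PP.of_isPP hplane) ht
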